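/- arXiv:1701.08321 — 2 statements merged into one kernel-verified Lean document; each statement's English description precedes it below -/
import Mathlib

section
/- If G is a finite-index subgroup of Thompson's group F and G is isomorphic to ⟨X⟩ for some finite geometrically proper set X ⊆ Homeo₊(I), then G is isomorphic to F. -/
open Set

/-- The unit interval `[0,1]` as a type. -/
abbrev UI : Type := ↥unitInterval

/-- Bijections of the unit interval; orientation-preserving homeomorphisms are
exactly the monotone ones among these. -/
abbrev Homeo01 : Type := Equiv.Perm UI

namespace PingPong

/-- The support of `f`. -/
def supt (f : Homeo01) : Set UI := {t | f t ≠ t}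

/-- `f` is an orientation-preserving homeomorphism of `[0,1]`:
a monotone bijection of `[0,1]` (automatically a homeomorphism). -/
def IsOPH (f : Homeo01) : Prop := Monotone ⇑f

/-- A bump function: an orientation preserving homeomorphism with exactly one
orbital, i.e. whose support is nonempty and connected. -/
def IsBump (f : Homeo01) : Prop := IsOPH f ∧ IsConnected (supt f)

/-- A positive bump function. -/
def IsPosBump (f : Homeo01) : Prop := IsBump f ∧ ∀ t ∈ supt f, t < f t

/-- The source of a positive bump `a` with marker `t`. -/
def src (a : Homeo01) (t : UI) : Set UI := {s ∈ supt a | s < t}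

/-- The destination of a positive bump `a` with marker `t`. -/
def dest (a : Homeo01) (t : UI) : Set UI := {s ∈ supt a | a t ≤ s}

/-- `m` is a marking of the collection `A` of bumps. -/
def IsMarking (A : Set Homeo01) (m : Homeo01 → UI) : Prop := ∀ a ∈ A, m a ∈ supt a

/-- The feet of a marked bump: `false` gives the source, `true` the destination. -/
def foot (a : Homeo01) (t : UI) : Bool → Set UI
  | false => src a t
  | true => dest a t

/-- The feet of the marked family `(A, m)` are pairwise disjoint. -/
def FeetDisjoint (A : Set Homeo01) (m : Homeo01 → UI) : Prop :=
  ∀ a ∈ A, ∀ b ∈ A, ∀ i j : Bool, (a, i) ≠ (b, j) →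
    Disjoint (foot a (m a) i) (foot b (m b) j)

/-- A geometrically fast collection of (positive) bumps. -/
def FastBumps (A : Set Homeo01) : Prop :=
  (∀ a ∈ A, IsPosBump a) ∧ ∃ m : Homeo01 → UI, IsMarking A m ∧ FeetDisjoint A m

/-- `t` is a left transition point of `f`. -/
def IsLeftTransition (f : Homeo01) (t : UI) : Prop :=
  t ∉ supt f ∧ ∀ ε : ℝ, 0 < ε → ∃ s ∈ supt f, t < s ∧ (s : ℝ) < (t : ℝ) + ε

/-- `t` is a right transition point of `f`. -/
def IsRightTransition (f : Homeo01) (t : UI) : Prop :=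
  t ∉ supt f ∧ ∀ ε : ℝ, 0 < ε → ∃ s ∈ supt f, s < t ∧ (t : ℝ) - ε < (s : ℝ)

/-- `t` is a transition point of `f`. -/
def IsTransition (f : Homeo01) (t : UI) : Prop :=
  IsLeftTransition f t ∨ IsRightTransition f t

/-- A geometrically proper set of homeomorphisms. -/
def GeomProper (X : Set Homeo01) : Prop :=
  (∀ f ∈ X, ∀ g ∈ X, f ≠ g → ∀ t : UI, ¬(IsLeftTransition f t ∧ IsLeftTransition g t)) ∧
  (∀ f ∈ X, ∀ g ∈ X, f ≠ g → ∀ t : UI, ¬(IsRightTransition f t ∧ IsRightTransition g t))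

/-- The positive bump `a` is used in `f`. -/
def UsedIn (f a : Homeo01) : Prop :=
  IsPosBump a ∧ (Set.EqOn ⇑f ⇑a (supt a) ∨ Set.EqOn ⇑f ⇑a⁻¹ (supt a))

/-- The set of (positive) bumps used in `X`. -/
def usedBumps (X : Set Homeo01) : Set Homeo01 := {a | ∃ f ∈ X, UsedIn f a}

/-- A geometrically fast set of homeomorphisms. -/
def GeomFast (X : Set Homeo01) : Prop := GeomProper X ∧ FastBumps (usedBumps X)

/-- The set of transition points of elements of `X`. -/
def transitionPoints (X : Set Homeo01) : Set UI := {t | ∃ f ∈ X, IsTransition f t}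

/-! ### Words -/

/-- A word in the alphabet `A^± = A ∪ A⁻¹`, recorded as a list of the permutations
represented by its symbols (for a set `A` of positive bumps this is faithful,
since `A ∩ A⁻¹ = ∅`). -/
def WordOn (A : Set Homeo01) (w : List Homeo01) : Prop := ∀ x ∈ w, x ∈ A ∨ x⁻¹ ∈ A

/-- A freely reduced word: no symbol is immediately followed by its inverse. -/
def FreelyReduced (w : List Homeo01) : Prop := List.Chain' (fun a b => b ≠ a⁻¹) w

/-- The right action of a word on a point: apply the symbols from left to right. -/
def act (t : UI) (w : List Homeo01) : UI := w.foldl (fun s a => a s) t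

/-- `w` is locally reduced at `t`. -/
def LocallyReducedAt (w : List Homeo01) (t : UI) : Prop :=
  FreelyReduced w ∧ ∀ (u : List Homeo01) (a : Homeo01), u ++ [a] <+: w → a (act t u) ≠ act t u

open Classical in
/-- The source of a symbol of `A^±`: for `a ∈ A` it is `src a`, and for the
formal inverse of an element of `A` it is the destination of that element. -/
noncomputable def symSrc (A : Set Homeo01) (m : Homeo01 → UI) (b : Homeo01) : Set UI :=
  if b ∈ A then src b (m b) else dest b⁻¹ (m b⁻¹)

open Classical in
/-- The destination of a symbol of `A^±`. -/
noncomputable def symDest (A : Set Homeo01) (m : Homeo01 → UI) (b : Homeo01) : Set UI :=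
  if b ∈ A then dest b (m b) else src b⁻¹ (m b⁻¹)

/-- The source of a word: the source of its first symbol (empty for the empty word). -/
noncomputable def wordSrc (A : Set Homeo01) (m : Homeo01 → UI) : List Homeo01 → Set UI
  | [] => ∅
  | a :: _ => symSrc A m a

/-- The destination of a word: the destination of its last symbol. -/
noncomputable def wordDest (A : Set Homeo01) (m : Homeo01 → UI) (w : List Homeo01) : Set UI :=
  match w.getLast? with
  | none => ∅
  | some a => symDest A m a

/-- `J(w) = supt(a) \ src(a)` where `a` is the first symbol of `w`. -/
noncomputable def Jset (A : Set Homeo01) (m : Homeo01 → UI) : List Homeo01 → Set UI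
  | [] => ∅
  | a :: _ => supt a \ symSrc A m a

/-- `t` has trivial history: it lies in no foot of any element of `A`. -/
def TrivialHistory (A : Set Homeo01) (m : Homeo01 → UI) (t : UI) : Prop :=
  ∀ a ∈ A, t ∉ src a (m a) ∧ t ∉ dest a (m a)

/-- `x` has finite history: there is a finite bound on the lengths of `A`-words
locally reduced at `x` whose evaluation at `x` is outside their destination. -/
def FiniteHistory (A : Set Homeo01) (m : Homeo01 → UI) (x : UI) : Prop :=
  ∃ n : ℕ, ∀ w : List Homeo01, WordOn A w → LocallyReducedAt w x →
    act x w ∉ wordDest A m w → w.length ≤ n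

/-- A return word for `x`. -/
def IsReturnWord (x : UI) (w : List Homeo01) : Prop := w ≠ [] ∧ act x w = x

/-- `w` has a return prefix for `x`. -/
def HasReturnPrefix (x : UI) (w : List Homeo01) : Prop :=
  ∃ v : List Homeo01, v <+: w ∧ IsReturnWord x v

/-- The set of initial markers of the marked family `(A, m)`. -/
def initialMarkers (A : Set Homeo01) (m : Homeo01 → UI) : Set UI :=
  {t | (∃ a ∈ A, m a = t) ∧ ∀ b ∈ A, m b < t → b (m b) ≠ t}

/-- `M⟨X⟩`: the orbit of the set of initial markers of `(A, m)` under the group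
generated by `X`. -/
def MOrbit (A : Set Homeo01) (m : Homeo01 → UI) (X : Set Homeo01) : Set UI :=
  {u | ∃ t ∈ initialMarkers A m, ∃ g ∈ Subgroup.closure X, g t = u}

end PingPong
namespace PingPong

/-! ### Piecewise linear maps and Thompson's group F -/

/-- `f` is piecewise linear (finitely many affine pieces). -/
def IsPL (f : Homeo01) : Prop :=
  ∃ (n : ℕ) (t : Fin (n + 1) → ℝ), StrictMono t ∧ t 0 = 0 ∧ t (Fin.last n) = 1 ∧
    ∀ i : Fin n, ∃ c d : ℝ, ∀ s : UI,
      t i.castSucc ≤ (s : ℝ) → (s : ℝ) ≤ t i.succ → ((f s : ℝ)) = c * (s : ℝ) + d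

/-- `x` is a dyadic rational. -/
def IsDyadic (x : ℝ) : Prop := ∃ (a : ℤ) (k : ℕ), x = (a : ℝ) / 2 ^ k

/-- `f` belongs to Thompson's group `F`: an orientation-preserving piecewise linear
homeomorphism of `[0,1]` with dyadic breakpoints and slopes integer powers of `2`. -/
def InThompsonF (f : Homeo01) : Prop :=
  IsOPH f ∧
  ∃ (n : ℕ) (t : Fin (n + 1) → ℝ), StrictMono t ∧ t 0 = 0 ∧ t (Fin.last n) = 1 ∧
    (∀ i, IsDyadic (t i)) ∧
    ∀ i : Fin n, ∃ (k : ℤ) (d : ℝ), ∀ s : UI,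
      t i.castSucc ≤ (s : ℝ) → (s : ℝ) ≤ t i.succ → ((f s : ℝ)) = (2 : ℝ) ^ k * (s : ℝ) + d

/-! ### Stretched transition chains -/

/-- `a` is isolated in `A`: its support contains no transition point of an element of `A`. -/
def IsolatedIn (A : Set Homeo01) (a : Homeo01) : Prop :=
  ∀ t ∈ supt a, ∀ b ∈ A, ¬ IsTransition b t

/-- `c` (with supports `(x i, y i)`) is a stretched transition chain of `A`. -/
def IsSTC (A : Set Homeo01) (k : ℕ) (c : Fin (k + 1) → Homeo01)
    (x y : Fin (k + 1) → ℝ) : Prop :=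
  (∀ i, c i ∈ A ∧ ¬ IsolatedIn A (c i)) ∧
  (∀ i, supt (c i) = {t : UI | x i < (t : ℝ) ∧ (t : ℝ) < y i}) ∧
  (∀ i : Fin k, x i.castSucc < x i.succ ∧ x i.succ < y i.castSucc ∧ y i.castSucc < y i.succ) ∧
  (∀ i : Fin k, ∀ t : UI, x i.succ < (t : ℝ) → (t : ℝ) < y i.castSucc →
    ∀ b ∈ A, ¬ IsTransition b t)

/-- `S` is the underlying set of some stretched transition chain of `A`. -/
def ChainSet (A : Set Homeo01) (S : Set Homeo01) : Prop :=
  ∃ (k : ℕ) (c : Fin (k + 1) → Homeo01) (x y : Fin (k + 1) → ℝ),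
    IsSTC A k c x y ∧ S = Set.range c

/-- `S` is the underlying set of a maximal stretched transition chain of `A`. -/
def MaxChainSet (A : Set Homeo01) (S : Set Homeo01) : Prop :=
  ChainSet A S ∧ ∀ S' : Set Homeo01, ChainSet A S' → S ⊆ S' → S = S'

/-- The transition points of `A` lying in the support of the chain `c`. -/
def chainTrans (A : Set Homeo01) (k : ℕ) (c : Fin (k + 1) → Homeo01) : Set UI :=
  {t | (∃ i, t ∈ supt (c i)) ∧ ∃ b ∈ A, IsTransition b t}

/-- The image of `t` under the composition `∏ C = c 0 ⋯ c k`. -/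
def chainApply (k : ℕ) (c : Fin (k + 1) → Homeo01) (t : UI) : UI :=
  (List.ofFn c).foldl (fun s a => a s) t

/-! ### Dynamical diagrams -/

/-- The collection of feet of the bumps used in `X`, with marking `m`. -/
def Feet (X : Set Homeo01) (m : Homeo01 → UI) : Set (Set UI) :=
  {S | ∃ a ∈ usedBumps X, S = src a (m a) ∨ S = dest a (m a)}

/-- The signed bumps of `f`: bumps agreeing with `f` on their support. -/
def signedBumps (f : Homeo01) : Set Homeo01 :=
  {b | IsBump b ∧ Set.EqOn ⇑b ⇑f (supt b)}

open Classical in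
/-- The source of a signed bump, with respect to the marking `m` of the positive bumps. -/
noncomputable def sSrc (m : Homeo01 → UI) (b : Homeo01) : Set UI :=
  if IsPosBump b then src b (m b) else dest b⁻¹ (m b⁻¹)

open Classical in
/-- The destination of a signed bump, with respect to the marking `m` of the positive bumps. -/
noncomputable def sDest (m : Homeo01 → UI) (b : Homeo01) : Set UI :=
  if IsPosBump b then dest b (m b) else src b⁻¹ (m b⁻¹)

/-- An isomorphism of the dynamical diagrams of the marked families `(X, mX)` and
`(Y, mY)`, inducing the bijection `τ : X → Y`: an order-preserving bijection `Φ`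
between the collections of feet, together with, for each `f ∈ X`, a bijection of the
signed bumps of `f` with those of `τ f` under which `Φ` matches sources with sources
and destinations with destinations. -/
def DiagIso (X : Set Homeo01) (mX : Homeo01 → UI) (Y : Set Homeo01) (mY : Homeo01 → UI)
    (τ : Homeo01 → Homeo01) : Prop :=
  Set.BijOn τ X Y ∧
  ∃ Φ : Set UI → Set UI,
    Set.BijOn Φ (Feet X mX) (Feet Y mY) ∧
    (∀ S ∈ Feet X mX, ∀ T ∈ Feet X mX,
      (∀ s ∈ S, ∀ t ∈ T, s < t) → ∀ s ∈ Φ S, ∀ t ∈ Φ T, s < t) ∧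
    ∀ f ∈ X, ∃ β : Homeo01 → Homeo01,
      Set.BijOn β (signedBumps f) (signedBumps (τ f)) ∧
      ∀ b ∈ signedBumps f, Φ (sSrc mX b) = sSrc mY (β b) ∧ Φ (sDest mX b) = sDest mY (β b)

/-! ### Excision -/

/-- The union of the supports of the bumps of `E` used in `f`. -/
def quotSupp (f : Homeo01) (E : Set Homeo01) : Set UI :=
  {t | ∃ a ∈ E, UsedIn f a ∧ t ∈ supt a}

/-- `g = f/E`: `g` is the identity on the supports of the bumps of `E` used in `f`,
and agrees with `f` elsewhere. -/
def IsQuot (f : Homeo01) (E : Set Homeo01) (g : Homeo01) : Prop :=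
  (∀ t ∈ quotSupp f E, g t = t) ∧ ∀ t ∉ quotSupp f E, g t = f t

/-- `E` is extraneous in `X` (with respect to the marking `m`), witnessed by an
interval `J`. -/
def Extraneous (X : Set Homeo01) (m : Homeo01 → UI) (E : Set Homeo01) : Prop :=
  ∃ J : Set UI, J.OrdConnected ∧ ∃ f ∈ X,
    (∀ e ∈ E, UsedIn f e ∧ IsolatedIn (usedBumps X) e ∧ supt e ⊆ J) ∧
    (∃ a : Homeo01, UsedIn f a ∧ a ∉ E ∧ (src a (m a) ⊆ J ∨ dest a (m a) ⊆ J)) ∧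
    ∀ g ∈ X, g ≠ f → ∀ b : Homeo01, UsedIn g b →
      Disjoint (src b (m b)) J ∧ Disjoint (dest b (m b)) J

end PingPong

namespace PingPong

open Filter Topology
open scoped commutatorElement

/-! ### Dyadic rationals -/

/-- The subring of dyadic rationals. -/
def dyadics : Subring ℝ where
  carrier := {x | IsDyadic x}
  mul_mem' := by
    rintro _ _ ⟨a, k, rfl⟩ ⟨b, l, rfl⟩
    exact ⟨a * b, k + l, by push_cast; rw [pow_add]; field_simp⟩
  one_mem' := ⟨1, 0, by simp⟩
  add_mem' := by
    rintro _ _ ⟨a, k, rfl⟩ ⟨b, l, rfl⟩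
    exact ⟨a * 2 ^ l + b * 2 ^ k, k + l, by push_cast; rw [pow_add]; field_simp⟩
  zero_mem' := ⟨0, 0, by simp⟩
  neg_mem' := by
    rintro _ ⟨a, k, rfl⟩
    exact ⟨-a, k, by push_cast; ring⟩

lemma zpow_two_mem_dyadics (k : ℤ) : (2 : ℝ) ^ k ∈ dyadics := by
  rcases Int.eq_nat_or_neg k with ⟨n, rfl | rfl⟩
  · exact ⟨2 ^ n, 0, by simp⟩
  · exact ⟨1, n, by simp⟩

lemma half_mem_dyadics {x : ℝ} (hx : x ∈ dyadics) : x / 2 ∈ dyadics := by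
  have := dyadics.mul_mem hx (zpow_two_mem_dyadics (-1))
  simpa [div_eq_mul_inv] using this

lemma zpow_mul_add_mem_dyadics_iff {k : ℤ} {d x : ℝ} (hd : d ∈ dyadics) :
    2 ^ k * x + d ∈ dyadics ↔ x ∈ dyadics := by
  constructor
  · intro h
    have := dyadics.mul_mem (zpow_two_mem_dyadics (-k)) (dyadics.sub_mem h hd)
    rwa [add_sub_cancel_right, ← mul_assoc, ← zpow_add₀ two_ne_zero, neg_add_cancel, zpow_zero,
      one_mul] at this
  · intro h
    exact dyadics.add_mem (dyadics.mul_mem (zpow_two_mem_dyadics k) h) hd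

lemma exists_dyadic_btwn {x y : ℝ} (h : x < y) : ∃ d ∈ dyadics, x < d ∧ d < y := by
  obtain ⟨n, hn⟩ := exists_nat_gt (1 / (y - x))
  have h0 : 0 < y - x := sub_pos.2 h
  have hn' : 1 / (y - x) < 2 ^ n := hn.trans (by exact_mod_cast Nat.lt_two_pow_self)
  have hp : (0 : ℝ) < 2 ^ n := by positivity
  rw [div_lt_iff₀ h0] at hn'
  refine ⟨(⌊x * 2 ^ n⌋ + 1 : ℤ) / 2 ^ n, ⟨_, n, rfl⟩, ?_, ?_⟩
  · rw [lt_div_iff₀ hp]; push_cast; exact Int.lt_floor_add_one _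
  · rw [div_lt_iff₀ hp]; push_cast
    have := Int.floor_le (x * 2 ^ n)
    nlinarith

/-! ### Dyadic piecewise linear homeomorphisms of the line -/

/-- `f` is dyadic piecewise linear near `x`. -/
def DPLAt (f : ℝ → ℝ) (x : ℝ) : Prop :=
  ∃ (k l : ℤ) (d e : ℝ), d ∈ dyadics ∧ e ∈ dyadics ∧
    (∀ᶠ s in 𝓝[≥] x, f s = 2 ^ k * s + d) ∧ (∀ᶠ s in 𝓝[≤] x, f s = 2 ^ l * s + e) ∧
    (x ∈ dyadics ∨ (k = l ∧ d = e))

lemma dplAt_of_affine {f : ℝ → ℝ} {x u v : ℝ} {k : ℤ} {d : ℝ} (hd : d ∈ dyadics)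
    (hu : u < x) (hv : x < v) (h : ∀ s, u ≤ s → s ≤ v → f s = 2 ^ k * s + d) : DPLAt f x := by
  have : ∀ᶠ s in 𝓝 x, f s = 2 ^ k * s + d := by
    filter_upwards [Ioo_mem_nhds hu hv] with s hs using h s hs.1.le hs.2.le
  exact ⟨k, k, d, d, hd, hd, this.filter_mono nhdsWithin_le_nhds,
    this.filter_mono nhdsWithin_le_nhds, Or.inr ⟨rfl, rfl⟩⟩

lemma dplAt_of_break {f : ℝ → ℝ} {x u v : ℝ} {k l : ℤ} {d e : ℝ} (hx : x ∈ dyadics)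
    (hd : d ∈ dyadics) (he : e ∈ dyadics)
    (hu : u < x) (hv : x < v) (h : ∀ s, u ≤ s → s ≤ x → f s = 2 ^ k * s + d)
    (h' : ∀ s, x ≤ s → s ≤ v → f s = 2 ^ l * s + e) : DPLAt f x := by
  refine ⟨l, k, e, d, he, hd, ?_, ?_, Or.inl hx⟩
  · filter_upwards [Icc_mem_nhdsGE hv] with s hs using h' s hs.1 hs.2
  · filter_upwards [Icc_mem_nhdsLE hu] with s hs using h s hs.1 hs.2

lemma dplAt_id (x : ℝ) : DPLAt id x :=
  ⟨0, 0, 0, 0, dyadics.zero_mem, dyadics.zero_mem, by simp, by simp, Or.inr ⟨rfl, rfl⟩⟩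

lemma tendsto_nhdsGE (f : ℝ ≃o ℝ) (x : ℝ) : Tendsto f (𝓝[≥] x) (𝓝[≥] (f x)) :=
  f.continuous.continuousWithinAt.tendsto_nhdsWithin fun _ h => f.monotone h

lemma tendsto_nhdsLE (f : ℝ ≃o ℝ) (x : ℝ) : Tendsto f (𝓝[≤] x) (𝓝[≤] (f x)) :=
  f.continuous.continuousWithinAt.tendsto_nhdsWithin fun _ h => f.monotone h

lemma tendsto_nhdsGT (f : ℝ ≃o ℝ) (x : ℝ) : Tendsto f (𝓝[>] x) (𝓝[>] (f x)) :=
  f.continuous.continuousWithinAt.tendsto_nhdsWithin fun _ h => f.strictMono h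

lemma tendsto_nhdsLT (f : ℝ ≃o ℝ) (x : ℝ) : Tendsto f (𝓝[<] x) (𝓝[<] (f x)) :=
  f.continuous.continuousWithinAt.tendsto_nhdsWithin fun _ h => f.strictMono h

lemma DPLAt.apply_mem_iff {f : ℝ → ℝ} {x : ℝ} (hf : DPLAt f x) :
    f x ∈ dyadics ↔ x ∈ dyadics := by
  obtain ⟨k, l, d, e, hd, he, h1, h2, h3⟩ := hf
  rw [h1.self_of_nhdsWithin self_mem_Ici]
  exact zpow_mul_add_mem_dyadics_iff hd

lemma DPLAt.comp {f g : ℝ ≃o ℝ} {x : ℝ} (hg : DPLAt g (f x)) (hf : DPLAt f x) :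
    DPLAt (g * f : ℝ ≃o ℝ) x := by
  have hiff := hf.apply_mem_iff
  obtain ⟨k, l, d, e, hd, he, h1, h2, h3⟩ := hf
  obtain ⟨k', l', d', e', hd', he', h1', h2', h3'⟩ := hg
  refine ⟨k' + k, l' + l, 2 ^ k' * d + d', 2 ^ l' * e + e',
    (zpow_mul_add_mem_dyadics_iff hd').2 hd, (zpow_mul_add_mem_dyadics_iff he').2 he, ?_, ?_, ?_⟩
  · filter_upwards [h1, (tendsto_nhdsGE f x).eventually h1'] with s hs hs'
    rw [RelIso.mul_apply, hs', hs, zpow_add₀ two_ne_zero]; ring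
  · filter_upwards [h2, (tendsto_nhdsLE f x).eventually h2'] with s hs hs'
    rw [RelIso.mul_apply, hs', hs, zpow_add₀ two_ne_zero]; ring
  · by_cases hx : x ∈ dyadics
    · exact Or.inl hx
    · obtain ⟨rfl, rfl⟩ := h3.resolve_left hx
      obtain ⟨rfl, rfl⟩ := h3'.resolve_left (hiff.not.2 hx)
      exact Or.inr ⟨rfl, rfl⟩

lemma eq_zpow_neg_mul_add {k : ℤ} {d s t : ℝ} (h : t = 2 ^ k * s + d) :
    s = 2 ^ (-k) * t + -(2 ^ (-k) * d) := by
  rw [h, mul_add, ← mul_assoc, ← zpow_add₀ two_ne_zero]; simp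

lemma DPLAt.inv {f : ℝ ≃o ℝ} {x : ℝ} (hf : DPLAt f x) : DPLAt (f⁻¹ : ℝ ≃o ℝ) (f x) := by
  have hiff := hf.apply_mem_iff
  obtain ⟨k, l, d, e, hd, he, h1, h2, h3⟩ := hf
  refine ⟨-k, -l, -(2 ^ (-k) * d), -(2 ^ (-l) * e),
    dyadics.neg_mem (dyadics.mul_mem (zpow_two_mem_dyadics _) hd),
    dyadics.neg_mem (dyadics.mul_mem (zpow_two_mem_dyadics _) he), ?_, ?_, ?_⟩
  · have := tendsto_nhdsGE f⁻¹ (f x)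
    rw [RelIso.inv_apply_self] at this
    filter_upwards [this.eventually h1] with s hs
    rw [RelIso.apply_inv_self] at hs
    exact eq_zpow_neg_mul_add hs
  · have := tendsto_nhdsLE f⁻¹ (f x)
    rw [RelIso.inv_apply_self] at this
    filter_upwards [this.eventually h2] with s hs
    rw [RelIso.apply_inv_self] at hs
    exact eq_zpow_neg_mul_add hs
  · rcases h3 with h | ⟨rfl, rfl⟩
    · exact Or.inl (hiff.2 h)
    · exact Or.inr ⟨rfl, rfl⟩

lemma inv_apply_eq_iff {f : ℝ ≃o ℝ} {x y : ℝ} : f⁻¹ x = y ↔ x = f y := by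
  constructor
  · rintro rfl; simp
  · rintro rfl; simp

/-- Homeomorphisms of the line which are the identity on a given set. -/
def fixing (S : Set ℝ) : Subgroup (ℝ ≃o ℝ) where
  carrier := {f | ∀ x ∈ S, f x = x}
  mul_mem' := by
    intro f g hf hg x hx
    rw [RelIso.mul_apply, hg x hx, hf x hx]
  one_mem' := fun x _ => rfl
  inv_mem' := by
    intro f hf x hx
    exact inv_apply_eq_iff.2 (hf x hx).symm

/-- Thompson's group `F`, acting on the line by maps supported in `[0,1]`. -/
def thompson : Subgroup (ℝ ≃o ℝ) where
  carrier := {f | (∀ x, DPLAt f x) ∧ ∀ x, x ≤ 0 ∨ 1 ≤ x → f x = x}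
  mul_mem' := by
    rintro f g ⟨hf, hf'⟩ ⟨hg, hg'⟩
    exact ⟨fun x => (hf _).comp (hg x), fun x hx => by rw [RelIso.mul_apply, hg' x hx, hf' x hx]⟩
  one_mem' := ⟨dplAt_id, fun x _ => rfl⟩
  inv_mem' := by
    rintro f ⟨hf, hf'⟩
    refine ⟨fun x => ?_, fun x hx => inv_apply_eq_iff.2 (hf' x hx).symm⟩
    have := (hf (f⁻¹ x)).inv
    rwa [RelIso.apply_inv_self] at this

/-- The elements of `F` which are the identity near `0` and near `1`. -/
def thompsonC : Subgroup (ℝ ≃o ℝ) where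
  carrier := {f | f ∈ thompson ∧ ∃ ε, 0 < ε ∧ ∀ x, x ≤ ε ∨ 1 - ε ≤ x → f x = x}
  mul_mem' := by
    rintro f g ⟨hf, ε, hε, hf'⟩ ⟨hg, δ, hδ, hg'⟩
    refine ⟨mul_mem hf hg, min ε δ, lt_min hε hδ, fun x hx => ?_⟩
    have := min_le_left ε δ
    have := min_le_right ε δ
    have h1 : x ≤ ε ∨ 1 - ε ≤ x := hx.imp (by intro; linarith) (by intro; linarith)
    have h2 : x ≤ δ ∨ 1 - δ ≤ x := hx.imp (by intro; linarith) (by intro; linarith)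
    rw [RelIso.mul_apply, hg' x h2, hf' x h1]
  one_mem' := ⟨one_mem _, 1, one_pos, fun x _ => rfl⟩
  inv_mem' := by
    rintro f ⟨hf, ε, hε, hf'⟩
    exact ⟨inv_mem hf, ε, hε, fun x hx => inv_apply_eq_iff.2 (hf' x hx).symm⟩

lemma mem_thompsonC_of_fix {f : ℝ ≃o ℝ} (hf : f ∈ thompson) {a b : ℝ} (ha : 0 < a) (hb : b < 1)
    (h : ∀ x, x ≤ a ∨ b ≤ x → f x = x) : f ∈ thompsonC := by
  refine ⟨hf, min a (1 - b), lt_min ha (by linarith), fun x hx => h x (hx.imp ?_ ?_)⟩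
  · exact fun h => h.trans (min_le_left _ _)
  · intro h
    have := min_le_right a (1 - b)
    linarith

/-! ### The standard bumps -/

/-- The copy of the standard generator of `F` with support `(a, b)`. It is the identity
if `b ≤ a`. -/
noncomputable def xgen (a b : ℝ) : ℝ ≃o ℝ where
  toFun t := max t (min (2 * t - a) (min (t + (b - a) / 4) ((t + b) / 2)))
  invFun t := min t (max ((t + a) / 2) (max (t - (b - a) / 4) (2 * t - b)))
  left_inv t := by grind
  right_inv t := by grind
  map_rel_iff' := by
    intro s t
    simp only [Equiv.coe_fn_mk]
    grind

section xgen
variable {a b t : ℝ}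

lemma xgen_apply :
    xgen a b t = max t (min (2 * t - a) (min (t + (b - a) / 4) ((t + b) / 2))) := rfl

lemma xgen_of_le (h : t ≤ a) : xgen a b t = t := by rw [xgen_apply]; grind

lemma xgen_of_ge (h : b ≤ t) : xgen a b t = t := by rw [xgen_apply]; grind

lemma xgen_fst (h : a ≤ t) (h' : t ≤ a + (b - a) / 4) : xgen a b t = 2 * t - a := by
  rw [xgen_apply]; grind

lemma xgen_snd (h : a + (b - a) / 4 ≤ t) (h' : t ≤ (a + b) / 2) :
    xgen a b t = t + (b - a) / 4 := by
  rw [xgen_apply]; grind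

lemma xgen_thd (h : (a + b) / 2 ≤ t) (h' : t ≤ b) : xgen a b t = (t + b) / 2 := by
  rw [xgen_apply]; grind

lemma lt_xgen (h : a < t) (h' : t < b) : t < xgen a b t := by
  rw [xgen_apply]; grind

lemma dplAt_xgen (ha : a ∈ dyadics) (hb : b ∈ dyadics) (t : ℝ) : DPLAt (xgen a b) t := by
  rcases le_or_gt b a with hab | hab
  · exact dplAt_of_affine (k := 0) (d := 0) dyadics.zero_mem (sub_one_lt t) (lt_add_one t)
      fun s _ _ => by rw [xgen_apply, zpow_zero]; grind
  have hq : a + (b - a) / 4 ∈ dyadics := by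
    have := half_mem_dyadics (half_mem_dyadics (dyadics.sub_mem hb ha))
    rw [div_div] at this; norm_num at this
    exact dyadics.add_mem ha this
  have hq' : (b - a) / 4 ∈ dyadics := by
    have := dyadics.sub_mem hq ha
    rwa [add_sub_cancel_left] at this
  have hm : (a + b) / 2 ∈ dyadics := half_mem_dyadics (dyadics.add_mem ha hb)
  have e0 : ∀ s, a - 1 ≤ s → s ≤ a → xgen a b s = 2 ^ (0 : ℤ) * s + 0 := fun s _ h => by
    rw [xgen_of_le h]; simp
  have e1 : ∀ s, a ≤ s → s ≤ a + (b - a) / 4 → xgen a b s = 2 ^ (1 : ℤ) * s + -a :=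
    fun s h h' => by rw [xgen_fst h h', zpow_one]; ring
  have e2 : ∀ s, a + (b - a) / 4 ≤ s → s ≤ (a + b) / 2 →
      xgen a b s = 2 ^ (0 : ℤ) * s + (b - a) / 4 :=
    fun s h h' => by rw [xgen_snd h h', zpow_zero]; ring
  have e3 : ∀ s, (a + b) / 2 ≤ s → s ≤ b → xgen a b s = 2 ^ (-1 : ℤ) * s + b / 2 :=
    fun s h h' => by rw [xgen_thd h h', zpow_neg_one]; ring
  have e4 : ∀ s, b ≤ s → s ≤ b + 1 → xgen a b s = 2 ^ (0 : ℤ) * s + 0 := fun s h _ => by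
    rw [xgen_of_ge h]; simp
  have h0 := dyadics.zero_mem
  rcases lt_trichotomy t a with h | rfl | h1
  · exact dplAt_of_affine (k := 0) (u := t - 1) (v := a) h0 (by linarith) h
      fun s _ h => by rw [xgen_of_le h]; simp
  · exact dplAt_of_break ha h0 (dyadics.neg_mem ha) (by linarith) (by linarith) e0 e1
  rcases lt_trichotomy t (a + (b - a) / 4) with h | rfl | h2
  · exact dplAt_of_affine (dyadics.neg_mem ha) h1 h e1
  · exact dplAt_of_break hq (dyadics.neg_mem ha) hq' h1 (by linarith) e1 e2
  rcases lt_trichotomy t ((a + b) / 2) with h | rfl | h3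
  · exact dplAt_of_affine hq' h2 h e2
  · exact dplAt_of_break hm hq' (half_mem_dyadics hb) h2 (by linarith) e2 e3
  rcases lt_trichotomy t b with h | rfl | h4
  · exact dplAt_of_affine (half_mem_dyadics hb) h3 h e3
  · exact dplAt_of_break hb (half_mem_dyadics hb) h0 h3 (by linarith) e3 e4
  · exact dplAt_of_affine (k := 0) (u := b) (v := t + 1) h0 h4 (by linarith)
      fun s h _ => by rw [xgen_of_ge h]; simp

lemma xgen_mem_thompson (ha : a ∈ dyadics) (hb : b ∈ dyadics) (ha0 : 0 ≤ a) (hb1 : b ≤ 1) :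
    xgen a b ∈ thompson :=
  ⟨dplAt_xgen ha hb, fun _ hx => hx.elim (fun h => xgen_of_le (h.trans ha0))
    fun h => xgen_of_ge (hb1.trans h)⟩

lemma xgen_mem_thompsonC (ha : a ∈ dyadics) (hb : b ∈ dyadics) (ha0 : 0 < a) (hb1 : b < 1) :
    xgen a b ∈ thompsonC :=
  mem_thompsonC_of_fix (xgen_mem_thompson ha hb ha0.le hb1.le) ha0 hb1
    fun _ hx => hx.elim xgen_of_le xgen_of_ge

end xgen

/-! ### Uniform dyadic partitions -/

/-- `f` maps `[i / 2 ^ N, (i + 1) / 2 ^ N]` affinely onto a standard dyadic interval. -/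
def StdAff (f : ℝ → ℝ) (N : ℕ) (i : ℤ) : Prop :=
  ∃ (m : ℕ) (j : ℤ), ∀ s : ℝ, i / 2 ^ N ≤ s → s ≤ (i + 1) / 2 ^ N →
    f s = j / 2 ^ m + 2 ^ N / 2 ^ m * (s - i / 2 ^ N)

lemma affine_eq_std (k : ℤ) {d : ℝ} (hd : d ∈ dyadics) :
    ∃ N₀ : ℕ, ∀ N ≥ N₀, ∀ i : ℤ, ∃ (m : ℕ) (j : ℤ), ∀ s : ℝ,
      2 ^ k * s + d = j / 2 ^ m + 2 ^ N / 2 ^ m * (s - i / 2 ^ N) := by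
  obtain ⟨e, q, rfl⟩ := hd
  refine ⟨q + k.natAbs, fun N hN i => ?_⟩
  obtain ⟨m, hm⟩ : ∃ m : ℕ, (m : ℤ) = N - k := ⟨(N - k).toNat, by omega⟩
  obtain ⟨r, hr⟩ : ∃ r : ℕ, m = q + r := ⟨m - q, by omega⟩
  have hk : k = (N : ℤ) - m := by omega
  refine ⟨m, i + e * 2 ^ r, fun s => ?_⟩
  have h2 : (2 : ℝ) ^ k = 2 ^ N / 2 ^ m := by
    rw [hk, zpow_sub₀ two_ne_zero, zpow_natCast, zpow_natCast]
  have h3 : (2 : ℝ) ^ m = 2 ^ q * 2 ^ r := by rw [hr, pow_add]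
  rw [h2, h3]
  push_cast
  field_simp
  ring

lemma DPLAt.exists_stdAff {f : ℝ → ℝ} {x : ℝ} (hf : DPLAt f x) :
    ∃ ε > 0, ∃ N₀ : ℕ, ∀ N ≥ N₀, ∀ i : ℤ,
      (∃ y : ℝ, |y - x| < ε ∧ i / 2 ^ N ≤ y ∧ y ≤ (i + 1) / 2 ^ N) → StdAff f N i := by
  obtain ⟨k, l, d, e, hd, he, h1, h2, h3⟩ := hf
  rw [eventually_nhdsWithin_iff] at h1 h2
  obtain ⟨ε, hε, h⟩ := Metric.eventually_nhds_iff.1 (h1.and h2)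
  obtain ⟨N₁, hN₁⟩ := affine_eq_std k hd
  obtain ⟨N₂, hN₂⟩ := affine_eq_std l he
  obtain ⟨N₃, hN₃⟩ := exists_pow_lt_of_lt_one (half_pos hε) (by norm_num : (1 / 2 : ℝ) < 1)
  obtain ⟨q, hq⟩ : ∃ q : ℕ, x ∈ dyadics → ∃ p : ℤ, x = p / 2 ^ q := by
    by_cases hx : x ∈ dyadics
    · obtain ⟨p, q, hp⟩ := hx
      exact ⟨q, fun _ => ⟨p, hp⟩⟩
    · exact ⟨0, fun h => absurd h hx⟩
  refine ⟨ε / 2, half_pos hε, N₁ + N₂ + N₃ + q, fun N hN i ⟨y, hy, hy1, hy2⟩ => ?_⟩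
  have hlen : ((i : ℝ) + 1) / 2 ^ N - i / 2 ^ N < ε / 2 := by
    have : ((1 : ℝ) / 2) ^ N ≤ (1 / 2) ^ N₃ :=
      pow_le_pow_of_le_one (by norm_num) (by norm_num) (by omega)
    rw [← sub_div, add_sub_cancel_left]
    rw [one_div_pow] at this
    linarith
  have hclose : ∀ s : ℝ, i / 2 ^ N ≤ s → s ≤ (i + 1) / 2 ^ N → dist s x < ε := by
    intro s hs hs'
    rw [Real.dist_eq, abs_lt]
    rw [abs_lt] at hy
    constructor <;> linarith
  have hright : (∀ s : ℝ, i / 2 ^ N ≤ s → s ≤ (i + 1) / 2 ^ N → x ≤ s) → StdAff f N i := by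
    intro hs
    obtain ⟨m, j, hmj⟩ := hN₁ N (by omega) i
    exact ⟨m, j, fun s hs1 hs2 => by rw [← hmj, (h (hclose s hs1 hs2)).1 (hs s hs1 hs2)]⟩
  have hleft : (∀ s : ℝ, i / 2 ^ N ≤ s → s ≤ (i + 1) / 2 ^ N → s ≤ x) → StdAff f N i := by
    intro hs
    obtain ⟨m, j, hmj⟩ := hN₂ N (by omega) i
    exact ⟨m, j, fun s hs1 hs2 => by rw [← hmj, (h (hclose s hs1 hs2)).2 (hs s hs1 hs2)]⟩
  rcases h3 with hx | ⟨rfl, rfl⟩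
  · obtain ⟨p, rfl⟩ := hq hx
    obtain ⟨r, hr⟩ : ∃ r : ℕ, N = q + r := ⟨N - q, by omega⟩
    have hpx : (p : ℝ) / 2 ^ q = ((p * 2 ^ r : ℤ) : ℝ) / 2 ^ N := by
      rw [hr, pow_add]; push_cast; field_simp
    have h2N : (0 : ℝ) < 2 ^ N := by positivity
    rcases le_or_gt (p * 2 ^ r) i with hi | hi
    · refine hright fun s hs _ => le_trans ?_ hs
      rw [hpx]
      gcongr
    · refine hleft fun s _ hs => hs.trans ?_
      rw [hpx]
      gcongr
      exact_mod_cast hi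
  · obtain ⟨m, j, hmj⟩ := hN₁ N (by omega) i
    refine ⟨m, j, fun s hs1 hs2 => ?_⟩
    rw [← hmj]
    rcases le_total x s with hs | hs
    · exact (h (hclose s hs1 hs2)).1 hs
    · exact (h (hclose s hs1 hs2)).2 hs

lemma exists_uniform_stdAff {f : ℝ → ℝ} (hf : ∀ x, DPLAt f x) :
    ∃ N₀ : ℕ, ∀ N ≥ N₀, ∀ i : ℤ, 0 ≤ i → i + 1 ≤ 2 ^ N → StdAff f N i := by
  have key : ∃ N₀ : ℕ, ∀ N ≥ N₀, ∀ i : ℤ,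
      (∃ y ∈ Icc (0 : ℝ) 1, i / 2 ^ N ≤ y ∧ y ≤ (i + 1) / 2 ^ N) → StdAff f N i := by
    refine isCompact_Icc.induction_on (p := fun S : Set ℝ => ∃ N₀ : ℕ, ∀ N ≥ N₀, ∀ i : ℤ,
      (∃ y ∈ S, i / 2 ^ N ≤ y ∧ y ≤ (i + 1) / 2 ^ N) → StdAff f N i) ?_ ?_ ?_ ?_
    · exact ⟨0, fun N _ i ⟨y, hy, _⟩ => hy.elim⟩
    · rintro S T hST ⟨N₀, h⟩
      exact ⟨N₀, fun N hN i ⟨y, hy, hy'⟩ => h N hN i ⟨y, hST hy, hy'⟩⟩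
    · rintro S T ⟨N₀, h⟩ ⟨N₁, h'⟩
      refine ⟨N₀ + N₁, fun N hN i ⟨y, hy, hy'⟩ => ?_⟩
      rcases hy with hy | hy
      · exact h N (by omega) i ⟨y, hy, hy'⟩
      · exact h' N (by omega) i ⟨y, hy, hy'⟩
    · intro x _
      obtain ⟨ε, hε, N₀, h⟩ := (hf x).exists_stdAff
      exact ⟨Metric.ball x ε, mem_nhdsWithin_of_mem_nhds (Metric.ball_mem_nhds x hε), N₀,
        fun N hN i ⟨y, hy, hy'⟩ => h N hN i ⟨y, by rwa [← Real.dist_eq], hy'⟩⟩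
  obtain ⟨N₀, h⟩ := key
  refine ⟨N₀, fun N hN i hi hi' => h N hN i ⟨i / 2 ^ N, ⟨by positivity, ?_⟩, le_rfl, ?_⟩⟩
  · rw [div_le_one (by positivity)]
    exact_mod_cast (by omega : i ≤ 2 ^ N)
  · gcongr
    linarith

/-! ### Binary trees and standard dyadic partitions -/

/-- Finite binary trees, describing iterated bisections of an interval. -/
inductive BTree
  | leaf : BTree
  | node : BTree → BTree → BTree

namespace BTree

/-- The intervals of the bisection of `[a, b]` described by a tree. -/
noncomputable def leaves : BTree → ℝ → ℝ → List (ℝ × ℝ)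
  | leaf, a, b => [(a, b)]
  | node l r, a, b => leaves l a ((a + b) / 2) ++ leaves r ((a + b) / 2) b

/-- The number of leaves of a tree. -/
def size : BTree → ℕ
  | leaf => 1
  | node l r => size l + size r

lemma size_pos : ∀ T : BTree, 0 < T.size
  | leaf => Nat.one_pos
  | node l _ => Nat.add_pos_left (size_pos l) _

lemma length_leaves (T : BTree) (a b : ℝ) : (T.leaves a b).length = T.size := by
  induction T generalizing a b with
  | leaf => rfl
  | node l r hl hr => simp [leaves, size, hl, hr]

/-- The tree whose left subtrees are all trivial, with `n + 1` leaves. -/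
def vine : ℕ → BTree
  | 0 => leaf
  | n + 1 => node leaf (vine n)

end BTree

open BTree

/-- `w` maps the interval `I` affinely onto the interval `J`. -/
def AffOn (w : ℝ ≃o ℝ) (I J : ℝ × ℝ) : Prop :=
  I.1 < I.2 ∧ J.1 < J.2 ∧ ∀ s ∈ Icc I.1 I.2,
    w s = J.1 + (s - I.1) * ((J.2 - J.1) / (I.2 - I.1))

/-- `w` maps the intervals of `P` affinely onto the intervals of `Q`, in order. -/
def AffMaps (w : ℝ ≃o ℝ) (P Q : List (ℝ × ℝ)) : Prop := List.Forall₂ (AffOn w) P Q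

lemma AffOn.mapsTo {w : ℝ ≃o ℝ} {I J : ℝ × ℝ} (h : AffOn w I J) {s : ℝ} (hs : s ∈ Icc I.1 I.2) :
    w s ∈ Icc J.1 J.2 := by
  obtain ⟨h1, h2, h3⟩ := h
  have e1 := h3 I.1 (left_mem_Icc.2 h1.le)
  have e2 := h3 I.2 (right_mem_Icc.2 h1.le)
  have : I.2 - I.1 ≠ 0 := by linarith
  have e3 : (I.2 - I.1) * ((J.2 - J.1) / (I.2 - I.1)) = J.2 - J.1 := by field_simp
  have := w.monotone hs.1
  have := w.monotone hs.2
  constructor <;> linarith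

lemma AffOn.mul {w v : ℝ ≃o ℝ} {I J K : ℝ × ℝ} (h : AffOn w I J) (h' : AffOn v J K) :
    AffOn (v * w) I K := by
  refine ⟨h.1, h'.2.1, fun s hs => ?_⟩
  rw [RelIso.mul_apply, h'.2.2 _ (h.mapsTo hs), h.2.2 _ hs]
  have : I.2 - I.1 ≠ 0 := by linarith [h.1]
  have : J.2 - J.1 ≠ 0 := by linarith [h.2.1]
  field_simp
  ring

lemma AffMaps.mul {w v : ℝ ≃o ℝ} {P Q R : List (ℝ × ℝ)} (h : AffMaps w P Q)
    (h' : AffMaps v Q R) : AffMaps (v * w) P R := by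
  induction h generalizing R with
  | nil => cases h'; exact List.Forall₂.nil
  | cons h1 h2 ih =>
    cases h' with
    | cons h3 h4 => exact List.Forall₂.cons (h1.mul h3) (ih h4)

lemma AffOn.inv {w : ℝ ≃o ℝ} {I J : ℝ × ℝ} (h : AffOn w I J) : AffOn w⁻¹ J I := by
  refine ⟨h.2.1, h.1, fun s hs => ?_⟩
  have h1 : 0 < I.2 - I.1 := by linarith [h.1]
  have h2 : 0 < J.2 - J.1 := by linarith [h.2.1]
  rw [inv_apply_eq_iff, h.2.2]
  · field_simp; ring
  · constructor
    · have : 0 ≤ (s - J.1) * ((I.2 - I.1) / (J.2 - J.1)) :=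
        mul_nonneg (by linarith [hs.1]) (by positivity)
      linarith
    · have : (s - J.1) * ((I.2 - I.1) / (J.2 - J.1)) ≤
          (J.2 - J.1) * ((I.2 - I.1) / (J.2 - J.1)) :=
        mul_le_mul_of_nonneg_right (by linarith [hs.2]) (by positivity)
      have e : (J.2 - J.1) * ((I.2 - I.1) / (J.2 - J.1)) = I.2 - I.1 := by field_simp
      linarith

lemma AffMaps.inv {w : ℝ ≃o ℝ} {P Q : List (ℝ × ℝ)} (h : AffMaps w P Q) :
    AffMaps w⁻¹ Q P := by
  induction h with
  | nil => exact List.Forall₂.nil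
  | cons h1 _ ih => exact List.Forall₂.cons h1.inv ih

lemma affMaps_leaves {w : ℝ ≃o ℝ} (T : BTree) {a b c d : ℝ} (h : AffOn w (a, b) (c, d)) :
    AffMaps w (T.leaves a b) (T.leaves c d) := by
  induction T generalizing a b c d with
  | leaf => exact List.Forall₂.cons h List.Forall₂.nil
  | node l r hl hr =>
    obtain ⟨h1, h2, h3⟩ := h
    simp only at h1 h2 h3
    have : b - a ≠ 0 := by linarith
    have e1 : ((c + d) / 2 - c) / ((a + b) / 2 - a) = (d - c) / (b - a) := by
      rw [show (c + d) / 2 - c = (d - c) / 2 by ring, show (a + b) / 2 - a = (b - a) / 2 by ring]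
      field_simp
    have e2 : (d - (c + d) / 2) / (b - (a + b) / 2) = (d - c) / (b - a) := by
      rw [show d - (c + d) / 2 = (d - c) / 2 by ring, show b - (a + b) / 2 = (b - a) / 2 by ring]
      field_simp
    refine List.rel_append (hl ⟨by simp only; linarith, by simp only; linarith, ?_⟩)
      (hr ⟨by simp only; linarith, by simp only; linarith, ?_⟩)
    · rintro s ⟨hs, hs'⟩
      simp only at hs hs' ⊢
      rw [e1, h3 s ⟨hs, by linarith⟩]
    · rintro s ⟨hs, hs'⟩
      simp only at hs hs' ⊢
      rw [e2, h3 s ⟨by linarith, hs'⟩]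
      field_simp
      ring

lemma affMaps_of_fix {w : ℝ ≃o ℝ} (T : BTree) {a b : ℝ} (hab : a < b)
    (h : ∀ s ∈ Icc a b, w s = s) : AffMaps w (T.leaves a b) (T.leaves a b) := by
  refine affMaps_leaves T ⟨hab, hab, fun s hs => ?_⟩
  have : b - a ≠ 0 := by linarith
  simp only at hs ⊢
  rw [h s hs, div_self this]
  ring

/-- The group generated by the standard bumps supported in `[a, b]`. -/
def bumpGroup (a b : ℝ) : Subgroup (ℝ ≃o ℝ) :=
  Subgroup.closure {g | ∃ c ∈ dyadics, ∃ d ∈ dyadics, a ≤ c ∧ c < d ∧ d ≤ b ∧ g = xgen c d}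

lemma bumpGroup_mono {a b c d : ℝ} (h : c ≤ a) (h' : b ≤ d) : bumpGroup a b ≤ bumpGroup c d :=
  Subgroup.closure_mono fun _ ⟨u, hu, v, hv, h1, h2, h3, h4⟩ =>
    ⟨u, hu, v, hv, h.trans h1, h2, h3.trans h', h4⟩

lemma bumpGroup_le_fixing (a b : ℝ) : bumpGroup a b ≤ fixing (Iic a ∪ Ici b) := by
  refine (Subgroup.closure_le _).2 ?_
  rintro _ ⟨c, _, d, _, h1, _, h2, rfl⟩ x (hx | hx)
  · exact xgen_of_le (le_trans hx h1)
  · exact xgen_of_ge (le_trans h2 hx)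

lemma bumpGroup_apply_of_le {a b x : ℝ} {w : ℝ ≃o ℝ} (hw : w ∈ bumpGroup a b) (hx : x ≤ a) :
    w x = x := bumpGroup_le_fixing a b hw x (Or.inl hx)

lemma bumpGroup_apply_of_ge {a b x : ℝ} {w : ℝ ≃o ℝ} (hw : w ∈ bumpGroup a b) (hx : b ≤ x) :
    w x = x := bumpGroup_le_fixing a b hw x (Or.inr hx)

lemma affMaps_xgen_rotate (A B C : BTree) {a b : ℝ} (hab : a < b) :
    AffMaps (xgen a b) ((node (node A B) C).leaves a b) ((node A (node B C)).leaves a b) := by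
  have hba : b - a ≠ 0 := by linarith
  simp only [leaves, List.append_assoc]
  refine List.rel_append (affMaps_leaves A ⟨?_, ?_, ?_⟩) (List.rel_append
    (affMaps_leaves B ⟨?_, ?_, ?_⟩) (affMaps_leaves C ⟨?_, ?_, ?_⟩)) <;>
    simp only [mem_Icc] <;> try linarith
  · rintro s ⟨h, h'⟩
    have : ((a + b) / 2 - a) / ((a + (a + b) / 2) / 2 - a) = 2 := by
      rw [div_eq_iff (by intro; apply hba; linarith)]; ring
    rw [xgen_fst h (by linarith), this]
    ring
  · rintro s ⟨h, h'⟩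
    have : (((a + b) / 2 + b) / 2 - (a + b) / 2) / ((a + b) / 2 - (a + (a + b) / 2) / 2) = 1 := by
      rw [div_eq_iff (by intro; apply hba; linarith)]; ring
    rw [xgen_snd (by linarith) (by linarith), this]
    ring
  · rintro s ⟨h, h'⟩
    have : (b - ((a + b) / 2 + b) / 2) / (b - (a + b) / 2) = 1 / 2 := by
      rw [div_eq_iff (by intro; apply hba; linarith)]; ring
    rw [xgen_thd (by linarith) (by linarith), this]
    ring

lemma exists_affMaps_comb (n m : ℕ) {a b : ℝ} (ha : a ∈ dyadics) (hb : b ∈ dyadics)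
    (hab : a < b) : ∃ w ∈ bumpGroup a b,
      AffMaps w ((node (vine n) (vine m)).leaves a b) ((vine (n + m + 1)).leaves a b) := by
  induction n generalizing a b with
  | zero =>
    rw [zero_add]
    exact ⟨1, one_mem _, affMaps_of_fix _ hab fun s _ => rfl⟩
  | succ n ih =>
    have hm : (a + b) / 2 ∈ dyadics := half_mem_dyadics (dyadics.add_mem ha hb)
    obtain ⟨w, hw, hw'⟩ := ih hm hb (by linarith)
    refine ⟨w * xgen a b, mul_mem (bumpGroup_mono (by linarith) le_rfl hw)
      (Subgroup.subset_closure ⟨a, ha, b, hb, le_rfl, hab, le_rfl, rfl⟩), ?_⟩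
    refine (affMaps_xgen_rotate leaf (vine n) (vine m) hab).mul ?_
    rw [show n + 1 + m + 1 = (n + m + 1) + 1 by ring]
    exact List.rel_append (affMaps_of_fix leaf (by linarith)
      fun s hs => bumpGroup_apply_of_le hw hs.2) hw'

lemma exists_affMaps_vine (T : BTree) {a b : ℝ} (ha : a ∈ dyadics) (hb : b ∈ dyadics)
    (hab : a < b) : ∃ w ∈ bumpGroup a b,
      AffMaps w (T.leaves a b) ((vine (T.size - 1)).leaves a b) := by
  induction T generalizing a b with
  | leaf => exact ⟨1, one_mem _, affMaps_of_fix _ hab fun s _ => rfl⟩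
  | node l r hl hr =>
    have hm : (a + b) / 2 ∈ dyadics := half_mem_dyadics (dyadics.add_mem ha hb)
    obtain ⟨w, hw, hw'⟩ := hl ha hm (by linarith)
    obtain ⟨v, hv, hv'⟩ := hr hm hb (by linarith)
    obtain ⟨u, hu, hu'⟩ := exists_affMaps_comb (l.size - 1) (r.size - 1) ha hb hab
    refine ⟨u * (v * w), mul_mem hu (mul_mem (bumpGroup_mono (by linarith) le_rfl hv)
      (bumpGroup_mono le_rfl (by linarith) hw)), ?_⟩
    have := l.size_pos
    have := r.size_pos
    rw [show (node l r).size - 1 = l.size - 1 + (r.size - 1) + 1 by simp only [size]; omega]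
    refine AffMaps.mul ?_ hu'
    refine List.rel_append ?_ ?_
    · exact hw'.mul (affMaps_of_fix _ (by linarith) fun s hs => bumpGroup_apply_of_le hv hs.2)
    · exact (affMaps_of_fix _ (by linarith) fun s hs => bumpGroup_apply_of_ge hw hs.1).mul hv'

lemma eq_of_affMaps_leaves {w v : ℝ ≃o ℝ} {T : BTree} {Q : List (ℝ × ℝ)} {a b : ℝ}
    (hw : AffMaps w (T.leaves a b) Q) (hv : AffMaps v (T.leaves a b) Q) :
    ∀ s ∈ Icc a b, w s = v s := by
  induction T generalizing a b Q with
  | leaf =>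
    intro s hs
    cases hw with
    | cons h1 _ =>
      cases hv with
      | cons h2 _ => rw [h1.2.2 s hs, h2.2.2 s hs]
  | node l r hl hr =>
    intro s hs
    have e1 := (List.forall₂_take_append Q _ _ hw.flip).flip
    have e2 := (List.forall₂_drop_append Q _ _ hw.flip).flip
    have e3 := (List.forall₂_take_append Q _ _ hv.flip).flip
    have e4 := (List.forall₂_drop_append Q _ _ hv.flip).flip
    rcases le_total s ((a + b) / 2) with h | h
    · exact hl e1 e3 s ⟨hs.1, h⟩
    · exact hr e2 e4 s ⟨h, hs.2⟩

/-- An element of the group of homeomorphisms of `[a, b]` given by a pair of trees with the same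
number of leaves is a product of standard bumps. -/
lemma mem_bumpGroup_of_trees {h : ℝ ≃o ℝ} {S T : BTree} {a b : ℝ} (ha : a ∈ dyadics)
    (hb : b ∈ dyadics) (hab : a < b) (hfix : h ∈ fixing (Iic a ∪ Ici b))
    (hST : AffMaps h (S.leaves a b) (T.leaves a b)) : h ∈ bumpGroup a b := by
  have hsize : S.size = T.size := by
    rw [← length_leaves S a b, ← length_leaves T a b]
    exact hST.length_eq
  obtain ⟨w, hw, hw'⟩ := exists_affMaps_vine S ha hb hab
  obtain ⟨v, hv, hv'⟩ := exists_affMaps_vine T ha hb hab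
  rw [← hsize] at hv'
  have key : w⁻¹ * v * h = w⁻¹ * w := by
    ext s
    by_cases hs : s ∈ Icc a b
    · exact eq_of_affMaps_leaves ((hST.mul (hv'.mul hw'.inv))) (hw'.mul hw'.inv) s hs
    · have hs' : s ∈ Iic a ∪ Ici b := by
        simp only [mem_Icc, not_and_or, not_le] at hs
        exact hs.imp le_of_lt le_of_lt
      have hv1 := bumpGroup_le_fixing a b (mul_mem (inv_mem hw) hv) s hs'
      rw [RelIso.mul_apply, hfix s hs', hv1]
      simp
  have : h = v⁻¹ * w := by
    rw [mul_assoc] at key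
    rw [← mul_left_cancel key]
    group
  rw [this]
  exact mul_mem (inv_mem hv) hw

lemma exists_tree_leaves_eq {y : ℕ → ℝ} (hy : StrictMono y) {K : ℕ}
    (hstd : ∀ i < K, ∃ (m : ℕ) (j : ℤ), y i = j / 2 ^ m ∧ y (i + 1) = (j + 1) / 2 ^ m)
    (n i₀ M : ℕ) (J : ℤ) (hK : i₀ + n + 1 ≤ K) (h₀ : y i₀ = J / 2 ^ M)
    (h₁ : y (i₀ + n + 1) = (J + 1) / 2 ^ M) :
    ∃ T : BTree, T.leaves (y i₀) (y (i₀ + n + 1)) =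
      (List.range' i₀ (n + 1)).map fun i => (y i, y (i + 1)) := by
  induction n using Nat.strong_induction_on generalizing i₀ M J with
  | _ n ih =>
    rcases Nat.eq_zero_or_pos n with rfl | hn
    · exact ⟨leaf, by simp [leaves]⟩
    have hM : (0 : ℝ) < 2 ^ M := by positivity
    set c : ℝ := (2 * J + 1) / 2 ^ (M + 1) with hc
    have hc2 : c = (y i₀ + y (i₀ + n + 1)) / 2 := by
      rw [hc, h₀, h₁, pow_succ]; field_simp; ring
    have hlt : y i₀ < y (i₀ + n + 1) := hy (by omega)
    have hex : ∃ i, i₀ ≤ i ∧ c < y i := ⟨i₀ + n + 1, by omega, by linarith⟩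
    classical
    obtain ⟨hf1, hf2⟩ := Nat.find_spec hex
    have hmin := fun m => @Nat.find_min _ _ hex m
    generalize hk : Nat.find hex = k at *
    have hk0 : k ≠ i₀ := by rintro rfl; linarith
    obtain ⟨i, rfl⟩ : ∃ i, k = i + 1 := ⟨k - 1, by omega⟩
    have hile : y i ≤ c := by
      by_contra! hcon
      exact hmin i (Nat.lt_succ_self i) ⟨by omega, hcon⟩
    have hin : i < i₀ + n + 1 := by
      by_contra! hcon
      have := hy.monotone hcon
      linarith
    have hic : y i = c := by
      refine hile.eq_of_not_lt fun hlt' => ?_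
      obtain ⟨m, j, hj1, hj2⟩ := hstd i (by omega)
      have hm0 : (0 : ℝ) < 2 ^ m := by positivity
      rcases Nat.lt_or_ge M m with hm | hm
      · obtain ⟨r, rfl⟩ : ∃ r, m = M + 1 + r := ⟨m - (M + 1), by omega⟩
        have e : c = ((2 * J + 1) * 2 ^ r) / 2 ^ (M + 1 + r) := by
          rw [hc, pow_add _ (M + 1) r]; field_simp
        rw [e] at hlt' hf2
        rw [hj1, div_lt_div_iff_of_pos_right hm0] at hlt'
        rw [hj2, div_lt_div_iff_of_pos_right hm0] at hf2
        have h1 : j < (2 * J + 1) * 2 ^ r := by exact_mod_cast hlt'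
        have h2 : (2 * J + 1) * 2 ^ r < j + 1 := by exact_mod_cast hf2
        omega
      · have hge : y (i₀ + n + 1) - y i₀ ≤ y (i + 1) - y i := by
          rw [hj1, hj2, h₀, h₁, ← sub_div, ← sub_div, add_sub_cancel_left, add_sub_cancel_left]
          exact one_div_le_one_div_of_le hm0 (pow_le_pow_right₀ one_le_two hm)
        rcases Nat.lt_or_ge i₀ i with hi | hi
        · have := hy hi
          have := hy.monotone (show i + 1 ≤ i₀ + n + 1 by omega)
          linarith
        · obtain rfl : i = i₀ := by omega
          have := hy (show i + 1 < i + n + 1 by omega)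
          linarith
    have hi0 : i₀ < i := hy.lt_iff_lt.1 (by linarith)
    obtain ⟨p, rfl⟩ : ∃ p, i = i₀ + p + 1 := ⟨i - i₀ - 1, by omega⟩
    obtain ⟨q, rfl⟩ : ∃ q, n = p + 1 + q := ⟨n - (p + 1), by omega⟩
    obtain ⟨S, hS⟩ := ih p (by omega) i₀ (M + 1) (2 * J) (by omega)
      (by rw [h₀, pow_succ]; push_cast; field_simp) (by rw [hic, hc]; push_cast; rfl)
    have e1 : i₀ + (p + 1 + q) + 1 = i₀ + p + 1 + q + 1 := by ring
    rw [e1] at h₁ hc2 ⊢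
    obtain ⟨T, hT⟩ := ih q (by omega) (i₀ + p + 1) (M + 1) (2 * J + 1) (by omega)
      (by rw [hic, hc]; push_cast; rfl) (by rw [h₁, pow_succ]; push_cast; field_simp; ring)
    refine ⟨node S T, ?_⟩
    have e2 := List.range'_append_1 (s := i₀) (m := p + 1) (n := q + 1)
    rw [leaves, ← hc2, ← hic, hS, hT, ← List.map_append,
      show p + 1 + q + 1 = p + 1 + (q + 1) by ring, ← e2,
      show i₀ + (p + 1) = i₀ + p + 1 by ring]

/-- An element of `F` supported in a standard dyadic interval is a product of standard bumps
supported there. -/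
lemma mem_bumpGroup_of_mem_thompson {h : ℝ ≃o ℝ} (hh : h ∈ thompson) (A M : ℕ)
    (hA : A + 1 ≤ 2 ^ M)
    (hfix : h ∈ fixing (Iic ((A : ℝ) / 2 ^ M) ∪ Ici (((A : ℝ) + 1) / 2 ^ M))) :
    h ∈ bumpGroup ((A : ℝ) / 2 ^ M) (((A : ℝ) + 1) / 2 ^ M) := by
  obtain ⟨N₀, hN₀⟩ := exists_uniform_stdAff hh.1
  obtain ⟨N, hN, r, rfl⟩ : ∃ N ≥ N₀, ∃ r, N = M + r := ⟨M + N₀, by omega, N₀, rfl⟩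
  have hS := hN₀ _ hN
  set y : ℕ → ℝ := fun i => (i : ℝ) / 2 ^ (M + r) with hy
  have hym : StrictMono y := fun i j hij => by
    simp only [hy]
    gcongr
  have hyh : StrictMono fun i => h (y i) := h.strictMono.comp hym
  have h2r : 0 < 2 ^ r := by positivity
  have hr0 : (0 : ℝ) < 2 ^ r := by positivity
  obtain ⟨n, hn⟩ : ∃ n, 2 ^ r = n + 1 := ⟨2 ^ r - 1, by omega⟩
  have e0 : y (A * 2 ^ r) = (A : ℝ) / 2 ^ M := by
    simp only [hy]; rw [pow_add]; push_cast; field_simp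
  have e1 : y (A * 2 ^ r + n + 1) = ((A : ℝ) + 1) / 2 ^ M := by
    rw [add_assoc, ← hn]
    simp only [hy]; rw [pow_add]; push_cast; field_simp
  have hK : A * 2 ^ r + n + 1 ≤ 2 ^ (M + r) := by
    rw [add_assoc, ← hn, pow_add, ← Nat.succ_mul]
    exact Nat.mul_le_mul_right _ hA
  have e0' : h (y (A * 2 ^ r)) = (A : ℝ) / 2 ^ M := by
    rw [e0]; exact hfix _ (Or.inl (mem_Iic.2 le_rfl))
  have e1' : h (y (A * 2 ^ r + n + 1)) = ((A : ℝ) + 1) / 2 ^ M := by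
    rw [e1]; exact hfix _ (Or.inr (mem_Ici.2 le_rfl))
  have hpiece : ∀ i < 2 ^ (M + r), ∃ (m : ℕ) (j : ℤ), ∀ s, y i ≤ s → s ≤ y (i + 1) →
      h s = j / 2 ^ m + 2 ^ (M + r) / 2 ^ m * (s - y i) := by
    intro i hi
    obtain ⟨m, j, hmj⟩ := hS i (by omega) (by exact_mod_cast hi)
    refine ⟨m, j, fun s hs hs' => ?_⟩
    simp only [hy] at hs hs' ⊢
    push_cast at hs' hmj
    exact hmj s hs hs'
  have hlen : ∀ i, y (i + 1) - y i = 1 / 2 ^ (M + r) := by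
    intro i; simp only [hy]; rw [← sub_div]; push_cast; ring
  obtain ⟨S, hS⟩ := exists_tree_leaves_eq hym (K := 2 ^ (M + r))
    (fun i _ => ⟨M + r, i, by simp [hy], by simp [hy]⟩) n (A * 2 ^ r) M A hK
    (by rw [e0]; simp) (by rw [e1]; simp)
  obtain ⟨T, hT⟩ := exists_tree_leaves_eq hyh (K := 2 ^ (M + r))
    (fun i hi => by
      obtain ⟨m, j, hmj⟩ := hpiece i hi
      refine ⟨m, j, ?_, ?_⟩
      · simp only [hmj _ le_rfl (hym.monotone (Nat.le_succ i)), sub_self, mul_zero, add_zero]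
      · simp only [hmj _ (hym.monotone (Nat.le_succ i)) le_rfl, hlen]
        field_simp)
    n (A * 2 ^ r) M A hK (by rw [e0']; simp) (by rw [e1']; simp)
  simp only [e0', e1'] at hT
  rw [e0, e1] at hS
  have hAM : (A : ℝ) / 2 ^ M ∈ dyadics := ⟨A, M, by simp⟩
  have hAM' : ((A : ℝ) + 1) / 2 ^ M ∈ dyadics := ⟨A + 1, M, by simp⟩
  refine mem_bumpGroup_of_trees hAM hAM' (by gcongr; linarith) hfix (S := S) (T := T) ?_
  rw [hS, hT]
  refine List.forall₂_map_left_iff.2 (List.forall₂_map_right_iff.2 (List.forall₂_same.2 ?_))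
  intro i hi
  have hi' : i < 2 ^ (M + r) := by
    rw [List.mem_range'_1] at hi
    omega
  refine ⟨hym (Nat.lt_succ_self i), hyh (Nat.lt_succ_self i), ?_⟩
  rintro s ⟨hs, hs'⟩
  obtain ⟨m, j, hmj⟩ := hpiece i hi'
  have hle := hym.monotone (Nat.le_succ i)
  simp only [Nat.succ_eq_add_one] at hle hs hs' ⊢
  rw [hlen, hmj s hs hs', hmj _ le_rfl hle, hmj _ hle le_rfl, hlen]
  field_simp
  ring

/-! ### Moving points -/

lemma exists_lt_apply (H : Subgroup (ℝ ≃o ℝ)) {x y : ℝ}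
    (hmov : ∀ z ∈ Icc x y, ∃ h ∈ H, h z ≠ z) : ∃ h ∈ H, y < h x := by
  by_contra! hcon
  set S : Set ℝ := {z | ∃ h ∈ H, h x = z}
  have hbdd : BddAbove S := ⟨y, by rintro _ ⟨h, hh, rfl⟩; exact hcon h hh⟩
  have hxS : x ∈ S := ⟨1, one_mem _, rfl⟩
  have hz : sSup S ∈ Icc x y :=
    ⟨le_csSup hbdd hxS, csSup_le ⟨x, hxS⟩ (by rintro _ ⟨h, hh, rfl⟩; exact hcon h hh)⟩
  have main : ∀ h ∈ H, ¬ sSup S < h (sSup S) := by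
    intro h hh hlt
    have : h⁻¹ (sSup S) < sSup S := by
      have := h⁻¹.strictMono hlt
      rwa [RelIso.inv_apply_self] at this
    obtain ⟨_, ⟨k, hk, rfl⟩, hk'⟩ := exists_lt_of_lt_csSup ⟨x, hxS⟩ this
    have := h.strictMono hk'
    rw [RelIso.apply_inv_self] at this
    exact absurd (le_csSup hbdd ⟨h * k, mul_mem hh hk, rfl⟩) (not_le.2 this)
  obtain ⟨h, hh, hne⟩ := hmov _ hz
  rcases lt_or_gt_of_ne hne with hlt | hlt
  · refine main h⁻¹ (inv_mem hh) ?_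
    have := h⁻¹.strictMono hlt
    rwa [RelIso.inv_apply_self] at this
  · exact main h hh hlt

lemma exists_apply_lt (H : Subgroup (ℝ ≃o ℝ)) {x y : ℝ}
    (hmov : ∀ z ∈ Icc y x, ∃ h ∈ H, h z ≠ z) : ∃ h ∈ H, h x < y := by
  obtain ⟨h, hh, hlt⟩ := exists_lt_apply H hmov
  refine ⟨h⁻¹, inv_mem hh, ?_⟩
  have := h⁻¹.strictMono hlt
  rwa [RelIso.inv_apply_self] at this

lemma zpowers_xgen_moves {a b x y : ℝ} (ha : a < x) (hb : y < b) :
    ∀ z ∈ Icc x y, ∃ h ∈ Subgroup.zpowers (xgen a b), h z ≠ z := fun _ hz =>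
  ⟨_, Subgroup.mem_zpowers _, (lt_xgen (ha.trans_le hz.1) (hz.2.trans_lt hb)).ne'⟩

lemma apply_of_mem_zpowers {g h : ℝ ≃o ℝ} (hh : h ∈ Subgroup.zpowers g) {x : ℝ} (hx : g x = x) :
    h x = x := by
  have : Subgroup.zpowers g ≤ fixing {x} := by
    rw [Subgroup.zpowers_le]
    rintro _ rfl
    exact hx
  exact this hh x rfl

lemma exists_squeeze {ε a b : ℝ} (hε : 0 < ε) (ha : a ∈ dyadics)
    (ha0 : 0 < a) (hab : a < b) (hb : b < 1) :
    ∃ t ∈ thompsonC, ∀ x ∈ Icc ε (1 - ε), t x ∈ Ioo a b := by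
  obtain ⟨α, hα, hα0, hα'⟩ := exists_dyadic_btwn (lt_min hε ha0)
  obtain ⟨β, hβ, hβ', hβ1⟩ := exists_dyadic_btwn (max_lt (by linarith : 1 - ε < 1) hb)
  rw [lt_min_iff] at hα'
  rw [max_lt_iff] at hβ'
  obtain ⟨h, hh, hh'⟩ := exists_lt_apply _
    (zpowers_xgen_moves (y := a) (b := β) hα'.1 (by linarith))
  have hhC : h ∈ thompsonC :=
    (Subgroup.zpowers_le.2 (xgen_mem_thompsonC hα hβ hα0 hβ1)) hh
  have hhβ : h β = β := apply_of_mem_zpowers hh (xgen_of_ge le_rfl)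
  have hlt : h (1 - ε) < β := hhβ ▸ h.strictMono hβ'.1
  obtain ⟨k, hk, hk'⟩ := exists_apply_lt _ (zpowers_xgen_moves (x := b) hab hlt)
  have hkC : k ∈ thompsonC :=
    (Subgroup.zpowers_le.2 (xgen_mem_thompsonC ha hβ ha0 hβ1)) hk
  have hka : k a = a := apply_of_mem_zpowers hk (xgen_of_le le_rfl)
  refine ⟨k * h, mul_mem hkC hhC, fun x hx => ⟨?_, ?_⟩⟩
  · calc a = k a := hka.symm
      _ < k (h x) := k.strictMono (hh'.trans_le (h.monotone hx.1))
  · exact (k.monotone (h.monotone hx.2)).trans_lt hk'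

lemma conj_mem_fixing {f t : ℝ ≃o ℝ} {ε a b : ℝ} (hf : ∀ x, x ≤ ε ∨ 1 - ε ≤ x → f x = x)
    (ht : ∀ x ∈ Icc ε (1 - ε), t x ∈ Ioo a b) : t * f * t⁻¹ ∈ fixing (Iic a ∪ Ici b) := by
  intro x hx
  have : f (t⁻¹ x) = t⁻¹ x := by
    by_cases h : t⁻¹ x ∈ Icc ε (1 - ε)
    · have := ht _ h
      rw [RelIso.apply_inv_self] at this
      rcases hx with hx | hx
      · exact absurd this.1 (not_lt.2 hx)
      · exact absurd this.2 (not_lt.2 hx)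
    · simp only [mem_Icc, not_and_or, not_le] at h
      exact hf _ (h.imp le_of_lt le_of_lt)
  rw [RelIso.mul_apply, RelIso.mul_apply, this, RelIso.apply_inv_self]

/-! ### Perfectness -/

lemma xgen_pentagon {a b : ℝ} (hab : a < b) :
    xgen a b * xgen a b = xgen ((a + b) / 2) b * xgen a b * xgen a ((a + b) / 2) := by
  ext s
  by_cases hs : s ∈ Icc a b
  · refine eq_of_affMaps_leaves (T := node (node (node leaf leaf) leaf) leaf)
      ((affMaps_xgen_rotate (node leaf leaf) leaf leaf hab).mul
        (affMaps_xgen_rotate leaf leaf (node leaf leaf) hab)) ?_ s hs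
    rw [mul_assoc]
    refine AffMaps.mul (AffMaps.mul (Q := (node (node leaf (node leaf leaf)) leaf).leaves a b) ?_
      (affMaps_xgen_rotate leaf (node leaf leaf) leaf hab)) ?_
    · exact List.rel_append (affMaps_xgen_rotate leaf leaf leaf (by linarith))
        (affMaps_of_fix leaf (by linarith) fun s hs => xgen_of_ge hs.1)
    · exact List.rel_append (affMaps_of_fix leaf (by linarith) fun s hs => xgen_of_le hs.2)
        (affMaps_xgen_rotate leaf leaf leaf (by linarith))
  · simp only [mem_Icc, not_and_or, not_le] at hs
    simp only [RelIso.mul_apply]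
    rcases hs with hs | hs
    · rw [xgen_of_le (a := a) (b := b) hs.le, xgen_of_le (a := a) (b := b) hs.le,
        xgen_of_le (a := a) (b := (a + b) / 2) hs.le, xgen_of_le (a := a) (b := b) hs.le,
        xgen_of_le (by linarith)]
    · rw [xgen_of_ge (a := a) (b := b) hs.le, xgen_of_ge (a := a) (b := b) hs.le,
        xgen_of_ge (a := a) (b := (a + b) / 2) (by linarith), xgen_of_ge (a := a) (b := b) hs.le,
        xgen_of_ge (by linarith)]

lemma conj_xgen {a b c : ℝ} {t : ℝ ≃o ℝ} (hab : a < b) (ht : ∀ s ∈ Icc a b, t s = (s + c) / 2) :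
    t * xgen a b * t⁻¹ = xgen ((a + c) / 2) ((b + c) / 2) := by
  rw [mul_inv_eq_iff_eq_mul]
  ext s
  simp only [RelIso.mul_apply]
  have hta := ht a ⟨le_rfl, hab.le⟩
  have htb := ht b ⟨hab.le, le_rfl⟩
  by_cases hs : s ∈ Icc a b
  · have h1 : xgen a b s ∈ Icc a b := by
      rw [xgen_apply]
      obtain ⟨h1, h2⟩ := hs
      constructor <;> grind
    rw [ht _ h1, ht _ hs, xgen_apply, xgen_apply]
    grind
  · simp only [mem_Icc, not_and_or, not_le] at hs
    rcases hs with hs | hs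
    · have := t.monotone hs.le
      rw [xgen_of_le hs.le, xgen_of_le (by linarith)]
    · have := t.monotone hs.le
      rw [xgen_of_ge hs.le, xgen_of_ge (by linarith)]

lemma xgen_mem_commutator {a b : ℝ} (ha : a ∈ dyadics) (hb : b ∈ dyadics) (hab : a < b)
    (h0 : 0 < 2 * a - b) (h1 : 2 * b - a < 1) :
    xgen a b ∈ ⁅thompsonC, thompsonC⁆ := by
  have h2 : ∀ {x : ℝ}, x ∈ dyadics → 2 * x ∈ dyadics := fun {x} hx => by
    rw [two_mul]; exact dyadics.add_mem hx hx
  have hA : xgen a b ∈ thompsonC := xgen_mem_thompsonC ha hb (by linarith) (by linarith)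
  have ht : (xgen a (2 * b - a))⁻¹ ∈ thompsonC :=
    inv_mem (xgen_mem_thompsonC ha (dyadics.sub_mem (h2 hb) ha) (by linarith) h1)
  have hr : xgen (2 * a - b) b ∈ thompsonC :=
    xgen_mem_thompsonC (dyadics.sub_mem (h2 ha) hb) hb h0 (by linarith)
  have hL := conj_xgen (t := (xgen a (2 * b - a))⁻¹) (c := a) hab fun s hs => by
    rw [inv_apply_eq_iff, xgen_fst (by linarith [hs.1]) (by linarith [hs.2])]; ring
  have hR := conj_xgen (t := xgen (2 * a - b) b) (c := b) hab fun s hs => by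
    rw [xgen_thd (by linarith [hs.1]) hs.2]
  rw [add_self_div_two, add_comm b a] at hL
  rw [add_self_div_two] at hR
  have hp := xgen_pentagon hab
  rw [← hL, ← hR] at hp
  generalize xgen a b = A at *
  generalize (xgen a (2 * b - a))⁻¹ = t at *
  generalize xgen (2 * a - b) b = r at *
  have key : A⁻¹ = ⁅(A * A)⁻¹ * r * (A * A), A⁆ * ⁅t, A⁆ := by
    have e : ⁅(A * A)⁻¹ * r * (A * A), A⁆ * ⁅t, A⁆ =
        (A * A)⁻¹ * (r * A * r⁻¹ * A * (t * A * t⁻¹)) * A⁻¹ := by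
      simp only [commutatorElement_def]; group
    rw [e, ← hp]; group
  rw [← inv_mem_iff, key]
  exact mul_mem (Subgroup.commutator_mem_commutator
    (mul_mem (mul_mem (inv_mem (mul_mem hA hA)) hr) (mul_mem hA hA)) hA)
    (Subgroup.commutator_mem_commutator ht hA)

lemma thompsonC_le_commutator : thompsonC ≤ ⁅thompsonC, thompsonC⁆ := by
  have hle : ⁅thompsonC, thompsonC⁆ ≤ thompsonC := by
    rw [Subgroup.commutator_le]
    intro g hg h hh
    exact mul_mem (mul_mem (mul_mem hg hh) (inv_mem hg)) (inv_mem hh)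
  have hbump : bumpGroup (3 / 8) (1 / 2) ≤ ⁅thompsonC, thompsonC⁆ := by
    refine (Subgroup.closure_le _).2 ?_
    rintro _ ⟨c, hc, d, hd, h1, h2, h3, rfl⟩
    exact xgen_mem_commutator hc hd h2 (by linarith) (by linarith)
  intro f hf
  obtain ⟨hfF, ε, hε, hfix⟩ := hf
  obtain ⟨t, ht, ht'⟩ := exists_squeeze hε (a := 3 / 8) (b := 1 / 2) ⟨3, 3, by norm_num⟩
    (by norm_num) (by norm_num) (by norm_num)
  have h1 := conj_mem_fixing hfix ht'
  have h2 : t * f * t⁻¹ ∈ ⁅thompsonC, thompsonC⁆ := by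
    have := mem_bumpGroup_of_mem_thompson (h := t * f * t⁻¹)
      (mul_mem (mul_mem ht.1 hfF) (inv_mem ht.1)) 3 3 (by norm_num)
    norm_num at this
    exact hbump (this h1)
  have h3 : f = ⁅t⁻¹, t * f * t⁻¹⁆ * (t * f * t⁻¹) := by
    simp only [commutatorElement_def]; group
  rw [h3]
  exact mul_mem (Subgroup.commutator_mem_commutator (inv_mem ht) (hle h2)) h2

/-- A subgroup which is normalized by `thompsonC` and moves some point of `(0, 1)` contains
`thompsonC`. -/
lemma thompsonC_le_of_normalized {N : Subgroup (ℝ ≃o ℝ)}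
    (hN : ∀ t ∈ thompsonC, ∀ n ∈ N, t * n * t⁻¹ ∈ N) {n : ℝ ≃o ℝ} (hn : n ∈ N) {x : ℝ}
    (hx : x ∈ Ioo (0 : ℝ) 1) (hne : n x ≠ x) : thompsonC ≤ N := by
  wlog hlt : x < n x generalizing n
  · refine this (inv_mem hn) ?_ ?_
    · rw [Ne, inv_apply_eq_iff]; exact hne.symm
    · have := n⁻¹.strictMono (lt_of_le_of_ne (not_lt.1 hlt) hne)
      rwa [RelIso.inv_apply_self] at this
  obtain ⟨b, -, hb, hb'⟩ := exists_dyadic_btwn (lt_min hlt hx.2)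
  rw [lt_min_iff] at hb'
  have hbx : n⁻¹ b < x := by
    have := n⁻¹.strictMono hb'.1
    rwa [RelIso.inv_apply_self] at this
  obtain ⟨a, ha, ha1, ha2⟩ := exists_dyadic_btwn (max_lt hbx hx.1)
  rw [max_lt_iff] at ha1
  have hbna : b < n a := by
    have := n.strictMono ha1.1
    rwa [RelIso.apply_inv_self] at this
  refine thompsonC_le_commutator.trans ?_
  rw [Subgroup.commutator_le]
  rintro f ⟨hf, ε, hε, hf'⟩ g ⟨hg, δ, hδ, hg'⟩
  have m1 := min_le_left ε δ
  have m2 := min_le_right ε δ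
  obtain ⟨t, ht, ht'⟩ := exists_squeeze (lt_min hε hδ) ha ha1.2 (ha2.trans hb) hb'.2
  have hfF := conj_mem_fixing (f := f)
    (fun x hx => hf' x (hx.imp (by intro; linarith) (by intro; linarith))) ht'
  have hgF := conj_mem_fixing (f := g)
    (fun x hx => hg' x (hx.imp (by intro; linarith) (by intro; linarith))) ht'
  have hf1 : t * f * t⁻¹ ∈ thompsonC :=
    mul_mem (mul_mem ht ⟨hf, ε, hε, hf'⟩) (inv_mem ht)
  have hg1 : t * g * t⁻¹ ∈ thompsonC :=
    mul_mem (mul_mem ht ⟨hg, δ, hδ, hg'⟩) (inv_mem ht)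
  suffices h : ⁅t * f * t⁻¹, t * g * t⁻¹⁆ ∈ N by
    have := hN t⁻¹ (inv_mem ht) _ h
    convert this using 1
    simp only [commutatorElement_def]; group
  generalize t * f * t⁻¹ = f at *
  generalize t * g * t⁻¹ = g at *
  have hzfix : ∀ y, y ≤ b → (n * f⁻¹ * n⁻¹) y = y := by
    intro y hy
    have h1 : n⁻¹ y ≤ a := by
      have := n⁻¹.monotone (hy.trans hbna.le)
      rwa [RelIso.inv_apply_self] at this
    have := inv_mem hfF (n⁻¹ y) (Or.inl h1)
    rw [RelIso.mul_apply, RelIso.mul_apply, this, RelIso.apply_inv_self]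
  have hcomm : Commute (n * f⁻¹ * n⁻¹) g := by
    ext y
    simp only [RelIso.mul_apply (n * f⁻¹ * n⁻¹), RelIso.mul_apply g]
    rcases le_or_gt y b with hy | hy
    · have hgy : g y ≤ b := by
        have := g.monotone hy
        rwa [hgF b (Or.inr (mem_Ici.2 le_rfl))] at this
      rw [hzfix _ hy, hzfix _ hgy]
    · have hzy : b ≤ (n * f⁻¹ * n⁻¹) y := by
        have := (n * f⁻¹ * n⁻¹).monotone hy.le
        rwa [hzfix b le_rfl] at this
      rw [hgF y (Or.inr hy.le), hgF _ (Or.inr hzy)]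
  have hz : f * (n * f⁻¹ * n⁻¹) ∈ N := by
    have := mul_mem (hN f hf1 n hn) (inv_mem hn)
    convert this using 1; group
  have h1 : ⁅f, g⁆ = (f * (n * f⁻¹ * n⁻¹)) * (g * (f * (n * f⁻¹ * n⁻¹))⁻¹ * g⁻¹) := by
    generalize n * f⁻¹ * n⁻¹ = z at *
    have e : z * g * z⁻¹ = g := by rw [hcomm.eq]; group
    calc ⁅f, g⁆ = f * g * f⁻¹ * g⁻¹ := rfl
      _ = f * (z * g * z⁻¹) * f⁻¹ * g⁻¹ := by rw [e]
      _ = _ := by group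
  rw [h1]
  exact mul_mem hz (hN g hg1 _ (inv_mem hz))

/-! ### Reversing the line -/

/-- Conjugation by the reflection `x ↦ 1 - x`. -/
def flip : (ℝ ≃o ℝ) →* (ℝ ≃o ℝ) where
  toFun f :=
    { toFun := fun x => 1 - f (1 - x)
      invFun := fun x => 1 - f⁻¹ (1 - x)
      left_inv := fun x => by simp
      right_inv := fun x => by simp
      map_rel_iff' := by
        intro s t
        simp only [Equiv.coe_fn_mk, sub_le_sub_iff_left, f.le_iff_le] }
  map_one' := by ext x; simp
  map_mul' f g := by ext x; simp

lemma flip_apply (f : ℝ ≃o ℝ) (x : ℝ) : flip f x = 1 - f (1 - x) := rfl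

@[simp] lemma flip_flip (f : ℝ ≃o ℝ) : flip (flip f) = f := by
  ext x; simp [flip_apply]

lemma tendsto_one_sub_nhdsLE (x : ℝ) : Tendsto (fun s : ℝ => 1 - s) (𝓝[≤] x) (𝓝[≥] (1 - x)) :=
  (continuous_const.sub continuous_id).continuousWithinAt.tendsto_nhdsWithin
    fun _ h => sub_le_sub_left (mem_Iic.1 h) 1

lemma tendsto_one_sub_nhdsGE (x : ℝ) : Tendsto (fun s : ℝ => 1 - s) (𝓝[≥] x) (𝓝[≤] (1 - x)) :=
  (continuous_const.sub continuous_id).continuousWithinAt.tendsto_nhdsWithin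
    fun _ h => sub_le_sub_left (mem_Ici.1 h) 1

lemma DPLAt.flip {f : ℝ ≃o ℝ} {x : ℝ} (hf : DPLAt f (1 - x)) : DPLAt (PingPong.flip f) x := by
  obtain ⟨k, l, d, e, hd, he, h1, h2, h3⟩ := hf
  have h : ∀ {k : ℤ} {d : ℝ}, d ∈ dyadics → 1 - 2 ^ k - d ∈ dyadics := fun {k d} hd =>
    dyadics.sub_mem (dyadics.sub_mem dyadics.one_mem (zpow_two_mem_dyadics k)) hd
  refine ⟨l, k, 1 - 2 ^ l - e, 1 - 2 ^ k - d, h he, h hd, ?_, ?_, ?_⟩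
  · filter_upwards [(tendsto_one_sub_nhdsGE x).eventually h2] with s hs
    rw [flip_apply, hs]; ring
  · filter_upwards [(tendsto_one_sub_nhdsLE x).eventually h1] with s hs
    rw [flip_apply, hs]; ring
  · rcases h3 with h3 | ⟨rfl, rfl⟩
    · left
      have := dyadics.sub_mem dyadics.one_mem h3
      rwa [sub_sub_cancel] at this
    · exact Or.inr ⟨rfl, rfl⟩

lemma flip_mem_thompson {f : ℝ ≃o ℝ} (hf : f ∈ thompson) : flip f ∈ thompson := by
  refine ⟨fun x => (hf.1 _).flip, fun x hx => ?_⟩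
  rw [flip_apply, hf.2 _ (hx.symm.imp (by intro; linarith) (by intro; linarith))]
  ring

lemma flip_mem_thompsonC {f : ℝ ≃o ℝ} (hf : f ∈ thompsonC) : flip f ∈ thompsonC := by
  obtain ⟨hf, ε, hε, h⟩ := hf
  refine ⟨flip_mem_thompson hf, ε, hε, fun x hx => ?_⟩
  rw [flip_apply, h _ (hx.symm.imp (by intro; linarith) (by intro; linarith))]
  ring

/-! ### Slopes at the endpoints -/

/-- Near `0`, to its right, the map `f` is multiplication by `2 ^ k`. -/
def SlopeZero (f : ℝ ≃o ℝ) (k : ℤ) : Prop := ∀ᶠ s in 𝓝[≥] (0 : ℝ), f s = 2 ^ k * s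

/-- Near `1`, to its left, the map `f` fixes `1` and has slope `2 ^ k`. -/
def SlopeOne (f : ℝ ≃o ℝ) (k : ℤ) : Prop := SlopeZero (flip f) k

section slopes
variable {f g : ℝ ≃o ℝ} {k l : ℤ}

lemma SlopeZero.map_zero (h : SlopeZero f k) : f 0 = 0 := by
  have := Filter.Eventually.self_of_nhdsWithin h self_mem_Ici
  simpa using this

lemma SlopeZero.unique (h : SlopeZero f k) (h' : SlopeZero f l) : k = l := by
  have h1 : ∀ᶠ s in 𝓝[>] (0 : ℝ), f s = 2 ^ k * s ∧ f s = 2 ^ l * s :=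
    (h.and h').filter_mono (nhdsWithin_mono _ Ioi_subset_Ici_self)
  obtain ⟨s, ⟨hs, hs'⟩, hs0⟩ := (h1.and self_mem_nhdsWithin).exists
  rw [hs] at hs'
  exact zpow_right_injective₀ two_pos (by norm_num) (mul_right_cancel₀ (ne_of_gt hs0) hs')

lemma slopeZero_one : SlopeZero 1 0 := Eventually.of_forall fun s => by simp

lemma SlopeZero.mul (h : SlopeZero f k) (h' : SlopeZero g l) : SlopeZero (f * g) (k + l) := by
  have := tendsto_nhdsGE g 0
  rw [h'.map_zero] at this
  filter_upwards [this.eventually h, h'] with s hs hs'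
  rw [RelIso.mul_apply, hs, hs', zpow_add₀ two_ne_zero, mul_assoc]

lemma SlopeZero.inv (h : SlopeZero f k) : SlopeZero f⁻¹ (-k) := by
  have := tendsto_nhdsGE f⁻¹ 0
  rw [inv_apply_eq_iff.2 h.map_zero.symm] at this
  filter_upwards [this.eventually h] with s hs
  rw [RelIso.apply_inv_self] at hs
  rw [zpow_neg, eq_inv_mul_iff_mul_eq₀ (by positivity), ← hs]

lemma SlopeZero.pow (h : SlopeZero f k) (n : ℕ) : SlopeZero (f ^ n) (n * k) := by
  induction n with
  | zero => simpa using slopeZero_one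
  | succ n ih => rw [pow_succ]; convert ih.mul h using 1; push_cast; ring

lemma SlopeZero.zpow (h : SlopeZero f k) (n : ℤ) : SlopeZero (f ^ n) (n * k) := by
  rcases Int.eq_nat_or_neg n with ⟨n, rfl | rfl⟩
  · simpa using h.pow n
  · simpa using (h.pow n).inv

lemma slopeOne_one : SlopeOne 1 0 := by simpa [SlopeOne] using slopeZero_one

lemma SlopeOne.unique (h : SlopeOne f k) (h' : SlopeOne f l) : k = l := SlopeZero.unique h h'

lemma SlopeOne.mul (h : SlopeOne f k) (h' : SlopeOne g l) : SlopeOne (f * g) (k + l) := by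
  rw [SlopeOne, map_mul]; exact SlopeZero.mul h h'

lemma SlopeOne.inv (h : SlopeOne f k) : SlopeOne f⁻¹ (-k) := by
  rw [SlopeOne, map_inv]; exact SlopeZero.inv h

lemma SlopeOne.pow (h : SlopeOne f k) (n : ℕ) : SlopeOne (f ^ n) (n * k) := by
  rw [SlopeOne, map_pow]; exact SlopeZero.pow h n

lemma SlopeOne.zpow (h : SlopeOne f k) (n : ℤ) : SlopeOne (f ^ n) (n * k) := by
  rw [SlopeOne, map_zpow]; exact SlopeZero.zpow h n

lemma exists_slopeZero (hf : f ∈ thompson) : ∃ k, SlopeZero f k := by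
  obtain ⟨k, -, d, -, -, -, h, -⟩ := hf.1 0
  have h0 := h.self_of_nhdsWithin self_mem_Ici
  rw [hf.2 0 (Or.inl le_rfl)] at h0
  obtain rfl : d = 0 := by linarith
  exact ⟨k, by simpa [SlopeZero] using h⟩

lemma exists_slopeOne (hf : f ∈ thompson) : ∃ k, SlopeOne f k :=
  exists_slopeZero (flip_mem_thompson hf)

lemma SlopeZero.exists_eq (h : SlopeZero f k) : ∃ ε > 0, ∀ s, 0 ≤ s → s ≤ ε → f s = 2 ^ k * s := by
  obtain ⟨ε, hε, h⟩ := mem_nhdsGE_iff_exists_Icc_subset.1 h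
  exact ⟨ε, hε, fun s h0 h1 => h ⟨h0, h1⟩⟩

lemma slopeZero_of_eqOn {ε : ℝ} (hε : 0 < ε) (h : ∀ s, 0 ≤ s → s ≤ ε → f s = 2 ^ k * s) :
    SlopeZero f k := by
  filter_upwards [Icc_mem_nhdsGE hε] with s hs using h s hs.1 hs.2

lemma mem_thompsonC_iff :
    f ∈ thompsonC ↔ f ∈ thompson ∧ SlopeZero f 0 ∧ SlopeOne f 0 := by
  constructor
  · rintro ⟨hf, ε, hε, h⟩
    refine ⟨hf, slopeZero_of_eqOn hε fun s _ h' => ?_, slopeZero_of_eqOn hε fun s _ h' => ?_⟩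
    · rw [h s (Or.inl h')]; simp
    · rw [flip_apply, h (1 - s) (Or.inr (by linarith))]; simp
  · rintro ⟨hf, h0, h1⟩
    obtain ⟨ε, hε, h0⟩ := h0.exists_eq
    obtain ⟨δ, hδ, h1⟩ := SlopeZero.exists_eq h1
    refine mem_thompsonC_of_fix (a := ε) (b := 1 - δ) hf hε (by linarith) fun x hx => ?_
    rcases le_or_gt x 0 with hx0 | hx0
    · exact hf.2 x (Or.inl hx0)
    rcases le_or_gt 1 x with hx1 | hx1
    · exact hf.2 x (Or.inr hx1)
    rcases hx with hx | hx
    · rw [h0 x hx0.le hx]; simp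
    · have := h1 (1 - x) (by linarith) (by linarith)
      rw [flip_apply, zpow_zero, sub_sub_cancel] at this
      linarith

lemma SlopeZero.of_conj {t : ℝ ≃o ℝ} (ht : t ∈ thompson) (h : SlopeZero f k) :
    SlopeZero (t * f * t⁻¹) k := by
  obtain ⟨l, hl⟩ := exists_slopeZero ht
  convert (hl.mul h).mul hl.inv using 1
  ring

lemma SlopeOne.of_conj {t : ℝ ≃o ℝ} (ht : t ∈ thompson) (h : SlopeOne f k) :
    SlopeOne (t * f * t⁻¹) k := by
  rw [SlopeOne, map_mul, map_mul, map_inv]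
  exact SlopeZero.of_conj (flip_mem_thompson ht) h

end slopes

lemma slopeZero_xgen {b : ℝ} (hb : 0 < b) : SlopeZero (xgen 0 b) 1 :=
  slopeZero_of_eqOn (ε := b / 4) (by linarith) fun s h0 h1 => by
    rw [xgen_fst h0 (by linarith)]; simp

lemma slopeOne_xgen_of_lt {a b : ℝ} (hb : b < 1) : SlopeOne (xgen a b) 0 :=
  slopeZero_of_eqOn (ε := 1 - b) (by linarith) fun s h0 h1 => by
    rw [flip_apply, xgen_of_ge (by linarith)]; simp

lemma slopeOne_xgen {a : ℝ} (ha : a < 1) : SlopeOne (xgen a 1) (-1) :=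
  slopeZero_of_eqOn (ε := (1 - a) / 2) (by linarith) fun s h0 h1 => by
    rw [flip_apply, xgen_thd (by linarith) (by linarith), zpow_neg_one]; ring

lemma slopeZero_xgen_of_lt {a b : ℝ} (ha : 0 < a) : SlopeZero (xgen a b) 0 :=
  slopeZero_of_eqOn ha fun s h0 h1 => by rw [xgen_of_le h1]; simp

/-! ### Subgroups of finite index -/

lemma lt_xgen_pow {a b x : ℝ} (hx : a < x) (hx' : x < b) {n : ℕ} (hn : n ≠ 0) :
    x < (xgen a b ^ n) x ∧ (xgen a b ^ n) x < b := by
  have hb : ∀ y, y < b → xgen a b y < b := by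
    intro y hy
    have := (xgen a b).strictMono hy
    rwa [xgen_of_ge le_rfl] at this
  obtain ⟨m, rfl⟩ := Nat.exists_eq_succ_of_ne_zero hn
  clear hn
  induction m with
  | zero =>
    rw [Nat.succ_eq_add_one, zero_add, pow_one]
    exact ⟨lt_xgen hx hx', hb x hx'⟩
  | succ m ih =>
    rw [Nat.succ_eq_add_one, pow_succ', RelIso.mul_apply]
    exact ⟨ih.1.trans (lt_xgen (hx.trans ih.1) ih.2), hb _ ih.2⟩

lemma exists_pow_mem_of_cover {G : Subgroup (ℝ ≃o ℝ)}
    {T : Set (ℝ ≃o ℝ)} (hT : T.Finite)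
    (hcov : ∀ g ∈ thompson, ∃ t ∈ T, t ∈ thompson ∧ ∃ h ∈ G, g = t * h) :
    thompsonC ≤ G ∧ ∀ g ∈ thompson, ∃ n : ℕ, n ≠ 0 ∧ g ^ n ∈ G := by
  set K := G.subgroupOf thompson with hK
  have hfin : K.FiniteIndex := by
    rw [Subgroup.finiteIndex_iff_finite_quotient]
    have := hT.to_subtype
    classical
    refine Finite.of_surjective
      (fun t : T => if h : t.1 ∈ thompson then (QuotientGroup.mk (⟨t.1, h⟩ : thompson) :
        thompson ⧸ K) else QuotientGroup.mk 1) ?_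
    intro q
    obtain ⟨⟨g, hg⟩, rfl⟩ := QuotientGroup.mk_surjective q
    obtain ⟨t, htT, ht, h, hh, rfl⟩ := hcov g hg
    refine ⟨⟨t, htT⟩, ?_⟩
    simp only [ht, dif_pos]
    rw [QuotientGroup.eq]
    simpa [hK, Subgroup.mem_subgroupOf] using hh
  have key : ∀ (L : Subgroup thompson) [L.FiniteIndex], ∀ g (hg : g ∈ thompson),
      ∃ n : ℕ, n ≠ 0 ∧ (⟨g, hg⟩ : thompson) ^ n ∈ L := by
    intro L hL g hg
    obtain ⟨n, hn, -, h⟩ := L.exists_pow_mem_of_index_ne_zero hL.index_ne_zero ⟨g, hg⟩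
    exact ⟨n, hn.ne', h⟩
  constructor
  · have hx : xgen (1 / 4) (1 / 2) ∈ thompson :=
      xgen_mem_thompson ⟨1, 2, by norm_num⟩ ⟨1, 1, by norm_num⟩ (by norm_num) (by norm_num)
    obtain ⟨n, hn, hn'⟩ := key K.normalCore _ hx
    set N := K.normalCore.map thompson.subtype with hN
    have hle : N ≤ G := by
      rintro _ ⟨y, hy, rfl⟩
      exact Subgroup.mem_subgroupOf.1 (Subgroup.normalCore_le _ hy)
    have hnN : xgen (1 / 4) (1 / 2) ^ n ∈ N := by
      have := Subgroup.mem_map_of_mem thompson.subtype hn'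
      rwa [map_pow] at this
    have hconj : ∀ t ∈ thompsonC, ∀ y ∈ N, t * y * t⁻¹ ∈ N := by
      rintro t ht _ ⟨y, hy, rfl⟩
      have := Subgroup.mem_map_of_mem thompson.subtype
        ((Subgroup.normalCore_normal K).conj_mem _ hy ⟨t, ht.1⟩)
      rwa [map_mul, map_mul, map_inv] at this
    have hne := (lt_xgen_pow (a := 1 / 4) (b := 1 / 2) (x := 3 / 8) (by norm_num)
      (by norm_num) hn).1.ne'
    exact (thompsonC_le_of_normalized hconj hnN (by norm_num) hne).trans hle
  · intro g hg
    obtain ⟨n, hn, h⟩ := key K g hg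
    exact ⟨n, hn, Subgroup.mem_subgroupOf.1 h⟩

/-! ### Centralizers -/

lemma Commute.apply_fixed {c u : ℝ ≃o ℝ} (h : Commute c u) {x : ℝ} :
    u (c x) = c x ↔ u x = x := by
  have : u (c x) = c (u x) := by
    rw [← RelIso.mul_apply, ← RelIso.mul_apply, h.eq]
  rw [this, c.injective.eq_iff]

lemma Commute.fixes_ends {c : ℝ ≃o ℝ} {a b : ℝ} (hab : a < b) (h : Commute c (xgen a b)) :
    c a = a ∧ c b = b := by
  have hsupp : ∀ x, xgen a b x ≠ x ↔ x ∈ Ioo a b := by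
    intro x
    constructor
    · intro hx
      by_contra hcon
      simp only [mem_Ioo, not_and_or, not_lt] at hcon
      exact hx (hcon.elim xgen_of_le xgen_of_ge)
    · exact fun hx => (lt_xgen hx.1 hx.2).ne'
  have himg : Ioo (c a) (c b) = Ioo a b := by
    rw [← OrderIso.image_Ioo]
    ext x
    constructor
    · rintro ⟨y, hy, rfl⟩
      rw [← hsupp] at hy ⊢
      rwa [Ne, Commute.apply_fixed h]
    · intro hx
      refine ⟨c⁻¹ x, ?_, by simp⟩
      rw [← hsupp] at hx ⊢
      rwa [Ne, Commute.apply_fixed h.inv_left]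
  have hc := c.strictMono hab
  constructor
  · rw [← csInf_Ioo hc, himg, csInf_Ioo hab]
  · rw [← csSup_Ioo hc, himg, csSup_Ioo hab]

lemma Commute.fix_of_apply {c h : ℝ ≃o ℝ} (hc : Commute c h) {x : ℝ} (hx : c (h x) = h x) :
    c x = x := (Commute.apply_fixed hc.symm).1 hx

lemma exists_centralizer_zero {k : ℝ ≃o ℝ} {s : ℤ} (hk : SlopeZero k s) (hs : s ≠ 0) :
    ∃ u ∈ thompsonC, ∃ v ∈ thompsonC, ∀ c ∈ thompson, Commute c k → Commute c u → Commute c v →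
      ∀ x ≤ 1 / 2, c x = x := by
  wlog hs0 : 0 < s generalizing k s
  · obtain ⟨u, hu, v, hv, h⟩ := this hk.inv (neg_ne_zero.2 hs) (by omega)
    exact ⟨u, hu, v, hv, fun c hc hck => h c hc hck.inv_right⟩
  obtain ⟨ε, hε, hk⟩ := hk.exists_eq
  have h2s : (1 : ℝ) < 2 ^ s := one_lt_zpow₀ (by norm_num) hs0
  have h2s0 : (0 : ℝ) < 2 ^ s := by positivity
  obtain ⟨a, ha, ha0, ha'⟩ := exists_dyadic_btwn (x := 0) (y := min ε ((1 / 2) / 2 ^ s))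
    (lt_min hε (by positivity))
  rw [lt_min_iff, lt_div_iff₀ h2s0] at ha'
  obtain ⟨haε, ha1⟩ := ha'
  have ha12 : a < 1 / 2 := by nlinarith
  have hb : (3 / 4 : ℝ) ∈ dyadics := ⟨3, 2, by norm_num⟩
  have hm : (a + 3 / 4) / 2 ∈ dyadics := half_mem_dyadics (dyadics.add_mem ha hb)
  refine ⟨xgen a (3 / 4), xgen_mem_thompsonC ha hb ha0 (by norm_num),
    xgen a ((a + 3 / 4) / 2), xgen_mem_thompsonC ha hm ha0 (by linarith), ?_⟩
  intro c hc hck hcu hcv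
  have hca : c a = a := (Commute.fixes_ends (by linarith) hcu).1
  have hcm := (Commute.fixes_ends (by linarith) hcv).2
  have hcz : ∀ h ∈ Subgroup.zpowers (xgen a (3 / 4)), Commute c h := by
    rintro _ ⟨n, rfl⟩
    exact hcu.zpow_right n
  have haz : ∀ h ∈ Subgroup.zpowers (xgen a (3 / 4)), ∀ x, a < x → a < h x := by
    intro h hh x hx
    have := h.strictMono hx
    rwa [apply_of_mem_zpowers hh (xgen_of_le le_rfl)] at this
  obtain ⟨y, hay, hy⟩ : ∃ y, a < y ∧ ∀ x ∈ Icc a y, c x = x := by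
    obtain ⟨j, -, d, -, -, -, h, -⟩ := hc.1 a
    obtain ⟨y, hy, h⟩ := mem_nhdsGE_iff_exists_Icc_subset.1 h
    refine ⟨y, hy, ?_⟩
    obtain ⟨z, hz, hzy⟩ := exists_apply_lt _ (zpowers_xgen_moves (x := y)
      (y := (a + 3 / 4) / 2) (b := 3 / 4) hy (by linarith))
    have hz1 := haz z hz ((a + 3 / 4) / 2) (by linarith)
    have hz2 : c (z ((a + 3 / 4) / 2)) = z ((a + 3 / 4) / 2) :=
      (Commute.apply_fixed (hcz z hz).symm).2 hcm
    have e1 : c a = _ := h ⟨le_rfl, le_of_lt hy⟩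
    have e2 : c (z ((a + 3 / 4) / 2)) = _ := h ⟨hz1.le, hzy.le⟩
    rw [hca] at e1
    rw [hz2] at e2
    have e3 : ((2 : ℝ) ^ j - 1) * (z ((a + 3 / 4) / 2) - a) = 0 := by linarith
    have e4 : (2 : ℝ) ^ j = 1 :=
      sub_eq_zero.1 ((mul_eq_zero.1 e3).resolve_right (sub_ne_zero.2 hz1.ne'))
    intro x hx
    have e5 : c x = _ := h hx
    rw [e4] at e1 e5
    linarith
  have hab : ∀ x, a ≤ x → x < 3 / 4 → c x = x := by
    intro x hx hx'
    rcases le_or_gt x y with h | h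
    · exact hy x ⟨hx, h⟩
    · obtain ⟨z, hz, hzy⟩ := exists_apply_lt _ (zpowers_xgen_moves hay hx')
      exact Commute.fix_of_apply (hcz z hz) (hy _ ⟨(haz z hz x (hay.trans h)).le, hzy.le⟩)
  have hind : ∀ n : ℕ, ∀ x, a / (2 ^ s) ^ n ≤ x → x < 3 / 4 → c x = x := by
    intro n
    induction n with
    | zero => simpa using hab
    | succ n ih =>
      intro x hx hx'
      rcases le_or_gt a x with h | h
      · exact hab x h hx'
      have hx0 : 0 < x := lt_of_lt_of_le (by positivity) hx
      have hkx := hk x hx0.le (h.le.trans haε.le)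
      refine Commute.fix_of_apply hck (ih _ ?_ ?_)
      · rw [hkx]
        rw [div_le_iff₀ (by positivity)] at hx ⊢
        rw [pow_succ] at hx
        linarith
      · rw [hkx]
        nlinarith
  intro x hx
  rcases le_or_gt x 0 with h | h
  · exact hc.2 x (Or.inl h)
  obtain ⟨n, hn⟩ := pow_unbounded_of_one_lt (a / x) h2s
  refine hind n x ?_ (by linarith)
  rw [div_lt_iff₀ h] at hn
  rw [div_le_iff₀ (by positivity)]
  linarith

lemma exists_centralizer_one {k : ℝ ≃o ℝ} {s : ℤ} (hk : SlopeOne k s) (hs : s ≠ 0) :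
    ∃ u ∈ thompsonC, ∃ v ∈ thompsonC, ∀ c ∈ thompson, Commute c k → Commute c u → Commute c v →
      ∀ x, 1 / 2 ≤ x → c x = x := by
  obtain ⟨u, hu, v, hv, h⟩ := exists_centralizer_zero hk hs
  refine ⟨flip u, flip_mem_thompsonC hu, flip v, flip_mem_thompsonC hv, ?_⟩
  intro c hc hck hcu hcv x hx
  have := h (flip c) (flip_mem_thompson hc) (hck.map flip)
    (by simpa using hcu.map flip) (by simpa using hcv.map flip) (1 - x) (by linarith)
  rw [flip_apply, sub_sub_cancel] at this
  linarith

/-! ### Groups generated by proper families -/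

/-- Homeomorphisms of the line with trivial germ along a filter. -/
def trivialGerm (l : Filter ℝ) : Subgroup (ℝ ≃o ℝ) where
  carrier := {f | ∀ᶠ s in l, f s = s}
  mul_mem' := by
    intro f g hf hg
    filter_upwards [hf, hg] with s hs hs'
    rw [RelIso.mul_apply, hs', hs]
  one_mem' := Eventually.of_forall fun _ => rfl
  inv_mem' := by
    intro f hf
    filter_upwards [hf] with s hs
    exact inv_apply_eq_iff.2 hs.symm

lemma conj_mem_trivialGerm {l : Filter ℝ} {f h : ℝ ≃o ℝ} (hf : f ∈ trivialGerm l)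
    (hh : Tendsto (h⁻¹ : ℝ ≃o ℝ) l l) : h * f * h⁻¹ ∈ trivialGerm l := by
  filter_upwards [hh.eventually hf] with s hs
  rw [RelIso.mul_apply, RelIso.mul_apply, hs, RelIso.apply_inv_self]

lemma exists_zpow_mul_zpow {K : Type*} [Group K] {N : Subgroup K} [N.Normal] {f g : K}
    (hfg : ⁅f, g⁆ ∈ N) {Y : Set K} (hY : Subgroup.closure Y = ⊤)
    (h : ∀ y ∈ Y, y = f ∨ y = g ∨ y ∈ N) (k : K) : ∃ n m : ℤ, k * (f ^ n * g ^ m)⁻¹ ∈ N := by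
  have hc : Commute (f : K ⧸ N) (g : K ⧸ N) := by
    rw [← commutatorElement_eq_one_iff_commute]
    exact (QuotientGroup.eq_one_iff _).2 hfg
  suffices hs : ∃ n m : ℤ, (k : K ⧸ N) = (f : K ⧸ N) ^ n * (g : K ⧸ N) ^ m by
    obtain ⟨n, m, hnm⟩ := hs
    refine ⟨n, m, (QuotientGroup.eq_one_iff _).1 ?_⟩
    rw [QuotientGroup.mk_mul, QuotientGroup.mk_inv, QuotientGroup.mk_mul, QuotientGroup.mk_zpow,
      QuotientGroup.mk_zpow, hnm, mul_inv_cancel]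
  have hk : k ∈ Subgroup.closure Y := hY ▸ Subgroup.mem_top k
  induction hk using Subgroup.closure_induction with
  | mem y hy =>
    rcases h y hy with rfl | rfl | hN
    · exact ⟨1, 0, by simp⟩
    · exact ⟨0, 1, by simp⟩
    · exact ⟨0, 0, by simpa using hN⟩
  | one => exact ⟨0, 0, by simp⟩
  | mul a b _ _ ha hb =>
    obtain ⟨n, m, hnm⟩ := ha
    obtain ⟨n', m', hnm'⟩ := hb
    refine ⟨n + n', m + m', ?_⟩
    rw [QuotientGroup.mk_mul, hnm, hnm', zpow_add, zpow_add, mul_assoc, mul_assoc,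
      ← mul_assoc (_ ^ m), (hc.symm.zpow_zpow m n').eq, mul_assoc]
  | inv a _ ha =>
    obtain ⟨n, m, hnm⟩ := ha
    refine ⟨-n, -m, ?_⟩
    rw [QuotientGroup.mk_inv, hnm, mul_inv_rev, zpow_neg, zpow_neg,
      ((hc.symm.zpow_zpow m n).inv_inv).eq]

lemma commutator_mem_of_forall_zpow {K : Type*} [Group K] {N : Subgroup K} [N.Normal] {f g : K}
    (hfg : ⁅f, g⁆ ∈ N) (h : ∀ k, ∃ n m : ℤ, k * (f ^ n * g ^ m)⁻¹ ∈ N) (a b : K) :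
    ⁅a, b⁆ ∈ N := by
  have hc : Commute (f : K ⧸ N) (g : K ⧸ N) := by
    rw [← commutatorElement_eq_one_iff_commute]
    exact (QuotientGroup.eq_one_iff _).2 hfg
  have key : ∀ k : K, ∃ n m : ℤ, (k : K ⧸ N) = (f : K ⧸ N) ^ n * (g : K ⧸ N) ^ m := by
    intro k
    obtain ⟨n, m, hnm⟩ := h k
    refine ⟨n, m, ?_⟩
    rw [← QuotientGroup.eq_one_iff] at hnm
    rw [QuotientGroup.mk_mul, QuotientGroup.mk_inv, QuotientGroup.mk_mul, QuotientGroup.mk_zpow,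
      QuotientGroup.mk_zpow] at hnm
    exact mul_inv_eq_one.1 hnm
  obtain ⟨n, m, ha⟩ := key a
  obtain ⟨n', m', hb⟩ := key b
  have hab : Commute (a : K ⧸ N) (b : K ⧸ N) := by
    rw [ha, hb]
    exact (((Commute.refl _).zpow_zpow n n').mul_right (hc.zpow_zpow n m')).mul_left
      ((hc.symm.zpow_zpow m n').mul_right ((Commute.refl _).zpow_zpow m m'))
  exact (QuotientGroup.eq_one_iff _).1 (commutatorElement_eq_one_iff_commute.2 hab)

/-- At each point, at most one element of `Y` has a nontrivial germ to the right and at most one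
a nontrivial germ to the left, among those fixing the point. -/
def ProperFamily {K : Type*} [Group K] (ρ : K →* (ℝ ≃o ℝ)) (Y : Set K) : Prop :=
  ∀ f ∈ Y, ∀ g ∈ Y, f ≠ g → ∀ t, ρ f t = t → ρ g t = t →
    (ρ f ∈ trivialGerm (𝓝[>] t) ∨ ρ g ∈ trivialGerm (𝓝[>] t)) ∧
    (ρ f ∈ trivialGerm (𝓝[<] t) ∨ ρ g ∈ trivialGerm (𝓝[<] t))

lemma exists_unique_active {K : Type*} [Group K] {Y : Set K} {P : Subgroup K}
    (h : ∀ f ∈ Y, ∀ g ∈ Y, f ≠ g → f ∈ P ∨ g ∈ P) :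
    ∃ f, (f ∈ Y ∨ f = 1) ∧ ∀ y ∈ Y, y ≠ f → y ∈ P := by
  by_cases hP : ∀ y ∈ Y, y ∈ P
  · exact ⟨1, Or.inr rfl, fun y hy _ => hP y hy⟩
  · push Not at hP
    obtain ⟨f, hf, hfP⟩ := hP
    exact ⟨f, Or.inl hf, fun y hy hne => (h y hy f hf hne).resolve_right hfP⟩

section action
variable {K : Type*} [Group K] {ρ : K →* (ℝ ≃o ℝ)} {p q : ℝ}

lemma commute_of_complementary (hfaith : ∀ k, (∀ s ∈ Ioo p q, ρ k s = s) → k = 1)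
    (hp : ∀ k, ρ k p = p) (hq : ∀ k, ρ k q = q) {c e : K} {δ : ℝ} (hδ : δ ∈ Ioo p q)
    (hc : ∀ s, δ ≤ s → s < q → ρ c s = s) (he : ∀ s, p < s → s ≤ δ → ρ e s = s) :
    Commute c e := by
  rw [← commutatorElement_eq_one_iff_commute]
  refine hfaith _ fun s hs => ?_
  have hcδ := hc δ le_rfl hδ.2
  have heδ := he δ hδ.1 le_rfl
  have main : ∀ s ∈ Ioo p q, ρ c (ρ e s) = ρ e (ρ c s) := by
    intro s hs
    rcases le_or_gt s δ with h | h
    · have h1 := (ρ c).strictMono hs.1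
      have h2 := (ρ c).monotone h
      rw [hp] at h1
      rw [hcδ] at h2
      rw [he s hs.1 h, he _ h1 h2]
    · have h1 := (ρ e).strictMono hs.2
      have h2 := (ρ e).strictMono h
      rw [hq] at h1
      rw [heδ] at h2
      rw [hc s h.le hs.2, hc _ h2.le h1]
  have hs1 : (ρ e⁻¹) s ∈ Ioo p q := by
    have h1 := (ρ e⁻¹).strictMono hs.1
    have h2 := (ρ e⁻¹).strictMono hs.2
    rw [hp] at h1
    rw [hq] at h2
    exact ⟨h1, h2⟩
  have hs2 : (ρ c⁻¹) ((ρ e⁻¹) s) ∈ Ioo p q := by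
    have h1 := (ρ c⁻¹).strictMono hs1.1
    have h2 := (ρ c⁻¹).strictMono hs1.2
    rw [hp] at h1
    rw [hq] at h2
    exact ⟨h1, h2⟩
  have := main _ hs2
  rw [commutatorElement_def, map_mul, map_mul, map_mul, RelIso.mul_apply, RelIso.mul_apply,
    RelIso.mul_apply, this, map_inv, map_inv, RelIso.apply_inv_self, RelIso.apply_inv_self]

end action

theorem exists_germ_subgroups {K : Type*} [Group K] {ρ : K →* (ℝ ≃o ℝ)}
    (hρ : Function.Injective ρ) (hsupp : ∀ k x, x ≤ 0 ∨ 1 ≤ x → ρ k x = x)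
    {Y : Set K} (hY : Subgroup.closure Y = ⊤) (hprop : ProperFamily ρ Y)
    {D : Subgroup K} (hD : D ≠ ⊥) (hperf : D ≤ ⁅D, D⁆)
    (hmin : ∀ N : Subgroup K, N.Normal → N ≠ ⊥ → D ≤ N) :
    ∃ P Q : Subgroup K, D ≤ P ⊓ Q ∧
      (∃ f g : K, (∀ k, ∃ n m : ℤ, k * (f ^ n * g ^ m)⁻¹ ∈ P ⊓ Q) ∧ (f ∈ Q ∧ g ∈ P ∨ g = 1)) ∧
      (∀ E : Set K, E.Finite → E ⊆ P → ∃ c ≠ 1, ∀ e ∈ E, Commute c e) ∧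
      (∀ E : Set K, E.Finite → E ⊆ Q → ∃ c ≠ 1, ∀ e ∈ E, Commute c e) ∧
      (∀ E : Set K, E.Finite → E ⊆ P ⊓ Q → ∃ t, ∀ e ∈ E, ∀ e' ∈ E, Commute e (t * e' * t⁻¹)) := by
  obtain ⟨h₀, hh₀, hne₀⟩ := D.bot_or_exists_ne_one.resolve_left hD
  obtain ⟨x, hx⟩ : ∃ x, ρ h₀ x ≠ x := by
    by_contra! hcon
    exact hne₀ (hρ (by rw [map_one]; ext x; exact hcon x))
  -- the orbit of a moved point
  set O : Set ℝ := range fun k : K => ρ k x with hO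
  have hx01 : x ∈ Ioo (0 : ℝ) 1 := by
    by_contra hcon
    simp only [mem_Ioo, not_and_or, not_lt] at hcon
    exact hx (hsupp _ _ hcon)
  have hO01 : O ⊆ Icc 0 1 := by
    rintro _ ⟨k, rfl⟩
    have h1 := (ρ k).monotone hx01.1.le
    have h2 := (ρ k).monotone hx01.2.le
    rw [hsupp k 0 (Or.inl le_rfl)] at h1
    rw [hsupp k 1 (Or.inr le_rfl)] at h2
    exact ⟨h1, h2⟩
  have hOne : O.Nonempty := ⟨_, 1, rfl⟩
  have hbelow : BddBelow O := ⟨0, fun _ h => (hO01 h).1⟩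
  have habove : BddAbove O := ⟨1, fun _ h => (hO01 h).2⟩
  have hOimg : ∀ k, ρ k '' O = O := by
    intro k
    ext y
    constructor
    · rintro ⟨_, ⟨l, rfl⟩, rfl⟩
      exact ⟨k * l, by simp⟩
    · rintro ⟨l, rfl⟩
      exact ⟨_, ⟨k⁻¹ * l, rfl⟩, by simp⟩
  set p := sInf O with hp_def
  set q := sSup O with hq_def
  have hp : ∀ k, ρ k p = p := by
    intro k
    rw [hp_def, OrderIso.map_csInf' _ hOne hbelow, hOimg]
  have hq : ∀ k, ρ k q = q := by
    intro k
    rw [hq_def, OrderIso.map_csSup' _ hOne habove, hOimg]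
  have hpx : p < x ∧ x < q := by
    have h1 : ∀ k, p ≤ ρ k x := fun k => csInf_le hbelow ⟨k, rfl⟩
    have h2 : ∀ k, ρ k x ≤ q := fun k => le_csSup habove ⟨k, rfl⟩
    have hl : p ≠ x := fun h => hx (by rw [← h]; exact hp h₀)
    have hr : x ≠ q := fun h => hx (by rw [h]; exact hq h₀)
    have := h1 1
    have := h2 1
    simp only [map_one, RelIso.one_apply] at *
    exact ⟨lt_of_le_of_ne (by assumption) hl, lt_of_le_of_ne (by assumption) hr⟩
  have hmov : ∀ z ∈ Ioo p q, ∃ h ∈ ρ.range, h z ≠ z := by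
    intro z hz
    by_contra! hcon
    obtain ⟨_, ⟨k, rfl⟩, hk⟩ := exists_lt_of_csInf_lt hOne hz.1
    obtain ⟨_, ⟨l, rfl⟩, hl⟩ := exists_lt_of_lt_csSup hOne hz.2
    have := (ρ (l * k⁻¹)).strictMono hk
    rw [hcon _ ⟨_, rfl⟩] at this
    simp only [map_mul, map_inv, RelIso.mul_apply, RelIso.inv_apply_self] at this
    exact lt_asymm hl this
  have hIoo : ∀ k s, s ∈ Ioo p q → ρ k s ∈ Ioo p q := by
    intro k s hs
    have h1 := (ρ k).strictMono hs.1
    have h2 := (ρ k).strictMono hs.2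
    rw [hp] at h1
    rw [hq] at h2
    exact ⟨h1, h2⟩
  have hfaith : ∀ k, (∀ s ∈ Ioo p q, ρ k s = s) → k = 1 := by
    set N : Subgroup K := (fixing (Ioo p q)).comap ρ with hN
    have hNn : N.Normal := by
      refine ⟨fun n hn g => ?_⟩
      intro s hs
      have h1 := hn _ (hIoo g⁻¹ s hs)
      rw [map_inv] at h1
      rw [map_mul, map_mul, map_inv, RelIso.mul_apply, RelIso.mul_apply, h1,
        RelIso.apply_inv_self]
    by_cases hbot : N = ⊥
    · intro k hk
      have : k ∈ N := hk
      rwa [hbot, Subgroup.mem_bot] at this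
    · exact absurd (hmin N hNn hbot hh₀ x hpx) hx
  -- the germ subgroups
  set P : Subgroup K := (trivialGerm (𝓝[>] p)).comap ρ with hP
  set Q : Subgroup K := (trivialGerm (𝓝[<] q)).comap ρ with hQ
  have hPn : P.Normal := by
    refine ⟨fun n hn g => ?_⟩
    rw [hP, Subgroup.mem_comap, map_mul, map_mul, map_inv]
    refine conj_mem_trivialGerm hn ?_
    have := tendsto_nhdsGT (ρ g⁻¹) p
    rwa [hp, map_inv] at this
  have hQn : Q.Normal := by
    refine ⟨fun n hn g => ?_⟩
    rw [hQ, Subgroup.mem_comap, map_mul, map_mul, map_inv]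
    refine conj_mem_trivialGerm hn ?_
    have := tendsto_nhdsLT (ρ g⁻¹) q
    rwa [hq, map_inv] at this
  obtain ⟨f, hfY, hf⟩ := exists_unique_active (P := P) (Y := Y) fun a ha b hb hab =>
    (hprop a ha b hb hab p (hp a) (hp b)).1
  obtain ⟨g, hgY, hg⟩ := exists_unique_active (P := Q) (Y := Y) fun a ha b hb hab =>
    (hprop a ha b hb hab q (hq a) (hq b)).2
  have hpair : ∃ f g : K, ⁅f, g⁆ ∈ P ⊓ Q ∧ (∀ k, ∃ n m : ℤ, k * (f ^ n * g ^ m)⁻¹ ∈ P ⊓ Q) ∧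
      (f ∈ Q ∧ g ∈ P ∨ g = 1) := by
    by_cases hfg : f = g
    · subst hfg
      have h1 : ⁅f, (1 : K)⁆ ∈ P ⊓ Q := by simp
      refine ⟨f, 1, h1, exists_zpow_mul_zpow h1 hY fun y hy => ?_, Or.inr rfl⟩
      by_cases hyf : y = f
      · exact Or.inl hyf
      · exact Or.inr (Or.inr ⟨hf y hy hyf, hg y hy hyf⟩)
    · have hfQ : f ∈ Q := hfY.elim (fun h => hg f h hfg) fun h => h ▸ one_mem Q
      have hgP : g ∈ P := hgY.elim (fun h => hf g h (Ne.symm hfg)) fun h => h ▸ one_mem P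
      have h1 : ⁅f, g⁆ ∈ P ⊓ Q :=
        ⟨P.mul_mem (hPn.conj_mem _ hgP f) (P.inv_mem hgP), by
          have := Q.mul_mem hfQ (hQn.conj_mem _ (Q.inv_mem hfQ) g)
          rwa [← mul_assoc, ← mul_assoc] at this⟩
      refine ⟨f, g, h1, exists_zpow_mul_zpow h1 hY fun y hy => ?_, Or.inl ⟨hfQ, hgP⟩⟩
      by_cases hyf : y = f
      · exact Or.inl hyf
      by_cases hyg : y = g
      · exact Or.inr (Or.inl hyg)
      · exact Or.inr (Or.inr ⟨hf y hy hyf, hg y hy hyg⟩)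
  obtain ⟨f, g, hcomm, hgen, hfg⟩ := hpair
  have hDPQ : D ≤ P ⊓ Q := by
    refine hperf.trans ?_
    rw [Subgroup.commutator_le]
    exact fun a _ b _ => commutator_mem_of_forall_zpow hcomm hgen a b
  have hpq : p < q := hpx.1.trans hpx.2
  have hPE : ∀ E : Set K, E.Finite → E ⊆ P →
      ∃ δ ∈ Ioo p q, ∀ e ∈ E, ∀ s, p < s → s ≤ δ → ρ e s = s := by
    intro E hE hEP
    have h1 : ∀ᶠ s in 𝓝[>] p, ∀ e ∈ E, ρ e s = s :=
      (Set.Finite.eventually_all hE).2 fun e he => hEP he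
    obtain ⟨u, hu, h⟩ := mem_nhdsGT_iff_exists_Ioo_subset.1 h1
    obtain ⟨δ, hδ, hδ'⟩ := exists_between (lt_min hpq hu)
    rw [lt_min_iff] at hδ'
    exact ⟨δ, ⟨hδ, hδ'.1⟩, fun e he s h1 h2 => h ⟨h1, h2.trans_lt hδ'.2⟩ e he⟩
  have hQE : ∀ E : Set K, E.Finite → E ⊆ Q →
      ∃ δ ∈ Ioo p q, ∀ e ∈ E, ∀ s, δ ≤ s → s < q → ρ e s = s := by
    intro E hE hEP
    have h1 : ∀ᶠ s in 𝓝[<] q, ∀ e ∈ E, ρ e s = s :=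
      (Set.Finite.eventually_all hE).2 fun e he => hEP he
    obtain ⟨u, hu, h⟩ := mem_nhdsLT_iff_exists_Ioo_subset.1 h1
    obtain ⟨δ, hδ, hδ'⟩ := exists_between (max_lt hpq hu)
    rw [max_lt_iff] at hδ
    exact ⟨δ, ⟨hδ.1, hδ'⟩, fun e he s h1 h2 => h ⟨hδ.2.trans_le h1, h2⟩ e he⟩
  have hconj : ∀ t k s, ρ k (ρ t⁻¹ s) = ρ t⁻¹ s → ρ (t * k * t⁻¹) s = s := by
    intro t k s h
    rw [map_mul, map_mul, RelIso.mul_apply, RelIso.mul_apply, h, map_inv, RelIso.apply_inv_self]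
  have hback : ∀ t s, ρ t⁻¹ (ρ t s) = s := by
    intro t s
    rw [map_inv, RelIso.inv_apply_self]
  have hsub : ∀ {a b}, a ∈ Ioo p q → b ∈ Ioo p q → ∀ z ∈ Icc a b, ∃ h ∈ ρ.range, h z ≠ z :=
    fun ha hb z hz => hmov z ⟨ha.1.trans_le hz.1, hz.2.trans_lt hb.2⟩
  refine ⟨P, Q, hDPQ, ⟨f, g, hgen, hfg⟩, ?_, ?_, ?_⟩
  · intro E hE hEP
    obtain ⟨δ, hδ, hEδ⟩ := hPE E hE hEP
    obtain ⟨β, hβ, hβ'⟩ := hQE {h₀} (finite_singleton _)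
      (singleton_subset_iff.2 (hDPQ hh₀).2)
    obtain ⟨_, ⟨t, rfl⟩, ht⟩ := exists_apply_lt _ (hsub hδ hβ)
    refine ⟨t * h₀ * t⁻¹, by simpa [mul_inv_eq_one] using hne₀, fun e he =>
      commute_of_complementary hfaith hp hq hδ (fun s hs hs' => hconj _ _ _ ?_) (hEδ e he)⟩
    refine hβ' _ rfl _ ?_ ?_
    · have := (ρ t⁻¹).monotone (ht.le.trans hs)
      rwa [hback] at this
    · have := (ρ t⁻¹).strictMono hs'
      rwa [hq] at this
  · intro E hE hEQ
    obtain ⟨δ, hδ, hEδ⟩ := hQE E hE hEQ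
    obtain ⟨α, hα, hα'⟩ := hPE {h₀} (finite_singleton _)
      (singleton_subset_iff.2 (hDPQ hh₀).1)
    obtain ⟨_, ⟨t, rfl⟩, ht⟩ := exists_lt_apply _ (hsub hα hδ)
    refine ⟨t * h₀ * t⁻¹, by simpa [mul_inv_eq_one] using hne₀, fun e he =>
      (commute_of_complementary hfaith hp hq hδ (hEδ e he)
        (fun s hs hs' => hconj _ _ _ ?_)).symm⟩
    refine hα' _ rfl _ ?_ ?_
    · have := (ρ t⁻¹).strictMono hs
      rwa [hp] at this
    · have := (ρ t⁻¹).monotone (hs'.trans ht.le)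
      rwa [hback] at this
  · intro E hE hEPQ
    obtain ⟨α, hα, hEα⟩ := hPE E hE fun e he => (hEPQ he).1
    obtain ⟨β, hβ, hEβ⟩ := hQE E hE fun e he => (hEPQ he).2
    obtain ⟨_, ⟨t, rfl⟩, ht⟩ := exists_lt_apply _ (hsub hα hβ)
    refine ⟨t, fun e he e' he' => commute_of_complementary hfaith hp hq hβ (hEβ e he)
      (fun s hs hs' => hconj _ _ _ (hEα e' he' _ ?_ ?_))⟩
    · have := (ρ t⁻¹).strictMono hs
      rwa [hp] at this
    · have := (ρ t⁻¹).monotone (hs'.trans ht.le)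
      rwa [hback] at this

/-! ### Finite index subgroups of `F` with proper generating sets -/

lemma exists_apply_ne_of_ne_one {f : ℝ ≃o ℝ} (hf : f ∈ thompson) (h : f ≠ 1) :
    ∃ x ∈ Ioo (0 : ℝ) 1, f x ≠ x := by
  by_contra! hcon
  refine h (by
    ext x
    by_cases hx : x ∈ Ioo (0 : ℝ) 1
    · exact hcon x hx
    · simp only [mem_Ioo, not_and_or, not_lt] at hx
      exact hf.2 x hx)

lemma slopeZero_eq_zero_or_slopeOne_eq_zero {G : Subgroup (ℝ ≃o ℝ)} (hG : G ≤ thompson)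
    (hCG : thompsonC ≤ G) {S : Subgroup G} (hS : thompsonC.subgroupOf G ≤ S)
    (hE : ∀ E : Set G, E.Finite → E ⊆ S → ∃ c ≠ 1, ∀ e ∈ E, Commute c e)
    {k : G} (hk : k ∈ S) {s t : ℤ} (h0 : SlopeZero k s) (h1 : SlopeOne k t) :
    s = 0 ∨ t = 0 := by
  by_contra! hcon
  obtain ⟨u, hu, v, hv, huv⟩ := exists_centralizer_zero h0 hcon.1
  obtain ⟨u', hu', v', hv', huv'⟩ := exists_centralizer_one h1 hcon.2
  have hmem : ∀ w (hw : w ∈ thompsonC), (⟨w, hCG hw⟩ : G) ∈ S := fun w hw =>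
    hS (Subgroup.mem_subgroupOf.2 hw)
  obtain ⟨c, hc1, hc⟩ := hE {k, ⟨u, hCG hu⟩, ⟨v, hCG hv⟩, ⟨u', hCG hu'⟩, ⟨v', hCG hv'⟩}
    (Set.toFinite _) (by
      rintro _ (rfl | rfl | rfl | rfl | rfl)
      exacts [hk, hmem _ hu, hmem _ hv, hmem _ hu', hmem _ hv'])
  have hc' : ∀ e, _ → Commute (c : ℝ ≃o ℝ) (e : G) := fun e he => (hc e he).map G.subtype
  refine hc1 (Subtype.ext ?_)
  ext x
  rcases le_total x (1 / 2) with hx | hx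
  · exact huv c (hG c.2) (hc' k (by simp)) (hc' ⟨u, hCG hu⟩ (by simp))
      (hc' ⟨v, hCG hv⟩ (by simp)) x hx
  · exact huv' c (hG c.2) (hc' k (by simp)) (hc' ⟨u', hCG hu'⟩ (by simp))
      (hc' ⟨v', hCG hv'⟩ (by simp)) x hx

lemma slopes_eq_zero {G : Subgroup (ℝ ≃o ℝ)} (hG : G ≤ thompson)
    (hCG : thompsonC ≤ G) {S : Subgroup G} (hS : thompsonC.subgroupOf G ≤ S)
    (hE : ∀ E : Set G, E.Finite → E ⊆ S →
      ∃ t, ∀ e ∈ E, ∀ e' ∈ E, Commute e (t * e' * t⁻¹))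
    {k : G} (hk : k ∈ S) : (k : ℝ ≃o ℝ) ∈ thompsonC := by
  have hmem : ∀ w (hw : w ∈ thompsonC), (⟨w, hCG hw⟩ : G) ∈ S := fun w hw =>
    hS (Subgroup.mem_subgroupOf.2 hw)
  have main : ∀ u (hu : u ∈ thompsonC) v (hv : v ∈ thompsonC), ∃ t ∈ thompson,
      t * k * t⁻¹ ∈ thompson ∧ Commute (t * k * t⁻¹) (k : ℝ ≃o ℝ) ∧
      Commute (t * k * t⁻¹) u ∧ Commute (t * k * t⁻¹) v := by
    intro u hu v hv
    obtain ⟨t, ht⟩ := hE {k, ⟨u, hCG hu⟩, ⟨v, hCG hv⟩} (Set.toFinite _) (by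
      rintro _ (rfl | rfl | rfl)
      exacts [hk, hmem _ hu, hmem _ hv])
    have hc : ∀ e, _ → Commute (t * k * t⁻¹ : ℝ ≃o ℝ) (e : G) := fun e he =>
      ((ht e he k (by simp)).map G.subtype).symm
    exact ⟨t, hG t.2, hG (t * k * t⁻¹).2, hc k (by simp), hc ⟨u, hCG hu⟩ (by simp),
      hc ⟨v, hCG hv⟩ (by simp)⟩
  obtain ⟨s, hs⟩ := exists_slopeZero (hG k.2)
  obtain ⟨r, hr⟩ := exists_slopeOne (hG k.2)
  have hs0 : s = 0 := by
    by_contra hne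
    obtain ⟨u, hu, v, hv, h⟩ := exists_centralizer_zero hs hne
    obtain ⟨t, ht, htk, h1, h2, h3⟩ := main u hu v hv
    have := h _ htk h1 h2 h3
    refine hne (SlopeZero.unique (hs.of_conj ht) (slopeZero_of_eqOn (ε := 1 / 2) (by norm_num) ?_))
    intro s _ hs
    rw [this s hs]; simp
  have hr0 : r = 0 := by
    by_contra hne
    obtain ⟨u, hu, v, hv, h⟩ := exists_centralizer_one hr hne
    obtain ⟨t, ht, htk, h1, h2, h3⟩ := main u hu v hv
    have := h _ htk h1 h2 h3
    refine hne (SlopeOne.unique (hr.of_conj ht) (slopeZero_of_eqOn (ε := 1 / 2) (by norm_num) ?_))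
    intro s _ hs
    rw [flip_apply, this _ (by linarith)]; simp
  subst hs0 hr0
  exact mem_thompsonC_iff.2 ⟨hG k.2, hs, hr⟩

/-- The elements of `F` whose slopes at `0` and `1` are powers of `2 ^ a` and `2 ^ b`. -/
def slopeSubgroup (a b : ℕ) : Subgroup (ℝ ≃o ℝ) where
  carrier := {f | f ∈ thompson ∧ (∃ i : ℤ, SlopeZero f (i * a)) ∧ ∃ j : ℤ, SlopeOne f (j * b)}
  mul_mem' := by
    rintro f g ⟨hf, ⟨i, hi⟩, j, hj⟩ ⟨hg, ⟨i', hi'⟩, j', hj'⟩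
    refine ⟨mul_mem hf hg, ⟨i + i', ?_⟩, j + j', ?_⟩
    · rw [add_mul]; exact hi.mul hi'
    · rw [add_mul]; exact hj.mul hj'
  one_mem' := ⟨one_mem _, ⟨0, by simpa using slopeZero_one⟩, 0, by simpa using slopeOne_one⟩
  inv_mem' := by
    rintro f ⟨hf, ⟨i, hi⟩, j, hj⟩
    refine ⟨inv_mem hf, ⟨-i, ?_⟩, -j, ?_⟩
    · rw [neg_mul]; exact hi.inv
    · rw [neg_mul]; exact hj.inv

/-- A subgroup of `F` generated modulo its elements of trivial slopes by one element with slopes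
`(α, 0)` and one with slopes `(0, β)`. -/
lemma eq_slopeSubgroup {G : Subgroup (ℝ ≃o ℝ)} (hG : G ≤ thompson) (hCG : thompsonC ≤ G)
    {f g : ℝ ≃o ℝ} (hf : f ∈ G) (hg : g ∈ G) {α β : ℤ}
    (hf0 : SlopeZero f α) (hf1 : SlopeOne f 0) (hg0 : SlopeZero g 0) (hg1 : SlopeOne g β)
    (h : ∀ k ∈ G, ∃ n m : ℤ, SlopeZero k (n * α) ∧ SlopeOne k (m * β)) :
    G = slopeSubgroup α.natAbs β.natAbs := by
  have hsign : ∀ (γ n : ℤ), ∃ m : ℤ, n * γ = m * γ.natAbs ∧ m * γ = n * γ.natAbs := by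
    intro γ n
    rcases Int.natAbs_eq γ with h | h
    · exact ⟨n, by rw [← h], by rw [← h]⟩
    · have h' : (γ.natAbs : ℤ) = -γ := by omega
      exact ⟨-n, by rw [h']; ring, by rw [h']; ring⟩
  ext k
  constructor
  · intro hk
    obtain ⟨n, m, h0, h1⟩ := h k hk
    obtain ⟨i, hi, -⟩ := hsign α n
    obtain ⟨j, hj, -⟩ := hsign β m
    exact ⟨hG hk, ⟨i, hi ▸ h0⟩, j, hj ▸ h1⟩
  · rintro ⟨hk, ⟨n, h0⟩, m, h1⟩
    obtain ⟨i, -, hi⟩ := hsign α n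
    obtain ⟨j, -, hj⟩ := hsign β m
    rw [← hi] at h0
    rw [← hj] at h1
    have hw : f ^ i * g ^ j ∈ G := mul_mem (zpow_mem hf i) (zpow_mem hg j)
    have hC : k * (f ^ i * g ^ j)⁻¹ ∈ thompsonC := by
      refine mem_thompsonC_iff.2 ⟨mul_mem hk (inv_mem (hG hw)), ?_, ?_⟩
      · convert h0.mul ((hf0.zpow i).mul (hg0.zpow j)).inv using 1; ring
      · convert h1.mul ((hf1.zpow i).mul (hg1.zpow j)).inv using 1; ring
    have := mul_mem (hCG hC) hw
    rwa [inv_mul_cancel_right] at this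

theorem eq_slopeSubgroup_of_proper {G : Subgroup (ℝ ≃o ℝ)} (hG : G ≤ thompson)
    {T : Set (ℝ ≃o ℝ)} (hT : T.Finite)
    (hcov : ∀ g ∈ thompson, ∃ t ∈ T, t ∈ thompson ∧ ∃ h ∈ G, g = t * h)
    {ρ : G →* (ℝ ≃o ℝ)} (hρ : Function.Injective ρ)
    (hsupp : ∀ k x, x ≤ 0 ∨ 1 ≤ x → ρ k x = x)
    {Y : Set G} (hY : Subgroup.closure Y = ⊤) (hprop : ProperFamily ρ Y) :
    ∃ a b : ℕ, 0 < a ∧ 0 < b ∧ G = slopeSubgroup a b := by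
  obtain ⟨hCG, hpow⟩ := exists_pow_mem_of_cover hT hcov
  set D := thompsonC.subgroupOf G with hD_def
  have hDmap : D.map G.subtype = thompsonC := by
    rw [hD_def, Subgroup.subgroupOf_map_subtype, inf_eq_left.2 hCG]
  have hD : D ≠ ⊥ := by
    intro hbot
    have hx : xgen (1 / 4) (1 / 2) ∈ thompsonC :=
      xgen_mem_thompsonC ⟨1, 2, by norm_num⟩ ⟨1, 1, by norm_num⟩ (by norm_num) (by norm_num)
    rw [← hDmap, hbot, Subgroup.map_bot, Subgroup.mem_bot] at hx
    have := lt_xgen (a := 1 / 4) (b := 1 / 2) (t := 3 / 8) (by norm_num) (by norm_num)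
    rw [hx] at this
    exact lt_irrefl _ this
  have hperf : D ≤ ⁅D, D⁆ := by
    rw [← Subgroup.map_le_map_iff_of_injective G.subtype_injective, Subgroup.map_commutator,
      hDmap]
    exact thompsonC_le_commutator
  have hmin : ∀ N : Subgroup G, N.Normal → N ≠ ⊥ → D ≤ N := by
    intro N hN hne
    obtain ⟨n, hn, hn1⟩ := N.bot_or_exists_ne_one.resolve_left hne
    obtain ⟨x, hx, hx'⟩ := exists_apply_ne_of_ne_one (hG n.2) fun h => hn1 (Subtype.ext h)
    rw [← Subgroup.map_le_map_iff_of_injective G.subtype_injective, hDmap]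
    refine thompsonC_le_of_normalized ?_ (Subgroup.mem_map_of_mem G.subtype hn) hx hx'
    rintro t ht _ ⟨y, hy, rfl⟩
    exact ⟨_, hN.conj_mem y hy ⟨t, hCG ht⟩, rfl⟩
  obtain ⟨P, Q, hDPQ, ⟨f, g, hgen, hfg⟩, hP, hQ, hPQ⟩ :=
    exists_germ_subgroups hρ hsupp hY hprop hD hperf hmin
  obtain ⟨f0, hf0⟩ := exists_slopeZero (hG f.2)
  obtain ⟨f1, hf1⟩ := exists_slopeOne (hG f.2)
  obtain ⟨g0, hg0⟩ := exists_slopeZero (hG g.2)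
  obtain ⟨g1, hg1⟩ := exists_slopeOne (hG g.2)
  have hall : ∀ k ∈ G, ∃ n m : ℤ, SlopeZero k (n * f0 + m * g0) ∧
      SlopeOne k (n * f1 + m * g1) := by
    intro k hk
    obtain ⟨n, m, h⟩ := hgen ⟨k, hk⟩
    have hC := slopes_eq_zero hG hCG hDPQ hPQ h
    obtain ⟨-, h0, h1⟩ := mem_thompsonC_iff.1 hC
    refine ⟨n, m, ?_, ?_⟩
    · have := h0.mul ((hf0.zpow n).mul (hg0.zpow m))
      simpa [mul_assoc] using this
    · have := h1.mul ((hf1.zpow n).mul (hg1.zpow m))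
      simpa [mul_assoc] using this
  have hhalf : (1 / 2 : ℝ) ∈ dyadics := ⟨1, 1, by norm_num⟩
  obtain ⟨N, hN, hNG⟩ := hpow (xgen 0 (1 / 2))
    (xgen_mem_thompson dyadics.zero_mem hhalf le_rfl (by norm_num))
  obtain ⟨M, hM, hMG⟩ := hpow (xgen (1 / 2) 1)
    (xgen_mem_thompson hhalf dyadics.one_mem (by norm_num) le_rfl)
  obtain ⟨n, m, hN0, hN1⟩ := hall _ hNG
  obtain ⟨n', m', hM0, hM1⟩ := hall _ hMG
  replace hN0 := hN0.unique ((slopeZero_xgen (by norm_num)).pow N)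
  replace hN1 := hN1.unique ((slopeOne_xgen_of_lt (by norm_num)).pow N)
  replace hM0 := hM0.unique ((slopeZero_xgen_of_lt (by norm_num)).pow M)
  replace hM1 := hM1.unique ((slopeOne_xgen (by norm_num)).pow M)
  have hN' : (N : ℤ) ≠ 0 := by exact_mod_cast hN
  have hM' : (M : ℤ) ≠ 0 := by exact_mod_cast hM
  rcases hfg with ⟨hfQ, hgP⟩ | rfl
  · have hf01 := slopeZero_eq_zero_or_slopeOne_eq_zero hG hCG (hDPQ.trans inf_le_right) hQ
      hfQ hf0 hf1
    have hg01 := slopeZero_eq_zero_or_slopeOne_eq_zero hG hCG (hDPQ.trans inf_le_left) hP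
      hgP hg0 hg1
    by_cases hf00 : f0 = 0
    · have hg00 : g0 ≠ 0 := by
        rintro rfl
        simp [hf00] at hN0
        omega
      obtain rfl := hg01.resolve_left hg00
      subst hf00
      have hf10 : f1 ≠ 0 := by
        rintro rfl
        simp at hM1
        omega
      refine ⟨_, _, Int.natAbs_pos.2 hg00, Int.natAbs_pos.2 hf10,
        eq_slopeSubgroup hG hCG g.2 f.2 hg0 hg1 hf0 hf1 fun k hk => ?_⟩
      obtain ⟨n, m, h0, h1⟩ := hall k hk
      exact ⟨m, n, by simpa using h0, by simpa using h1⟩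
    · obtain rfl := hf01.resolve_left hf00
      have hg10 : g1 ≠ 0 := by
        rintro rfl
        simp at hM1
        omega
      obtain rfl := hg01.resolve_right hg10
      refine ⟨_, _, Int.natAbs_pos.2 hf00, Int.natAbs_pos.2 hg10,
        eq_slopeSubgroup hG hCG f.2 g.2 hf0 hf1 hg0 hg1 fun k hk => ?_⟩
      obtain ⟨n, m, h0, h1⟩ := hall k hk
      exact ⟨n, m, by simpa using h0, by simpa using h1⟩
  · obtain rfl := hg0.unique slopeZero_one
    obtain rfl := hg1.unique slopeOne_one
    simp only [mul_zero, add_zero, mul_one] at hN0 hN1 hM0 hM1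
    have hn : n ≠ 0 := by
      rintro rfl
      simp at hN0
      omega
    obtain rfl := (mul_eq_zero.1 hN1).resolve_left hn
    simp at hM1
    omega

/-! ### Rescaling the germs at the end points -/

lemma DPLAt.exists_slopeZero {f : ℝ ≃o ℝ} (hf : DPLAt f 0) (h0 : f 0 = 0) :
    ∃ k, SlopeZero f k := by
  obtain ⟨k, -, d, -, -, -, h, -⟩ := hf
  have h1 := h.self_of_nhdsWithin self_mem_Ici
  rw [h0] at h1
  obtain rfl : d = 0 := by linarith
  exact ⟨k, by simpa [SlopeZero] using h⟩

/-- `ψ` fixes `1` and every `x ≤ 0`, is dyadic piecewise linear away from `0`, and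
intertwines multiplication by `2 ^ p` with multiplication by `2 ^ q`. -/
structure Rescales (p q : ℕ) (ψ : ℝ ≃o ℝ) : Prop where
  of_nonpos : ∀ x ≤ 0, ψ x = x
  map_one : ψ 1 = 1
  dplAt : ∀ x ≠ 0, DPLAt ψ x
  map_mul : ∀ x, 0 < x → ψ (2 ^ (p : ℤ) * x) = 2 ^ (q : ℤ) * ψ x

section Rescales
variable {p q : ℕ} {ψ : ℝ ≃o ℝ}

lemma Rescales.map_zero (h : Rescales p q ψ) : ψ 0 = 0 := h.of_nonpos 0 le_rfl

lemma Rescales.pos (h : Rescales p q ψ) {x : ℝ} (hx : 0 < x) : 0 < ψ x := by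
  have := ψ.strictMono hx
  rwa [h.map_zero] at this

lemma Rescales.inv (h : Rescales p q ψ) : Rescales q p ψ⁻¹ where
  of_nonpos x hx := inv_apply_eq_iff.2 (h.of_nonpos x hx).symm
  map_one := inv_apply_eq_iff.2 h.map_one.symm
  dplAt x hx := by
    have h0 : ψ⁻¹ x ≠ 0 := fun h' => hx (by rw [inv_apply_eq_iff.1 h', h.map_zero])
    have := (h.dplAt _ h0).inv
    rwa [RelIso.apply_inv_self] at this
  map_mul x hx := by
    rw [inv_apply_eq_iff, h.map_mul, RelIso.apply_inv_self]
    by_contra! h'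
    have := ψ.monotone h'
    rw [RelIso.apply_inv_self, h.map_zero] at this
    linarith

lemma Rescales.map_zpow_mul (h : Rescales p q ψ) (i : ℤ) {x : ℝ} (hx : 0 < x) :
    ψ (2 ^ (i * p) * x) = 2 ^ (i * q) * ψ x := by
  induction i generalizing x with
  | zero => simp
  | succ i ih =>
    rw [add_mul, one_mul, zpow_add₀ two_ne_zero, mul_assoc, ih (by positivity), h.map_mul x hx,
      add_mul, one_mul, zpow_add₀ two_ne_zero, mul_assoc]
  | pred i ih =>
    have e : ∀ r : ℕ, ((-i - 1 : ℤ) * r) = -i * r + -r := fun r => by ring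
    have h1 := h.map_mul (2 ^ (-p : ℤ) * x) (by positivity)
    rw [← mul_assoc, ← zpow_add₀ two_ne_zero, add_neg_cancel, zpow_zero, one_mul] at h1
    rw [e, e, zpow_add₀ two_ne_zero, mul_assoc, ih (by positivity), zpow_add₀ two_ne_zero,
      mul_assoc, h1, ← mul_assoc (2 ^ (-q : ℤ)), ← zpow_add₀ two_ne_zero]
    simp

lemma Rescales.conj_mem (h : Rescales p q ψ) {b : ℕ} {f : ℝ ≃o ℝ}
    (hf : f ∈ slopeSubgroup p b) : ψ * f * ψ⁻¹ ∈ slopeSubgroup q b := by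
  obtain ⟨hf, ⟨i, hi⟩, j, hj⟩ := hf
  have h0 : SlopeZero (ψ * f * ψ⁻¹) (i * q) := by
    have ht := tendsto_nhdsGE ψ⁻¹ 0
    rw [h.inv.map_zero] at ht
    filter_upwards [ht.eventually hi, self_mem_nhdsWithin] with s hs hs0
    rcases (mem_Ici.1 hs0).eq_or_lt with rfl | hs0
    · simp [h.map_zero, h.inv.map_zero, hi.map_zero]
    · rw [RelIso.mul_apply, RelIso.mul_apply, hs, h.map_zpow_mul i (h.inv.pos hs0),
        RelIso.apply_inv_self]
  have hneg : ∀ s ≤ 0, (ψ * f * ψ⁻¹) s = s := fun s hs => by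
    rw [RelIso.mul_apply, RelIso.mul_apply, h.inv.of_nonpos s hs, hf.2 s (Or.inl hs),
      h.of_nonpos s hs]
  refine ⟨⟨fun x => ?_, fun x hx => ?_⟩, ⟨i, h0⟩, j, ?_⟩
  · rcases eq_or_ne x 0 with rfl | hx
    · obtain ⟨ε, hε, hs⟩ := h0.exists_eq
      exact dplAt_of_break (k := 0) (l := i * q) (u := -1) (v := ε) dyadics.zero_mem
        dyadics.zero_mem dyadics.zero_mem (by norm_num) hε
        (fun s _ h' => by rw [hneg s h']; simp) fun s h1 h2 => by rw [hs s h1 h2, add_zero]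
    · have h1 : ψ⁻¹ x ≠ 0 := fun h' => hx (by rw [inv_apply_eq_iff.1 h', h.map_zero])
      have h2 : f (ψ⁻¹ x) ≠ 0 := fun h' => h1 (f.injective (h'.trans hi.map_zero.symm))
      have h3 := (hf.1 (ψ⁻¹ x)).comp (h.inv.dplAt x hx)
      exact DPLAt.comp (f := f * ψ⁻¹) (g := ψ) (h.dplAt _ h2) h3
  · rcases hx with hx | hx
    · exact hneg x hx
    · have : 1 ≤ ψ⁻¹ x := by rw [← h.inv.map_one]; exact ψ⁻¹.monotone hx
      rw [RelIso.mul_apply, RelIso.mul_apply, hf.2 _ (Or.inr this), RelIso.apply_inv_self]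
  · have hd : DPLAt (flip ψ) 0 := by
      have := h.dplAt (1 - 0) (by norm_num)
      exact this.flip
    obtain ⟨l, hl⟩ := hd.exists_slopeZero (by simp [flip_apply, h.map_one])
    rw [SlopeOne, _root_.map_mul, _root_.map_mul, map_inv]
    convert (hl.mul hj).mul hl.inv using 1
    ring

lemma Rescales.mem_of_conj_mem (h : Rescales p q ψ) {b : ℕ} {f : ℝ ≃o ℝ}
    (hf : ψ * f * ψ⁻¹ ∈ slopeSubgroup q b) : f ∈ slopeSubgroup p b := by
  have := h.inv.conj_mem hf
  rwa [inv_inv, mul_assoc, mul_assoc, mul_assoc, inv_mul_cancel, mul_one, inv_mul_cancel_left]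
    at this

lemma flip_mem_slopeSubgroup {f : ℝ ≃o ℝ} (hf : f ∈ slopeSubgroup p q) :
    flip f ∈ slopeSubgroup q p := by
  obtain ⟨hf, hi, hj⟩ := hf
  exact ⟨flip_mem_thompson hf, hj, by simpa [SlopeOne] using hi⟩

lemma flip_mem_slopeSubgroup_iff {f : ℝ ≃o ℝ} :
    flip f ∈ slopeSubgroup q p ↔ f ∈ slopeSubgroup p q :=
  ⟨fun h => by simpa using flip_mem_slopeSubgroup h, flip_mem_slopeSubgroup⟩

end Rescales

lemma slopeSubgroup_one : slopeSubgroup 1 1 = thompson := by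
  refine le_antisymm (fun _ h => h.1) fun f hf => ⟨hf, ?_, ?_⟩
  · obtain ⟨k, hk⟩ := exists_slopeZero hf
    exact ⟨k, by simpa using hk⟩
  · obtain ⟨k, hk⟩ := exists_slopeOne hf
    exact ⟨k, by simpa using hk⟩

section interpolate

/-- The piecewise affine map taking `2 ^ n` to `Y n`, and the identity on `(-∞, 0]`. -/
noncomputable def interpolate (Y : ℤ → ℝ) (x : ℝ) : ℝ :=
  if x ≤ 0 then x else
    Y (Int.log 2 x) + (Y (Int.log 2 x + 1) - Y (Int.log 2 x)) * (x / 2 ^ Int.log 2 x - 1)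

variable {Y : ℤ → ℝ}

lemma int_log_eq {n : ℤ} {x : ℝ} (h : 2 ^ n ≤ x) (h' : x < 2 ^ (n + 1)) : Int.log 2 x = n := by
  have h0 : 0 < x := lt_of_lt_of_le (by positivity) h
  refine le_antisymm ?_ ?_
  · have := (Int.lt_zpow_iff_log_lt (b := 2) one_lt_two h0 (x := n + 1)).1 (by exact_mod_cast h')
    omega
  · exact (Int.zpow_le_iff_le_log (b := 2) one_lt_two h0).1 (by exact_mod_cast h)

lemma exists_zpow_le_lt {x : ℝ} (hx : 0 < x) : ∃ n : ℤ, 2 ^ n ≤ x ∧ x < 2 ^ (n + 1) := by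
  exact ⟨Int.log 2 x, by exact_mod_cast Int.zpow_log_le_self one_lt_two hx,
    by exact_mod_cast Int.lt_zpow_succ_log_self one_lt_two x⟩

lemma interpolate_eq (Y : ℤ → ℝ) {n : ℤ} {x : ℝ} (h : 2 ^ n ≤ x) (h' : x ≤ 2 ^ (n + 1)) :
    interpolate Y x = Y n + (Y (n + 1) - Y n) * (x / 2 ^ n - 1) := by
  have h0 : 0 < x := lt_of_lt_of_le (by positivity) h
  rw [interpolate, if_neg h0.not_ge]
  rcases h'.eq_or_lt with rfl | h'
  · rw [int_log_eq (n := n + 1) le_rfl (zpow_lt_zpow_right₀ one_lt_two (by omega)),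
      zpow_add_one₀ two_ne_zero (n)]
    have : (2 : ℝ) ^ n ≠ 0 := by positivity
    field_simp
    ring
  · rw [int_log_eq h h']

lemma interpolate_bounds (hY : StrictMono Y) {n : ℤ} {x : ℝ} (h : 2 ^ n ≤ x)
    (h' : x < 2 ^ (n + 1)) : Y n ≤ interpolate Y x ∧ interpolate Y x < Y (n + 1) := by
  rw [interpolate_eq Y h h'.le]
  have h1 : 0 < Y (n + 1) - Y n := sub_pos.2 (hY (by omega))
  have hp : (0 : ℝ) < 2 ^ n := by positivity
  have h2 : 1 ≤ x / 2 ^ n := by rwa [le_div_iff₀ hp, one_mul]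
  have h3 : x / 2 ^ n < 2 := by rwa [div_lt_iff₀ hp, mul_comm, ← zpow_add_one₀ two_ne_zero]
  constructor <;> nlinarith

lemma strictMono_interpolate (hY : StrictMono Y) (hpos : ∀ n, 0 < Y n) :
    StrictMono (interpolate Y) := by
  intro x y hxy
  rcases le_or_gt y 0 with hy | hy
  · rwa [interpolate, if_pos (hxy.le.trans hy), interpolate, if_pos hy]
  obtain ⟨m, hm, hm'⟩ := exists_zpow_le_lt hy
  have hb := interpolate_bounds hY hm hm'
  rcases le_or_gt x 0 with hx | hx
  · rw [interpolate, if_pos hx]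
    linarith [hpos m]
  obtain ⟨n, hn, hn'⟩ := exists_zpow_le_lt hx
  have hb' := interpolate_bounds hY hn hn'
  have hnm : n < m + 1 :=
    (zpow_lt_zpow_iff_right₀ (one_lt_two (α := ℝ))).1 (hn.trans_lt (hxy.trans hm'))
  rcases (Int.lt_add_one_iff.1 hnm).eq_or_lt with rfl | hnm
  · rw [interpolate_eq Y hn hn'.le, interpolate_eq Y hm hm'.le]
    have h1 : 0 < Y (n + 1) - Y n := sub_pos.2 (hY (by omega))
    gcongr
  · have := hY.monotone (Int.add_one_le_iff.2 hnm)
    linarith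

lemma surjective_interpolate (hY : StrictMono Y) (hlo : ∀ y, 0 < y → ∃ n, Y n ≤ y)
    (hhi : ∀ y, ∃ n, y < Y n) : Function.Surjective (interpolate Y) := by
  intro y
  rcases le_or_gt y 0 with hy | hy
  · exact ⟨y, if_pos hy⟩
  obtain ⟨u, hu⟩ := hhi y
  obtain ⟨n, hn, hmax⟩ := Int.exists_greatest_of_bdd (P := fun n => Y n ≤ y)
    ⟨u, fun z hz => (hY.lt_iff_lt.1 (hz.trans_lt hu)).le⟩ (hlo y hy)
  have hn' : y < Y (n + 1) := by
    by_contra! h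
    have := hmax _ h
    omega
  have h1 : 0 < Y (n + 1) - Y n := by linarith
  have hp : (0 : ℝ) < 2 ^ n := by positivity
  have h2 : 0 ≤ (y - Y n) / (Y (n + 1) - Y n) := div_nonneg (by linarith) h1.le
  have h3 : (y - Y n) / (Y (n + 1) - Y n) ≤ 1 := (div_le_one h1).2 (by linarith)
  refine ⟨2 ^ n * (1 + (y - Y n) / (Y (n + 1) - Y n)), ?_⟩
  rw [interpolate_eq Y (n := n) (by nlinarith)
    (by rw [zpow_add_one₀ two_ne_zero]; nlinarith)]
  field_simp
  ring

lemma interpolate_two_zpow (Y : ℤ → ℝ) (n : ℤ) : interpolate Y (2 ^ n) = Y n := by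
  rw [interpolate_eq Y le_rfl (zpow_le_zpow_right₀ one_le_two (by omega)),
    div_self (by positivity)]
  ring

lemma interpolate_zpow_mul {a : ℕ} (h : ∀ n, Y (n + a) = 2 * Y n) {x : ℝ} (hx : 0 < x) :
    interpolate Y (2 ^ (a : ℤ) * x) = 2 * interpolate Y x := by
  obtain ⟨n, hn, hn'⟩ := exists_zpow_le_lt hx
  have hp : (0 : ℝ) < 2 ^ (a : ℤ) := by positivity
  have e : ∀ m : ℤ, (2 : ℝ) ^ (m + a) = 2 ^ (a : ℤ) * 2 ^ m := fun m => by
    rw [zpow_add₀ two_ne_zero, mul_comm]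
  rw [interpolate_eq Y hn hn'.le, interpolate_eq Y (n := n + a), h, add_right_comm, h, e,
    mul_div_mul_left _ _ hp.ne']
  · ring
  · rw [e]; gcongr
  · rw [add_right_comm, e]; gcongr

lemma dplAt_interpolate (hd : ∀ n, Y n ∈ dyadics) (hdiff : ∀ n, ∃ k : ℤ, Y (n + 1) - Y n = 2 ^ k)
    {x : ℝ} (hx : x ≠ 0) : DPLAt (interpolate Y) x := by
  rcases hx.lt_or_gt with hx | hx
  · exact dplAt_of_affine (k := 0) (d := 0) (u := x - 1) (v := 0) dyadics.zero_mem (by linarith) hx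
      fun s _ h => by rw [interpolate, if_pos h]; simp
  have key : ∀ n : ℤ, ∃ (k : ℤ) (d : ℝ), d ∈ dyadics ∧ ∀ s : ℝ, 2 ^ n ≤ s → s ≤ 2 ^ (n + 1) →
      interpolate Y s = 2 ^ k * s + d := by
    intro n
    obtain ⟨k, hk⟩ := hdiff n
    refine ⟨k - n, Y n - 2 ^ k, dyadics.sub_mem (hd n) (zpow_two_mem_dyadics k), fun s h h' => ?_⟩
    rw [interpolate_eq Y h h', hk, zpow_sub₀ two_ne_zero]
    ring
  obtain ⟨n, hn, hn'⟩ := exists_zpow_le_lt hx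
  obtain ⟨k, d, hd, h⟩ := key n
  rcases hn.eq_or_lt with rfl | hn
  · obtain ⟨l, e, he, h'⟩ := key (n - 1)
    rw [sub_add_cancel] at h'
    exact dplAt_of_break (zpow_two_mem_dyadics n) he hd
      (zpow_lt_zpow_right₀ one_lt_two (by omega)) hn' h' h
  · exact dplAt_of_affine hd hn hn' h

end interpolate

/-- A sequence doubling every `a` steps whose successive differences are powers of `2`. -/
noncomputable def doublingSeq (a : ℕ) (n : ℤ) : ℝ := 2 ^ (n / (a : ℤ)) * (2 - 2 ^ (-(n % (a : ℤ))))

section doublingSeq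
variable {a : ℕ}

lemma doublingSeq_add (ha : 0 < a) (n : ℤ) : doublingSeq a (n + a) = 2 * doublingSeq a n := by
  have : (a : ℤ) ≠ 0 := by omega
  rw [doublingSeq, doublingSeq, Int.add_emod_right, Int.add_ediv_of_dvd_right dvd_rfl,
    Int.ediv_self this, zpow_add_one₀ two_ne_zero]
  ring

lemma doublingSeq_mem_dyadics (n : ℤ) : doublingSeq a n ∈ dyadics :=
  dyadics.mul_mem (zpow_two_mem_dyadics _)
    (dyadics.sub_mem ⟨2, 0, by simp⟩ (zpow_two_mem_dyadics _))

lemma doublingSeq_diff (ha : 0 < a) (n : ℤ) :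
    ∃ k : ℤ, doublingSeq a (n + 1) - doublingSeq a n = 2 ^ k := by
  have ha' : (0 : ℤ) < a := by omega
  have h0 := Int.emod_nonneg n ha'.ne'
  have h1 := Int.emod_lt_of_pos n ha'
  have h2 := Int.mul_ediv_add_emod n a
  rcases (Int.add_one_le_iff.2 h1).eq_or_lt with h | h
  · have e1 : n + 1 = a * (n / a + 1) := by rw [mul_add, mul_one]; linarith
    have e2 : (n + 1) / a = n / a + 1 := by rw [e1, Int.mul_ediv_cancel_left _ ha'.ne']
    have e3 : (n + 1) % a = 0 := by rw [e1, Int.mul_emod_right]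
    refine ⟨n / a - n % a, ?_⟩
    rw [doublingSeq, doublingSeq, e2, e3, zpow_add_one₀ two_ne_zero, sub_eq_add_neg (n / (a : ℤ)),
      zpow_add₀ two_ne_zero]
    norm_num
    ring
  · have e1 : n + 1 = (n % a + 1) + a * (n / a) := by linarith
    have e2 : (n + 1) / a = n / a := by
      rw [e1, Int.add_mul_ediv_left _ _ ha'.ne', Int.ediv_eq_zero_of_lt (by omega) h, zero_add]
    have e3 : (n + 1) % a = n % a + 1 := by
      rw [e1, Int.add_mul_emod_self_left, Int.emod_eq_of_lt (by omega) h]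
    refine ⟨n / a - (n % a + 1), ?_⟩
    rw [doublingSeq, doublingSeq, e2, e3, sub_eq_add_neg (n / (a : ℤ)), zpow_add₀ two_ne_zero,
      neg_add, zpow_add₀ two_ne_zero, zpow_neg_one]
    ring

lemma doublingSeq_mul (ha : 0 < a) (q : ℤ) : doublingSeq a (a * q) = 2 ^ q := by
  rw [doublingSeq, Int.mul_ediv_cancel_left _ (by omega), Int.mul_emod_right]
  norm_num

end doublingSeq

lemma exists_rescales {a : ℕ} (ha : 0 < a) : ∃ ψ, Rescales a 1 ψ := by
  have hY : StrictMono (doublingSeq a) := strictMono_int_of_lt_succ fun n => by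
    obtain ⟨k, hk⟩ := doublingSeq_diff ha n
    have : (0 : ℝ) < 2 ^ k := by positivity
    linarith
  have hlo : ∀ y, 0 < y → ∃ n, doublingSeq a n ≤ y := fun y hy => by
    obtain ⟨q, hq, -⟩ := exists_zpow_le_lt hy
    exact ⟨a * q, by rwa [doublingSeq_mul ha]⟩
  have hhi : ∀ y, ∃ n, y < doublingSeq a n := fun y => by
    obtain ⟨q, -, hq⟩ := exists_zpow_le_lt (lt_max_of_lt_right one_pos : 0 < max y 1)
    exact ⟨a * (q + 1), by rw [doublingSeq_mul ha]; exact (le_max_left _ _).trans_lt hq⟩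
  have hpos : ∀ n, 0 < doublingSeq a n := fun n => by
    have h := Int.emod_nonneg n (by omega : (a : ℤ) ≠ 0)
    have h' : (2 : ℝ) ^ (-(n % (a : ℤ))) ≤ 1 := zpow_le_one_of_nonpos₀ one_le_two (by omega)
    exact mul_pos (by positivity) (by linarith)
  refine ⟨(strictMono_interpolate hY hpos).orderIsoOfSurjective _
    (surjective_interpolate hY hlo hhi), ⟨fun x hx => if_pos hx, ?_, fun x hx => ?_, fun x hx => ?_⟩⟩
  · have h := interpolate_two_zpow (doublingSeq a) 0
    have h' := doublingSeq_mul ha 0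
    rw [zpow_zero] at h h'
    rw [mul_zero] at h'
    exact h.trans h'
  · exact dplAt_interpolate doublingSeq_mem_dyadics (doublingSeq_diff ha) hx
  · rw [Nat.cast_one, zpow_one]
    exact interpolate_zpow_mul (doublingSeq_add ha) hx

theorem exists_conj_slopeSubgroup {a b : ℕ} (ha : 0 < a) (hb : 0 < b) :
    ∃ Ψ : ℝ ≃o ℝ, ∀ f, Ψ * f * Ψ⁻¹ ∈ thompson ↔ f ∈ slopeSubgroup a b := by
  obtain ⟨ψ, hψ⟩ := exists_rescales ha
  obtain ⟨χ, hχ⟩ := exists_rescales hb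
  have key : ∀ {p c : ℕ} {ψ : ℝ ≃o ℝ}, Rescales p 1 ψ → ∀ f,
      ψ * f * ψ⁻¹ ∈ slopeSubgroup 1 c ↔ f ∈ slopeSubgroup p c :=
    fun h f => ⟨h.mem_of_conj_mem, h.conj_mem⟩
  refine ⟨flip χ * ψ, fun f => ?_⟩
  rw [← key hψ, ← flip_mem_slopeSubgroup_iff, ← key hχ, ← flip_mem_slopeSubgroup_iff,
    slopeSubgroup_one]
  simp only [_root_.map_mul, flip_flip, map_inv, mul_inv_rev, mul_assoc]

/-! ### Extending homeomorphisms of the interval to the line -/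

/-- The group of orientation-preserving homeomorphisms of the unit interval. -/
def orientationPreserving : Subgroup Homeo01 where
  carrier := {f | IsOPH f}
  mul_mem' := by
    intro f g hf hg
    exact Monotone.comp (g := f) hf hg
  one_mem' := monotone_id
  inv_mem' := by
    intro f hf x y hxy
    by_contra! h
    have h' : f (f⁻¹ y) ≤ f (f⁻¹ x) := hf h.le
    rw [Equiv.Perm.coe_inv, Equiv.apply_symm_apply, Equiv.apply_symm_apply] at h'
    obtain rfl := le_antisymm hxy h'
    exact lt_irrefl _ h

lemma IsOPH.map_zero {f : Homeo01} (hf : IsOPH f) : f 0 = 0 := by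
  refine le_antisymm ?_ (f 0).2.1
  have h := hf (show (0 : UI) ≤ f.symm 0 from (f.symm 0).2.1)
  rwa [Equiv.apply_symm_apply] at h

lemma IsOPH.map_one {f : Homeo01} (hf : IsOPH f) : f 1 = 1 := by
  refine le_antisymm (f 1).2.2 ?_
  have h := hf (show f.symm 1 ≤ (1 : UI) from (f.symm 1).2.2)
  rwa [Equiv.apply_symm_apply] at h

open Classical in
lemma strictMono_ofSubtype {f : Homeo01} (hf : IsOPH f) :
    StrictMono (Equiv.Perm.ofSubtype f : ℝ → ℝ) := by
  refine Monotone.strictMono_of_injective (fun x y hxy => ?_) (Equiv.injective _)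
  by_cases hx : x ∈ unitInterval <;> by_cases hy : y ∈ unitInterval
  · rw [Equiv.Perm.ofSubtype_apply_of_mem f hx, Equiv.Perm.ofSubtype_apply_of_mem f hy]
    exact hf hxy
  · rw [Equiv.Perm.ofSubtype_apply_of_mem f hx, Equiv.Perm.ofSubtype_apply_of_not_mem f hy]
    refine (f ⟨x, hx⟩).2.2.trans ?_
    by_contra! h
    exact hy ⟨hx.1.trans hxy, h.le⟩
  · rw [Equiv.Perm.ofSubtype_apply_of_not_mem f hx, Equiv.Perm.ofSubtype_apply_of_mem f hy]
    refine le_trans ?_ (f ⟨y, hy⟩).2.1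
    by_contra! h
    exact hx ⟨h.le, hxy.trans hy.2⟩
  · rwa [Equiv.Perm.ofSubtype_apply_of_not_mem f hx, Equiv.Perm.ofSubtype_apply_of_not_mem f hy]

open Classical in
/-- Extension by the identity of a homeomorphism of the unit interval to the line. -/
noncomputable def extend : orientationPreserving →* (ℝ ≃o ℝ) where
  toFun f := ⟨Equiv.Perm.ofSubtype f.1, (strictMono_ofSubtype f.2).le_iff_le⟩
  map_one' := by
    ext x
    exact congrArg (fun g : Equiv.Perm ℝ => g x) (map_one Equiv.Perm.ofSubtype)
  map_mul' f g := by
    ext x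
    exact congrArg (fun g : Equiv.Perm ℝ => g x) (map_mul Equiv.Perm.ofSubtype f.1 g.1)

lemma extend_apply_coe (f : orientationPreserving) (x : UI) : extend f x = f.1 x := by
  classical exact Equiv.Perm.ofSubtype_apply_coe f.1 x

lemma extend_apply_of_mem (f : orientationPreserving) {x : ℝ} (hx : x ∈ unitInterval) :
    extend f x = f.1 ⟨x, hx⟩ := extend_apply_coe f ⟨x, hx⟩

lemma extend_apply_of_le_or_ge (f : orientationPreserving) {x : ℝ} (hx : x ≤ 0 ∨ 1 ≤ x) :
    extend f x = x := by
  classical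
  by_cases h : x ∈ unitInterval
  · rcases hx with hx | hx
    · obtain rfl := le_antisymm hx h.1
      exact (extend_apply_coe f 0).trans (congrArg Subtype.val (IsOPH.map_zero f.2))
    · obtain rfl := le_antisymm h.2 hx
      exact (extend_apply_coe f 1).trans (congrArg Subtype.val (IsOPH.map_one f.2))
  · exact Equiv.Perm.ofSubtype_apply_of_not_mem f.1 h

lemma extend_injective : Function.Injective extend := by
  intro f g h
  ext x
  rw [← extend_apply_coe, ← extend_apply_coe, h]

lemma exists_extend_eq {k : ℝ ≃o ℝ} (hk : ∀ x, x ≤ 0 ∨ 1 ≤ x → k x = x) :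
    ∃ f, extend f = k := by
  have h0 := hk 0 (Or.inl le_rfl)
  have h1 := hk 1 (Or.inr le_rfl)
  have hmem : ∀ x, k x ∈ unitInterval ↔ x ∈ unitInterval := fun x => by
    rw [unitInterval, mem_Icc, mem_Icc, ← k.le_iff_le (x := 0) (y := x), h0,
      ← k.le_iff_le (x := x) (y := 1), h1]
  refine ⟨⟨Equiv.Perm.subtypePerm k.toEquiv hmem, fun x y hxy => k.monotone hxy⟩, ?_⟩
  ext x
  by_cases hx : x ∈ unitInterval
  · exact extend_apply_of_mem _ hx
  · have hx' : x ≤ 0 ∨ 1 ≤ x := by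
      simp only [unitInterval, mem_Icc, not_and_or, not_le] at hx
      exact hx.imp le_of_lt le_of_lt
    rw [extend_apply_of_le_or_ge _ hx', hk x hx']

lemma exists_castSucc_and_not_succ {n : ℕ} {p : Fin (n + 1) → Prop} (h0 : p 0)
    (h1 : ¬ p (Fin.last n)) : ∃ i : Fin n, p i.castSucc ∧ ¬ p i.succ := by
  by_contra! h
  exact h1 (Fin.induction h0 h (Fin.last n))

lemma extend_mem_thompson {f : orientationPreserving} (hf : InThompsonF f) :
    extend f ∈ thompson := by
  obtain ⟨-, n, t, ht, ht0, ht1, hdy, hpiece⟩ := hf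
  refine ⟨?_, fun x hx => extend_apply_of_le_or_ge f hx⟩
  set F := extend f with hF
  have hI : ∀ i, t i ∈ unitInterval := fun i =>
    ⟨by rw [← ht0]; exact ht.monotone (Fin.zero_le i),
      by rw [← ht1]; exact ht.monotone (Fin.le_last i)⟩
  have hpiece' : ∀ i : Fin n, ∃ (k : ℤ) (d : ℝ), ∀ s, t i.castSucc ≤ s → s ≤ t i.succ →
      F s = 2 ^ k * s + d := by
    intro i
    obtain ⟨k, d, h⟩ := hpiece i
    refine ⟨k, d, fun s hs hs' => ?_⟩
    have hs01 : s ∈ unitInterval := ⟨(hI _).1.trans hs, hs'.trans (hI _).2⟩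
    rw [hF, extend_apply_of_mem f hs01]
    exact h ⟨s, hs01⟩ hs hs'
  have hFt : ∀ i, F (t i) ∈ dyadics := by
    intro i
    induction i using Fin.induction with
    | zero =>
      rw [ht0, hF, extend_apply_of_le_or_ge f (Or.inl le_rfl)]
      exact dyadics.zero_mem
    | succ i ih =>
      obtain ⟨k, d, h⟩ := hpiece' i
      have hlt : t i.castSucc ≤ t i.succ := (ht i.castSucc_lt_succ).le
      have hd : d = F (t i.castSucc) - 2 ^ k * t i.castSucc := by
        rw [h _ le_rfl hlt]; ring
      rw [h _ hlt le_rfl, hd]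
      exact dyadics.add_mem (dyadics.mul_mem (zpow_two_mem_dyadics k) (hdy _))
        (dyadics.sub_mem ih (dyadics.mul_mem (zpow_two_mem_dyadics k) (hdy _)))
  have hpiece'' : ∀ i : Fin n, ∃ (k : ℤ) (d : ℝ), d ∈ dyadics ∧
      ∀ s, t i.castSucc ≤ s → s ≤ t i.succ → F s = 2 ^ k * s + d := by
    intro i
    obtain ⟨k, d, h⟩ := hpiece' i
    have hd : d = F (t i.castSucc) - 2 ^ k * t i.castSucc := by
      rw [h _ le_rfl (ht i.castSucc_lt_succ).le]; ring
    refine ⟨k, d, ?_, h⟩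
    rw [hd]
    exact dyadics.sub_mem (hFt _) (dyadics.mul_mem (zpow_two_mem_dyadics k) (hdy _))
  have hright : ∀ x, ∃ (k : ℤ) (d v : ℝ), d ∈ dyadics ∧ x < v ∧
      ∀ s, x ≤ s → s ≤ v → F s = 2 ^ k * s + d := by
    intro x
    rcases lt_or_ge x 0 with hx | hx
    · exact ⟨0, 0, 0, dyadics.zero_mem, hx, fun s _ hs => by
        rw [hF, extend_apply_of_le_or_ge f (Or.inl hs)]; simp⟩
    rcases lt_or_ge x 1 with hx' | hx'
    · obtain ⟨i, hi, hi'⟩ := exists_castSucc_and_not_succ (p := fun i => t i ≤ x)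
        (by rwa [ht0]) (by rw [ht1]; exact hx'.not_ge)
      obtain ⟨k, d, hd, h⟩ := hpiece'' i
      exact ⟨k, d, _, hd, not_le.1 hi', fun s hs hs' => h s (hi.trans hs) hs'⟩
    · exact ⟨0, 0, x + 1, dyadics.zero_mem, by linarith, fun s hs _ => by
        rw [hF, extend_apply_of_le_or_ge f (Or.inr (hx'.trans hs))]; simp⟩
  have hleft : ∀ x, ∃ (k : ℤ) (d u : ℝ), d ∈ dyadics ∧ u < x ∧
      ∀ s, u ≤ s → s ≤ x → F s = 2 ^ k * s + d := by
    intro x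
    rcases le_or_gt x 0 with hx | hx
    · exact ⟨0, 0, x - 1, dyadics.zero_mem, by linarith, fun s _ hs => by
        rw [hF, extend_apply_of_le_or_ge f (Or.inl (hs.trans hx))]; simp⟩
    rcases le_or_gt x 1 with hx' | hx'
    · obtain ⟨i, hi, hi'⟩ := exists_castSucc_and_not_succ (p := fun i => t i < x)
        (by rwa [ht0]) (by rw [ht1]; exact hx'.not_gt)
      obtain ⟨k, d, hd, h⟩ := hpiece'' i
      exact ⟨k, d, _, hd, hi, fun s hs hs' => h s hs (hs'.trans (not_lt.1 hi'))⟩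
    · exact ⟨0, 0, 1, dyadics.zero_mem, hx', fun s hs _ => by
        rw [hF, extend_apply_of_le_or_ge f (Or.inr hs)]; simp⟩
  intro x
  by_cases hx : x ∈ dyadics
  · obtain ⟨k, d, v, hd, hv, h⟩ := hright x
    obtain ⟨l, e, u, he, hu, h'⟩ := hleft x
    exact dplAt_of_break hx he hd hu hv h' h
  rcases lt_or_ge x 0 with hx0 | hx0
  · exact dplAt_of_affine (k := 0) (d := 0) (u := x - 1) dyadics.zero_mem (by linarith) hx0
      fun s _ hs => by rw [hF, extend_apply_of_le_or_ge f (Or.inl hs)]; simp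
  rcases lt_or_ge 1 x with hx1 | hx1
  · exact dplAt_of_affine (k := 0) (d := 0) (v := x + 1) dyadics.zero_mem hx1 (by linarith)
      fun s hs _ => by rw [hF, extend_apply_of_le_or_ge f (Or.inr hs)]; simp
  have hne : ∀ i, t i ≠ x := fun i h => hx (h ▸ hdy i)
  obtain ⟨i, hi, hi'⟩ := exists_castSucc_and_not_succ (p := fun i => t i < x)
    (lt_of_le_of_ne (by rwa [ht0]) (hne 0)) (by rw [ht1]; exact hx1.not_gt)
  obtain ⟨k, d, hd, h⟩ := hpiece'' i
  exact dplAt_of_affine hd hi (lt_of_le_of_ne (not_lt.1 hi') (hne _).symm) h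

lemma inThompsonF_of_extend_mem {f : orientationPreserving} (hf : extend f ∈ thompson) :
    InThompsonF f := by
  obtain ⟨N, hN⟩ := exists_uniform_stdAff hf.1
  have hp : (0 : ℝ) < 2 ^ N := by positivity
  refine ⟨f.2, 2 ^ N, fun i => (i : ℕ) / 2 ^ N, fun i j hij => ?_, by simp, by simp,
    fun i => ⟨(i : ℕ), N, by simp⟩, fun i => ?_⟩
  · have : ((i : ℕ) : ℝ) < (j : ℕ) := by exact_mod_cast hij
    simp only
    gcongr
  · obtain ⟨m, j, h⟩ := hN N le_rfl (i : ℕ) (by omega) (by exact_mod_cast i.2)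
    refine ⟨N - m, j / 2 ^ m - 2 ^ N / 2 ^ m * ((i : ℕ) / 2 ^ N), fun s hs hs' => ?_⟩
    rw [← extend_apply_coe, h s (by simpa using hs) (by simpa using hs'),
      zpow_sub₀ two_ne_zero, zpow_natCast, zpow_natCast]
    push_cast
    ring

lemma extend_mem_trivialGerm_right {f : orientationPreserving} {t : ℝ} (ht : extend f t = t)
    (h : ∀ h01 : t ∈ unitInterval, ¬ IsLeftTransition f ⟨t, h01⟩) :
    extend f ∈ trivialGerm (𝓝[>] t) := by
  rcases lt_or_ge t 0 with h0 | h0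
  · filter_upwards [Ioo_mem_nhdsGT h0] with s hs using extend_apply_of_le_or_ge f (Or.inl hs.2.le)
  rcases le_or_gt 1 t with h1 | h1
  · filter_upwards [self_mem_nhdsWithin] with s hs using
      extend_apply_of_le_or_ge f (Or.inr (h1.trans (mem_Ioi.1 hs).le))
  have h01 : t ∈ unitInterval := ⟨h0, h1.le⟩
  have hsupp : (⟨t, h01⟩ : UI) ∉ supt f := fun hne =>
    hne (Subtype.ext ((extend_apply_of_mem f h01).symm.trans ht))
  have hcon := h h01
  rw [IsLeftTransition] at hcon
  push Not at hcon
  obtain ⟨ε, hε, hcon⟩ := hcon hsupp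
  filter_upwards [Ioo_mem_nhdsGT h1, Ioo_mem_nhdsGT (lt_add_of_pos_right t hε)] with s hs hs'
  have hs01 : s ∈ unitInterval := ⟨h0.trans hs.1.le, hs.2.le⟩
  by_contra hne
  refine (hcon ⟨s, hs01⟩ (fun h' => hne ?_) hs.1).not_gt hs'.2
  rw [extend_apply_of_mem f hs01, h']

lemma extend_mem_trivialGerm_left {f : orientationPreserving} {t : ℝ} (ht : extend f t = t)
    (h : ∀ h01 : t ∈ unitInterval, ¬ IsRightTransition f ⟨t, h01⟩) :
    extend f ∈ trivialGerm (𝓝[<] t) := by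
  rcases lt_or_ge 1 t with h1 | h1
  · filter_upwards [Ioo_mem_nhdsLT h1] with s hs using extend_apply_of_le_or_ge f (Or.inr hs.1.le)
  rcases le_or_gt t 0 with h0 | h0
  · filter_upwards [self_mem_nhdsWithin] with s hs using
      extend_apply_of_le_or_ge f (Or.inl ((mem_Iio.1 hs).le.trans h0))
  have h01 : t ∈ unitInterval := ⟨h0.le, h1⟩
  have hsupp : (⟨t, h01⟩ : UI) ∉ supt f := fun hne =>
    hne (Subtype.ext ((extend_apply_of_mem f h01).symm.trans ht))
  have hcon := h h01
  rw [IsRightTransition] at hcon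
  push Not at hcon
  obtain ⟨ε, hε, hcon⟩ := hcon hsupp
  filter_upwards [Ioo_mem_nhdsLT h0, Ioo_mem_nhdsLT (sub_lt_self t hε)] with s hs hs'
  have hs01 : s ∈ unitInterval := ⟨hs.1.le, hs.2.le.trans h1⟩
  by_contra hne
  refine (hcon ⟨s, hs01⟩ (fun h' => hne ?_) hs.2).not_gt hs'.1
  rw [extend_apply_of_mem f hs01, h']

lemma properFamily_extend {K : Type*} [Group K] {X : Set Homeo01} (hX : GeomProper X)
    {θ : K →* orientationPreserving} (hθ : Function.Injective θ) :
    ProperFamily (extend.comp θ) {k | (θ k : Homeo01) ∈ X} := by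
  intro f hf g hg hfg t hft hgt
  have hne : (θ f : Homeo01) ≠ θ g := fun h => hfg (hθ (Subtype.ext h))
  constructor
  · by_contra! hcon
    have hl : ∀ k, extend (θ k) t = t → extend (θ k) ∉ trivialGerm (𝓝[>] t) →
        ∃ h01 : t ∈ unitInterval, IsLeftTransition (θ k) ⟨t, h01⟩ := fun k hk hk' => by
      by_contra! h
      exact hk' (extend_mem_trivialGerm_right hk h)
    obtain ⟨h01, h1⟩ := hl f hft hcon.1
    obtain ⟨_, h2⟩ := hl g hgt hcon.2
    exact hX.1 _ hf _ hg hne _ ⟨h1, h2⟩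
  · by_contra! hcon
    have hl : ∀ k, extend (θ k) t = t → extend (θ k) ∉ trivialGerm (𝓝[<] t) →
        ∃ h01 : t ∈ unitInterval, IsRightTransition (θ k) ⟨t, h01⟩ := fun k hk hk' => by
      by_contra! h
      exact hk' (extend_mem_trivialGerm_left hk h)
    obtain ⟨h01, h1⟩ := hl f hft hcon.1
    obtain ⟨_, h2⟩ := hl g hgt hcon.2
    exact hX.2 _ hf _ hg hne _ ⟨h1, h2⟩

end PingPong
namespace PingPong

/-- **Theorem (NoGeoProperGen).** If a finite-index subgroup `G` of Thompson's
group `F` is isomorphic to `⟨X⟩` for some finite geometrically proper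
`X ⊆ Homeo₊(I)`, then `G` is isomorphic to `F`. -/
theorem no_geo_proper_gen (G : Subgroup Homeo01)
    (hGF : ∀ g ∈ G, InThompsonF g)
    (hindex : ∃ T : Finset Homeo01, (∀ t ∈ T, InThompsonF t) ∧
      ∀ g : Homeo01, InThompsonF g → ∃ t ∈ T, ∃ h ∈ G, g = t * h)
    (X : Set Homeo01) (hX : ∀ f ∈ X, IsOPH f) (hXfin : X.Finite)
    (hXprop : GeomProper X)
    (hiso : Nonempty (G ≃* Subgroup.closure X)) :
    ∃ φ : G →* Homeo01, Function.Injective ⇑φ ∧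
      (∀ g : G, InThompsonF (φ g)) ∧
      ∀ h : Homeo01, InThompsonF h → ∃ g : G, φ g = h := by
  obtain ⟨ι⟩ := hiso
  obtain ⟨T, hTF, hT⟩ := hindex
  have hGo : G ≤ orientationPreserving := fun g hg => (hGF g hg).1
  have hXo : Subgroup.closure X ≤ orientationPreserving := (Subgroup.closure_le _).2 hX
  set E : G →* (ℝ ≃o ℝ) := extend.comp (Subgroup.inclusion hGo) with hE
  have hEinj : Function.Injective E := extend_injective.comp (Subgroup.inclusion_injective hGo)
  set e : G ≃* E.range := MonoidHom.ofInjective hEinj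
  have hEF : E.range ≤ thompson := by
    rintro _ ⟨g, rfl⟩
    exact extend_mem_thompson (hGF g g.2)
  let κ : E.range ≃* Subgroup.closure X := e.symm.trans ι
  let θ : E.range →* orientationPreserving := (Subgroup.inclusion hXo).comp κ.toMonoidHom
  have hθ : Function.Injective θ := (Subgroup.inclusion_injective hXo).comp κ.injective
  have hcov : ∀ g ∈ thompson, ∃ t ∈ extend '' {t | (t : Homeo01) ∈ T}, t ∈ thompson ∧
      ∃ h ∈ E.range, g = t * h := by
    intro g hg
    obtain ⟨f, rfl⟩ := exists_extend_eq hg.2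
    obtain ⟨t, ht, h, hh, hfth⟩ := hT f (inThompsonF_of_extend_mem hg)
    have hto : t ∈ orientationPreserving := (hTF t ht).1
    refine ⟨extend ⟨t, hto⟩, ⟨_, ht, rfl⟩, extend_mem_thompson (hTF t ht), E ⟨h, hh⟩, ⟨_, rfl⟩, ?_⟩
    rw [hE, MonoidHom.comp_apply, ← map_mul]
    exact congrArg extend (Subtype.ext hfth)
  have hfin : (extend '' {t | (t : Homeo01) ∈ T}).Finite :=
    (T.finite_toSet.preimage Subtype.val_injective.injOn).image _
  have hclos : Subgroup.closure {k | (θ k : Homeo01) ∈ X} = ⊤ := by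
    have h := Subgroup.closure_closure_coe_preimage (k := X)
    have h' := congrArg (Subgroup.map κ.symm.toMonoidHom) h
    rw [MonoidHom.map_closure, Subgroup.map_top_of_surjective _ κ.symm.surjective] at h'
    rw [← h']
    congr 1
    exact (κ.symm.toEquiv.image_eq_preimage_symm (Subtype.val ⁻¹' X)).symm
  obtain ⟨a, b, ha, hb, hab⟩ := eq_slopeSubgroup_of_proper hEF hfin hcov
    (ρ := extend.comp θ) (extend_injective.comp hθ)
    (fun k x hx => extend_apply_of_le_or_ge (θ k) hx) hclos (properFamily_extend hXprop hθ)
  obtain ⟨Ψ, hΨ⟩ := exists_conj_slopeSubgroup ha hb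
  rw [← hab] at hΨ
  let c : G →* extend.range := ((MulAut.conj Ψ).toMonoidHom.comp E).codRestrict extend.range
    fun g => exists_extend_eq ((hΨ (E g)).2 ⟨g, rfl⟩).2
  have hc : ∀ g, (c g : ℝ ≃o ℝ) = Ψ * E g * Ψ⁻¹ := fun g => rfl
  let r : extend.range ≃* orientationPreserving := (MonoidHom.ofInjective extend_injective).symm
  have hr : ∀ x, extend (r x) = x := fun x =>
    congrArg Subtype.val ((MonoidHom.ofInjective extend_injective).apply_symm_apply x)
  refine ⟨orientationPreserving.subtype.comp (r.toMonoidHom.comp c), ?_, fun g => ?_, fun h hh => ?_⟩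
  · refine Subtype.val_injective.comp (r.injective.comp fun g g' hgg => hEinj ?_)
    exact (MulAut.conj Ψ).injective (congrArg Subtype.val hgg)
  · refine inThompsonF_of_extend_mem (f := r (c g)) ?_
    rw [hr, hc]
    exact (hΨ _).2 ⟨g, rfl⟩
  · have hmem : extend ⟨h, hh.1⟩ ∈ thompson := extend_mem_thompson hh
    obtain ⟨g, hg⟩ := (hΨ (Ψ⁻¹ * extend ⟨h, hh.1⟩ * Ψ)).1 (by
      simpa [mul_assoc] using hmem)
    refine ⟨g, congrArg Subtype.val (extend_injective (a₁ := r (c g)) (a₂ := ⟨h, hh.1⟩) ?_)⟩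
    rw [hr, hc, hg]
    simp [mul_assoc]

end PingPong
end

section
/- If A ⊆ Homeo₊(I) is a geometrically fast set of positive bump functions, then there is a geometrically fast set B ⊆ Homeo₊(I) of positive bump functions with A ⊆ B such that no element of B is isolated in B. Moreover, if A is finite then B can be taken to be finite. -/
open Set

namespace PingPong

/-- For `p < m < d < r` there is a positive bump with support `(p, r)` mapping `m` to `d`. -/
lemma exists_isPosBump {p m d r : UI} (hpm : p < m) (hmd : m < d) (hdr : d < r) :
    ∃ f : Homeo01, IsPosBump f ∧ supt f = Ioo p r ∧ f m = d := by
  obtain ⟨p, hp⟩ := p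
  obtain ⟨m, hm⟩ := m
  obtain ⟨d, hd⟩ := d
  obtain ⟨r, hr⟩ := r
  change p < m at hpm
  change m < d at hmd
  change d < r at hdr
  have hα : 1 < (d - p) / (m - p) := by rw [lt_div_iff₀ (by linarith)]; linarith
  have hβ : (r - d) / (r - m) < 1 := by rw [div_lt_one (by linarith)]; linarith
  have hβ0 : 0 < (r - d) / (r - m) := div_pos (by linarith) (by linarith)
  have hL1m : p + (d - p) / (m - p) * (m - p) = d := by
    rw [div_mul_cancel₀ _ (by linarith)]; ring
  have hL2m : r + (r - d) / (r - m) * (m - r) = d := by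
    have : r - m ≠ 0 := by linarith
    field_simp
    ring
  generalize (d - p) / (m - p) = α at *
  generalize (r - d) / (r - m) = β at *
  let F : ℝ → ℝ := fun x => max x (min (p + α * (x - p)) (r + β * (x - r)))
  have hmono : StrictMono F := by
    intro x y hxy
    exact max_lt_max hxy (min_lt_min (by nlinarith) (by nlinarith))
  have hcont : Continuous F := by fun_prop
  have hleft : ∀ x ≤ p, F x = x := fun x hx =>
    max_eq_left ((min_le_left _ _).trans (by nlinarith))
  have hright : ∀ x, r ≤ x → F x = x := fun x hx =>
    max_eq_left ((min_le_right _ _).trans (by nlinarith))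
  have hmid : ∀ x, p < x → x < r → x < F x := fun x hx hx' =>
    lt_max_of_lt_right (lt_min (by nlinarith) (by nlinarith))
  have hFm : F m = d := by
    simp only [F, hL1m, hL2m, min_self]
    exact max_eq_right hmd.le
  have hmaps : ∀ x : UI, F x ∈ unitInterval := fun x =>
    ⟨(hleft 0 hp.1).symm.le.trans (hmono.monotone x.2.1),
      (hmono.monotone x.2.2).trans (hright 1 hr.2).le⟩
  let G : UI → UI := fun x => ⟨F x, hmaps x⟩
  have hGmono : StrictMono G := fun x y hxy => hmono hxy
  have hGcont : Continuous G := (hcont.comp continuous_subtype_val).subtype_mk _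
  have hGsurj : Function.Surjective G := fun y => by
    refine mem_range_of_exists_le_of_exists_ge hGcont ⟨0, ?_⟩ ⟨1, ?_⟩
    · exact (hleft 0 hp.1).le.trans y.2.1
    · exact y.2.2.trans (hright 1 hr.2).ge
  have hsupt : {t | G t ≠ t} = Ioo ⟨p, hp⟩ ⟨r, hr⟩ := by
    ext ⟨x, hx⟩
    simp only [G, mem_ofPred_eq, ne_eq, Subtype.mk.injEq, mem_Ioo, Subtype.mk_lt_mk]
    constructor
    · intro h
      by_contra h'
      rw [not_and_or, not_lt, not_lt] at h'
      exact h'.elim (fun h' => h (hleft x h')) (fun h' => h (hright x h'))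
    · exact fun h => (hmid x h.1 h.2).ne'
  refine ⟨Equiv.ofBijective G ⟨hGmono.injective, hGsurj⟩, ⟨⟨hGmono.monotone, ?_⟩, ?_⟩, hsupt,
    Subtype.ext hFm⟩
  · refine (congrArg IsConnected hsupt).mpr (isConnected_Ioo ?_)
    exact hpm.trans (hmd.trans hdr)
  · intro t ht
    have ht' := hsupt.subset ht
    exact hmid t ht'.1 ht'.2

lemma IsPosBump.exists_supt_eq {f : Homeo01} (hf : IsPosBump f) :
    ∃ p r : UI, p < r ∧ supt f = Ioo p r := by
  obtain ⟨⟨hmono, hconn⟩, hpos⟩ := hf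
  have hp : sInf (supt f) ∉ supt f := fun h => by
    have hlt : f.symm (sInf (supt f)) < sInf (supt f) := by
      by_contra! h'
      have := hmono h'
      rw [Equiv.apply_symm_apply] at this
      exact this.not_gt (hpos _ h)
    refine hlt.not_ge (sInf_le ?_)
    change f (f.symm _) ≠ _
    rw [Equiv.apply_symm_apply]
    exact hlt.ne'
  have hr : sSup (supt f) ∉ supt f := fun h =>
    (hpos _ h).not_ge (le_sSup fun h' => h (f.injective h'))
  have heq : supt f = Ioo (sInf (supt f)) (sSup (supt f)) := by
    refine Subset.antisymm (fun s hs => ⟨?_, ?_⟩)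
      (hconn.Ioo_csInf_csSup_subset (OrderBot.bddBelow _) (OrderTop.bddAbove _))
    · exact (sInf_le hs).lt_of_ne fun h => hp (h ▸ hs)
    · exact (le_sSup hs).lt_of_ne fun h => hr (h ▸ hs)
  obtain ⟨s, hs⟩ := hconn.nonempty
  rw [heq] at hs
  exact ⟨_, _, hs.1.trans hs.2, heq⟩

lemma isTransition_left {f : Homeo01} {p r : UI} (hpr : p < r) (hf : supt f = Ioo p r) :
    IsTransition f p := by
  refine Or.inl ⟨by simp [hf], fun ε hε => ?_⟩
  obtain ⟨s, hs, hs'⟩ : ∃ s : ℝ, (p : ℝ) < s ∧ s < min (r : ℝ) (p + ε) :=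
    exists_between (lt_min hpr (by linarith))
  have hsr := hs'.trans_le (min_le_left _ _)
  refine ⟨⟨s, p.2.1.trans hs.le, hsr.le.trans r.2.2⟩, ?_, hs, hs'.trans_le (min_le_right _ _)⟩
  rw [hf]
  exact ⟨hs, hsr⟩

lemma isTransition_right {f : Homeo01} {p r : UI} (hpr : p < r) (hf : supt f = Ioo p r) :
    IsTransition f r := by
  refine Or.inr ⟨by simp [hf], fun ε hε => ?_⟩
  obtain ⟨s, hs, hs'⟩ : ∃ s : ℝ, max (p : ℝ) (r - ε) < s ∧ s < (r : ℝ) :=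
    exists_between (max_lt hpr (by linarith))
  have hps := (le_max_left _ _).trans_lt hs
  refine ⟨⟨s, p.2.1.trans hps.le, hs'.le.trans r.2.2⟩, ?_, hs', (le_max_right _ _).trans_lt hs⟩
  rw [hf]
  exact ⟨hps, hs'⟩

/-- An indexed family of marked positive bumps with pairwise disjoint feet is geometrically
fast. -/
lemma fastBumps_range {ι : Type*} (F : ι → Homeo01) (M : ι → UI) (hF : ∀ i, IsPosBump (F i))
    (hM : ∀ i, M i ∈ supt (F i))
    (hdisj : ∀ i j k l, (i, k) ≠ (j, l) → Disjoint (foot (F i) (M i) k) (foot (F j) (M j) l)) :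
    FastBumps (range F) := by
  have hinj : Function.Injective F := by
    intro i j hij
    by_contra hne
    obtain ⟨p, r, -, hpr⟩ := (hF i).exists_supt_eq
    have hi := hM i
    have hj := hM j
    rw [← hij] at hj
    rw [hpr] at hi hj
    obtain ⟨z, hz, hz'⟩ := exists_between (lt_min hi.1 hj.1)
    have hzi := hz'.trans_le (min_le_left _ _)
    have hzs : z ∈ supt (F i) := by
      rw [hpr]
      exact ⟨hz, hzi.trans hi.2⟩
    exact disjoint_left.1 (hdisj i j false false (by simp [hne]))
      ⟨hzs, hzi⟩ ⟨hij ▸ hzs, hz'.trans_le (min_le_right _ _)⟩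
  refine ⟨forall_mem_range.2 hF, Function.extend F M 0, forall_mem_range.2 fun i => ?_, ?_⟩
  · rw [hinj.extend_apply]
    exact hM i
  · rintro _ ⟨i, rfl⟩ _ ⟨j, rfl⟩ k l hne
    rw [hinj.extend_apply, hinj.extend_apply]
    refine hdisj i j k l fun h => hne ?_
    simp only [Prod.mk.injEq] at h ⊢
    exact ⟨congrArg F h.1, h.2⟩

/-- An interval `[t, t')` contains the feet of a fast pair of overlapping bumps. -/
lemma exists_overlapping_pair {t t' : UI} (h : t < t') :
    ∃ (b : Bool → Homeo01) (n : Bool → UI), (∀ i, IsPosBump (b i)) ∧ (∀ i, n i ∈ supt (b i)) ∧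
      (∀ i k, foot (b i) (n i) k ⊆ Ico t t') ∧
      (∀ i j k l, (i, k) ≠ (j, l) → Disjoint (foot (b i) (n i) k) (foot (b j) (n j) l)) ∧
      IsTransition (b false) t ∧ ∀ i, ∃ s ∈ supt (b i), ∃ j, IsTransition (b j) s := by
  obtain ⟨m, htm, hmt⟩ := exists_between h
  obtain ⟨d, hmd, hdt⟩ := exists_between hmt
  obtain ⟨r, hdr, hrt⟩ := exists_between hdt
  obtain ⟨b, hb, hbs, hbm⟩ := exists_isPosBump htm hmd hdr
  obtain ⟨c, hc, hcs, hcd⟩ := exists_isPosBump hmd hdr hrt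
  have hb0 : foot b m false = Ioo t m := by
    ext s
    simp only [foot, src, hbs, mem_ofPred_eq, mem_Ioo]
    exact ⟨fun h => ⟨h.1.1, h.2⟩, fun h => ⟨⟨h.1, h.2.trans (hmd.trans hdr)⟩, h.2⟩⟩
  have hb1 : foot b m true = Ico d r := by
    ext s
    simp only [foot, dest, hbs, hbm, mem_ofPred_eq, mem_Ioo, mem_Ico]
    exact ⟨fun h => ⟨h.2, h.1.2⟩, fun h => ⟨⟨(htm.trans hmd).trans_le h.1, h.2⟩, h.1⟩⟩
  have hc0 : foot c d false = Ioo m d := by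
    ext s
    simp only [foot, src, hcs, mem_ofPred_eq, mem_Ioo]
    exact ⟨fun h => ⟨h.1.1, h.2⟩, fun h => ⟨⟨h.1, h.2.trans hdt⟩, h.2⟩⟩
  have hc1 : foot c d true = Ico r t' := by
    ext s
    simp only [foot, dest, hcs, hcd, mem_ofPred_eq, mem_Ioo, mem_Ico]
    exact ⟨fun h => ⟨h.2, h.1.2⟩, fun h => ⟨⟨(hmd.trans hdr).trans_le h.1, h.2⟩, h.1⟩⟩
  refine ⟨fun i => cond i c b, fun i => cond i d m, ?_, ?_, ?_, ?_, ?_, ?_⟩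
  · rintro (_ | _)
    exacts [hb, hc]
  · rintro (_ | _)
    · exact hbs ▸ ⟨htm, hmd.trans hdr⟩
    · exact hcs ▸ ⟨hmd, hdt⟩
  · rintro (_ | _) (_ | _) s hs <;> simp only [cond_true, cond_false, hb0, hb1, hc0, hc1] at hs
    · exact ⟨hs.1.le, hs.2.trans hmt⟩
    · exact ⟨(htm.trans hmd).le.trans hs.1, hs.2.trans hrt⟩
    · exact ⟨htm.le.trans hs.1.le, hs.2.trans hdt⟩
    · exact ⟨(htm.trans (hmd.trans hdr)).le.trans hs.1, hs.2⟩
  · rintro (_ | _) (_ | _) (_ | _) (_ | _) hne <;> first | exact absurd rfl hne | skip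
    all_goals
      simp only [cond_true, cond_false, hb0, hb1, hc0, hc1]
      rw [disjoint_left]
      intro s hs hs'
      simp only [mem_Ioo, mem_Ico] at hs hs'
      order
  · exact isTransition_left (htm.trans (hmd.trans hdr)) hbs
  · rintro (_ | _)
    · exact ⟨m, hbs ▸ ⟨htm, hmd.trans hdr⟩, true, isTransition_left hmt hcs⟩
    · exact ⟨r, hcs ▸ ⟨hmd.trans hdr, hrt⟩, false,
        isTransition_right (htm.trans (hmd.trans hdr)) hbs⟩

section Isolated

variable {A : Set Homeo01} {m : Homeo01 → UI} {a b : Homeo01}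

lemma IsolatedIn.disjoint_foot (hA : ∀ a ∈ A, IsPosBump a) (hm : IsMarking A m)
    (hd : FeetDisjoint A m) (ha : a ∈ A) (hb : b ∈ A) (hab : a ≠ b) (hi : IsolatedIn A a)
    (k : Bool) : Disjoint (supt a) (foot b (m b) k) := by
  obtain ⟨x, y, -, hxy⟩ := (hA a ha).exists_supt_eq
  obtain ⟨u, v, huv, huvs⟩ := (hA b hb).exists_supt_eq
  have hu : u ∉ Ioo x y := fun h => hi u (hxy ▸ h) b hb (isTransition_left huv huvs)
  have hv : v ∉ Ioo x y := fun h => hi v (hxy ▸ h) b hb (isTransition_right huv huvs)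
  have hma : m a ∈ Ioo x y := hxy ▸ hm a ha
  have hfa : a (m a) < y := by
    have : a (m a) ∈ supt a := fun h => hm a ha (a.injective h)
    rw [hxy] at this
    exact this.2
  have hmf := (hA a ha).2 _ (hm a ha)
  rw [disjoint_left]
  intro s hs hs'
  have hdab := disjoint_left.1 (hd a ha b hb k k (by simp [hab]))
  rw [hxy] at hs
  cases k
  · obtain ⟨hsb, hsm⟩ : s ∈ supt b ∧ s < m b := hs'
    rw [huvs] at hsb
    have hux : u ≤ x := not_lt.1 fun h => hu ⟨h, hsb.1.trans hs.2⟩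
    obtain ⟨z, hz, hz'⟩ := exists_between (lt_min hma.1 hs.1)
    obtain ⟨hz1, hz2⟩ := lt_min_iff.1 hz'
    have hza : z ∈ supt a := hxy ▸ ⟨hz, hz1.trans hma.2⟩
    have hzb : z ∈ supt b := huvs ▸ ⟨hux.trans_lt hz, hz2.trans hsb.2⟩
    exact hdab ⟨hza, hz1⟩ ⟨hzb, hz2.trans hsm⟩
  · obtain ⟨hsb, hsm⟩ : s ∈ supt b ∧ b (m b) ≤ s := hs'
    rw [huvs] at hsb
    have hyv : y ≤ v := not_lt.1 fun h => hv ⟨hs.1.trans hsb.2, h⟩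
    have hz : max s (a (m a)) < y := max_lt hs.2 hfa
    have hza : max s (a (m a)) ∈ supt a := hxy ▸ ⟨lt_max_of_lt_left hs.1, hz⟩
    have hzb : max s (a (m a)) ∈ supt b := huvs ▸ ⟨lt_max_of_lt_left hsb.1, hz.trans_le hyv⟩
    exact hdab ⟨hza, le_max_right _ _⟩ ⟨hzb, hsm.trans (le_max_left _ _)⟩

lemma IsolatedIn.disjoint_supt (hA : ∀ a ∈ A, IsPosBump a) (hm : IsMarking A m)
    (hd : FeetDisjoint A m) (ha : a ∈ A) (hb : b ∈ A) (hab : a ≠ b) (hia : IsolatedIn A a)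
    (hib : IsolatedIn A b) : Disjoint (supt a) (supt b) := by
  obtain ⟨x, y, hxy, hxys⟩ := (hA a ha).exists_supt_eq
  obtain ⟨u, v, huv, huvs⟩ := (hA b hb).exists_supt_eq
  have hu : u ∉ Ioo x y := fun h => hia u (hxys ▸ h) b hb (isTransition_left huv huvs)
  have hx : x ∉ Ioo u v := fun h => hib x (huvs ▸ h) a ha (isTransition_left hxy hxys)
  have hmb : m b ∈ Ioo u v := huvs ▸ hm b hb
  rw [disjoint_left]
  intro s hs hs'
  rw [hxys] at hs
  rw [huvs] at hs'
  have hux : u ≤ x := not_lt.1 fun h => hu ⟨h, hs'.1.trans hs.2⟩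
  have hxu : x ≤ u := not_lt.1 fun h => hx ⟨h, hs.1.trans hs'.2⟩
  obtain ⟨z, hz, hz'⟩ := exists_between (lt_min hmb.1 hs'.1)
  obtain ⟨hz1, hz2⟩ := lt_min_iff.1 hz'
  have hza : z ∈ supt a := hxys ▸ ⟨hxu.trans_lt hz, hz2.trans hs.2⟩
  have hzb : z ∈ supt b := huvs ▸ ⟨hz, hz1.trans hmb.2⟩
  exact disjoint_left.1 (hia.disjoint_foot hA hm hd ha hb hab false) hza ⟨hzb, hz1⟩

lemma Ico_marker_subset_supt (ha : IsPosBump a) {t : UI} (ht : t ∈ supt a) :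
    Ico t (a t) ⊆ supt a := by
  obtain ⟨x, y, -, hxy⟩ := ha.exists_supt_eq
  have h : a t ∈ supt a := fun h => ht (a.injective h)
  rw [hxy] at ht h ⊢
  exact fun s hs => ⟨ht.1.trans_le hs.1, hs.2.trans h.2⟩

lemma disjoint_Ico_marker_foot (a : Homeo01) (t : UI) (k : Bool) :
    Disjoint (Ico t (a t)) (foot a t k) := by
  rw [disjoint_left]
  intro s hs hs'
  cases k
  · exact hs'.2.not_ge hs.1
  · exact hs.2.not_ge hs'.2

end Isolated

/-- **Proposition (IsolatedFixProp).** Every geometrically fast set of positive bump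
functions extends to a geometrically fast set of positive bump functions with no
isolated bumps; the extension may be taken finite if the original set is finite. -/
theorem isolated_fix (A : Set Homeo01) (hA : FastBumps A) :
    ∃ B : Set Homeo01, A ⊆ B ∧ FastBumps B ∧
      (∀ b ∈ B, ¬ IsolatedIn B b) ∧ (A.Finite → B.Finite) := by
  obtain ⟨hpos, m, hm, hd⟩ := hA
  have hex := fun a : {a : A // IsolatedIn A a} =>
    exists_overlapping_pair (hpos a.1 a.1.2 |>.2 _ (hm a.1 a.1.2))
  choose b n hb hn hsub hdisj htrans hover using hex
  have hgap : ∀ (a : {a : A // IsolatedIn A a}) (c : A) i k l,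
      Disjoint (foot (b a i) (n a i) k) (foot c.1 (m c.1) l) := by
    intro a c i k l
    refine Disjoint.mono_left (hsub a i k) ?_
    by_cases hac : a.1 = c
    · rw [hac]
      exact disjoint_Ico_marker_foot _ _ _
    · exact (a.2.disjoint_foot hpos hm hd a.1.2 c.2 (fun h => hac (Subtype.ext h)) l).mono_left
        (Ico_marker_subset_supt (hpos _ a.1.2) (hm _ a.1.2))
  let F : A ⊕ ({a : A // IsolatedIn A a} × Bool) → Homeo01 :=
    Sum.elim (fun a => a.1) fun p => b p.1 p.2
  let M : A ⊕ ({a : A // IsolatedIn A a} × Bool) → UI :=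
    Sum.elim (fun a => m a.1) fun p => n p.1 p.2
  refine ⟨range F, fun a ha => ⟨Sum.inl ⟨a, ha⟩, rfl⟩, fastBumps_range F M ?_ ?_ ?_, ?_, ?_⟩
  · rintro (a | ⟨a, i⟩)
    exacts [hpos _ a.2, hb a i]
  · rintro (a | ⟨a, i⟩)
    exacts [hm _ a.2, hn a i]
  · rintro (a | ⟨a, i⟩) (c | ⟨c, j⟩) k l hne
    · refine hd _ a.2 _ c.2 k l fun h => hne ?_
      simp only [Prod.mk.injEq] at h
      rw [Subtype.ext h.1, h.2]
    · exact (hgap c a j l k).symm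
    · exact hgap a c i k l
    · by_cases hac : a = c
      · subst hac
        refine hdisj a i j k l fun h => hne ?_
        simp only [Prod.mk.injEq] at h
        rw [h.1, h.2]
      · refine (a.2.disjoint_supt hpos hm hd a.1.2 c.1.2
          (fun h => hac (Subtype.ext (Subtype.ext h))) c.2).mono ?_ ?_
        · exact (hsub a i k).trans (Ico_marker_subset_supt (hpos _ a.1.2) (hm _ a.1.2))
        · exact (hsub c j l).trans (Ico_marker_subset_supt (hpos _ c.1.2) (hm _ c.1.2))
  · rintro _ ⟨a | ⟨a, i⟩, rfl⟩ hiso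
    · by_cases ha : IsolatedIn A a
      · exact hiso (m a) (hm _ a.2) _ ⟨Sum.inr (⟨a, ha⟩, false), rfl⟩ (htrans ⟨a, ha⟩)
      · exact ha fun t ht c hc => hiso t ht c ⟨Sum.inl ⟨c, hc⟩, rfl⟩
    · obtain ⟨s, hs, j, hj⟩ := hover a i
      exact hiso s hs _ ⟨Sum.inr (a, j), rfl⟩ hj
  · intro hfin
    have := hfin.to_subtype
    exact finite_range F

end PingPong
end
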